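/- Let (q,r) and (q̃,r̃) be admissible pairs in ℝ². There is a constant C, depending only on q, r, q̃, r̃ and not on T, such that for every T > 0, every smooth function u : ℝ × ℝ² → ℂ with u(t,·) Schwartz for each t ∈ [0,T], and every smooth G : ℝ × ℝ² → ℂ with G(t,·) Schwartz for each t ∈ [0,T], if i∂ₜu(t,x) + Δu(t,x) = G(t,x) for all (t,x) ∈ [0,T] × ℝ², then ‖u‖_{L^q_{[0,T]}L^r_x} ≤ C (‖u(0,·)‖_{L²(ℝ²)} + ‖G‖_{L^{q̃′}_{[0,T]}L^{r̃′}_x}), where q̃′ and r̃′ denote the Hölder conjugate exponents of q̃ and r̃. -/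

import Mathlib

open MeasureTheory Real Complex
open scoped FourierTransform ENNReal ContDiff

noncomputable section

/-- The `j`-th partial derivative of a function on `EuclideanSpace ℝ (Fin n)`. -/
def pd {n : ℕ} {F : Type*} [NormedAddCommGroup F] [NormedSpace ℝ F]
    (j : Fin n) (f : EuclideanSpace ℝ (Fin n) → F) (x : EuclideanSpace ℝ (Fin n)) : F :=
  fderiv ℝ f x (EuclideanSpace.single j 1)

/-- The Laplacian. -/
def lap {n : ℕ} {F : Type*} [NormedAddCommGroup F] [NormedSpace ℝ F]
    (f : EuclideanSpace ℝ (Fin n) → F) (x : EuclideanSpace ℝ (Fin n)) : F :=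
  ∑ j, pd j (pd j f) x

/-- `f` coincides with a (complex-valued) Schwartz function. -/
def IsSchwartz {n : ℕ} (f : EuclideanSpace ℝ (Fin n) → ℂ) : Prop :=
  ∃ g : SchwartzMap (EuclideanSpace ℝ (Fin n)) ℂ, ⇑g = f

/-- `f` coincides with a (real-valued) Schwartz function. -/
def IsSchwartzR {n : ℕ} (f : EuclideanSpace ℝ (Fin n) → ℝ) : Prop :=
  ∃ g : SchwartzMap (EuclideanSpace ℝ (Fin n)) ℝ, ⇑g = f

/-- A (smooth, spatially Schwartz) solution of the defocusing cubic NLS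
`i ∂ₜ u + Δ u = |u|² u` on `[0,T] × ℝⁿ`. -/
def IsNLSSolution (n : ℕ) (T : ℝ) (u : ℝ → EuclideanSpace ℝ (Fin n) → ℂ) : Prop :=
  ContDiff ℝ ∞ (Function.uncurry u) ∧
  (∀ t ∈ Set.Icc (0:ℝ) T, IsSchwartz (u t)) ∧
  (∀ t ∈ Set.Icc (0:ℝ) T, ∀ x, Complex.I * deriv (fun s => u s x) t + lap (u t) x
      = (‖u t x‖ : ℂ)^2 * u t x)

/-- Inhomogeneous Sobolev norm via the Fourier transform. -/
def HsNorm {n : ℕ} (σ : ℝ) (f : EuclideanSpace ℝ (Fin n) → ℂ) : ℝ :=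
  (∫ ξ, (1 + ‖ξ‖) ^ (2 * σ) * ‖𝓕 f ξ‖ ^ 2) ^ ((1:ℝ)/2)

/-- Homogeneous Sobolev norm via the Fourier transform. -/
def HdotNorm {n : ℕ} (σ : ℝ) (f : EuclideanSpace ℝ (Fin n) → ℂ) : ℝ :=
  (∫ ξ, ‖ξ‖ ^ (2 * σ) * ‖𝓕 f ξ‖ ^ 2) ^ ((1:ℝ)/2)

/-- The Fourier multiplier operator with (real) symbol `m`. -/
def fourierMult {n : ℕ} (m : EuclideanSpace ℝ (Fin n) → ℝ) (f : EuclideanSpace ℝ (Fin n) → ℂ) :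
    EuclideanSpace ℝ (Fin n) → ℂ :=
  𝓕⁻ (fun ξ => (m ξ : ℂ) * 𝓕 f ξ)

/-- The standing hypotheses on the radial profile `φ` of the symbol of the smoothing
operator `I = I_N`, with derivative-bound constants `Ck` (independent of `N`). -/
structure IMultiplier (s N : ℝ) (Ck : ℕ → ℝ) (φ : ℝ → ℝ) : Prop where
  contDiff : ContDiffOn ℝ ∞ φ (Set.Ioi 0)
  pos : ∀ r > (0:ℝ), 0 < φ r
  le_one : ∀ r > (0:ℝ), φ r ≤ 1
  anti : AntitoneOn φ (Set.Ioi 0)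
  eq_one : ∀ r : ℝ, 0 < r → r ≤ N → φ r = 1
  eq_pow : ∀ r : ℝ, 2 * N ≤ r → φ r = (r / N) ^ (s - 1)
  mono_mul : MonotoneOn (fun r => r * φ r) (Set.Ioi 0)
  deriv_bound : ∀ k : ℕ, 1 ≤ k → ∀ r > (0:ℝ), |iteratedDeriv k φ r| ≤ Ck k * φ r * r ^ (-(k:ℝ))

/-- The smoothing operator `I = I_N`, a Fourier multiplier with symbol `φ (|ξ|)`. -/
def Iop {n : ℕ} (φ : ℝ → ℝ) (f : EuclideanSpace ℝ (Fin n) → ℂ) : EuclideanSpace ℝ (Fin n) → ℂ :=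
  fourierMult (fun ξ => φ ‖ξ‖) f

/-- The operator `⟨D⟩ I_N`, a Fourier multiplier with symbol `(1 + |ξ|) φ (|ξ|)`. -/
def DIop {n : ℕ} (φ : ℝ → ℝ) (f : EuclideanSpace ℝ (Fin n) → ℂ) : EuclideanSpace ℝ (Fin n) → ℂ :=
  fourierMult (fun ξ => (1 + ‖ξ‖) * φ ‖ξ‖) f

/-- Mixed space-time norm `‖v‖_{L^q_{[0,T]} L^r_x}` (with values in `ℝ≥0∞`). -/
def mixNorm {α : Type*} [MeasureSpace α] {F : Type*} [NormedAddCommGroup F]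
    (T : ℝ) (q r : ℝ≥0∞) (v : ℝ → α → F) : ℝ≥0∞ :=
  eLpNorm (fun t => (eLpNorm (v t) r volume).toReal) q (volume.restrict (Set.Ioc 0 T))

/-- An admissible pair in `ℝ²`: `1/q + 1/r = 1/2` and `2 < q ≤ ∞`. -/
def Admissible (q r : ℝ≥0∞) : Prop := 1/q + 1/r = 1/2 ∧ 2 < q

/-- The `L²` norm. -/
def L2Norm {n : ℕ} (f : EuclideanSpace ℝ (Fin n) → ℂ) : ℝ :=
  (∫ x, ‖f x‖ ^ 2) ^ ((1:ℝ)/2)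

/-- The `L²` norm of the (spatial) gradient. -/
def gradL2Norm {n : ℕ} (f : EuclideanSpace ℝ (Fin n) → ℂ) : ℝ :=
  (∫ x, ∑ j, ‖pd j f x‖ ^ 2) ^ ((1:ℝ)/2)

/-- Space-time `L⁴_{[0,T]} L⁴_x` norm (real-valued). -/
def L4L4Norm {n : ℕ} (T : ℝ) (v : ℝ → EuclideanSpace ℝ (Fin n) → ℂ) : ℝ :=
  (∫ t in Set.Ioc (0:ℝ) T, ∫ x, ‖v t x‖ ^ 4) ^ ((1:ℝ)/4)

/-- The modified energy `E(v) = ½∫|∇v|² + ¼∫|v|⁴`. -/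
def energy {n : ℕ} (v : EuclideanSpace ℝ (Fin n) → ℂ) : ℝ :=
  (1/2) * (∫ x, ∑ j, ‖pd j v x‖ ^ 2) + (1/4) * ∫ x, ‖v x‖ ^ 4

/-- The Morawetz action `M_a(t) = 2 ∫ ∇a · Im (ū ∇u) dx`. -/
def morAction {n : ℕ} (a : EuclideanSpace ℝ (Fin n) → ℝ)
    (u : ℝ → EuclideanSpace ℝ (Fin n) → ℂ) (t : ℝ) : ℝ :=
  2 * ∫ x, ∑ j, pd j a x * ((starRingEnd ℂ) (u t x) * pd j (u t) x).im

/-- All derivatives of `a` grow at most polynomially. -/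
def PolyGrowth {n : ℕ} (a : EuclideanSpace ℝ (Fin n) → ℝ) : Prop :=
  ∀ k : ℕ, ∃ C d : ℝ, ∀ x, ‖iteratedFDeriv ℝ k a x‖ ≤ C * (1 + ‖x‖) ^ d

/-- The kernel of the complex-time heat semigroup `exp (z Δ)` on `ℝ²`. -/
def heatKer (z : ℂ) (x : EuclideanSpace ℝ (Fin 2)) : ℂ :=
  (4 * π * z)⁻¹ * cexp (-(4 * z)⁻¹ * (‖x‖ : ℂ) ^ 2)

lemma heatKer_neg (z : ℂ) (x : EuclideanSpace ℝ (Fin 2)) : heatKer z (-x) = heatKer z x := by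
  simp [heatKer]

lemma heatKer_sub_comm (z : ℂ) (x y : EuclideanSpace ℝ (Fin 2)) :
    heatKer z (x - y) = heatKer z (y - x) := by
  rw [← heatKer_neg, neg_sub]

lemma measurable_heatKer :
    Measurable (fun p : ℂ × EuclideanSpace ℝ (Fin 2) => heatKer p.1 p.2) := by
  unfold heatKer
  fun_prop

lemma continuous_heatKer (z : ℂ) : Continuous (heatKer z) := by
  unfold heatKer
  fun_prop

lemma re_inv_four_mul (z : ℂ) : ((4 * z)⁻¹).re = z.re / (4 * ‖z‖ ^ 2) := by
  rw [Complex.inv_re, Complex.normSq_eq_norm_sq]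
  by_cases hz : z = 0
  · simp [hz]
  · have : ‖z‖ ≠ 0 := by simpa using hz
    simp
    field_simp

lemma norm_heatKer (z : ℂ) (x : EuclideanSpace ℝ (Fin 2)) :
    ‖heatKer z x‖ = (4 * π * ‖z‖)⁻¹ * rexp (-(z.re / (4 * ‖z‖ ^ 2)) * ‖x‖ ^ 2) := by
  have h : (-(4 * z)⁻¹ * (‖x‖ : ℂ) ^ 2).re = -(z.re / (4 * ‖z‖ ^ 2)) * ‖x‖ ^ 2 := by
    rw [← re_inv_four_mul, ← Complex.ofReal_pow, Complex.re_mul_ofReal, Complex.neg_re]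
  rw [heatKer, norm_mul, Complex.norm_exp, h]
  simp [abs_of_pos Real.pi_pos]

lemma norm_heatKer_le {z : ℂ} (hz : 0 ≤ z.re) (x : EuclideanSpace ℝ (Fin 2)) :
    ‖heatKer z x‖ ≤ (4 * π * ‖z‖)⁻¹ := by
  rw [norm_heatKer]
  apply mul_le_of_le_one_right (by positivity)
  apply Real.exp_le_one_iff.2
  have : 0 ≤ (z.re / (4 * ‖z‖ ^ 2)) * ‖x‖ ^ 2 := by positivity
  linarith

lemma conj_heatKer (z : ℂ) (x : EuclideanSpace ℝ (Fin 2)) :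
    (starRingEnd ℂ) (heatKer z x) = heatKer ((starRingEnd ℂ) z) x := by
  simp [heatKer, ← Complex.exp_conj, map_ofNat]

lemma integrable_heatKer {z : ℂ} (hz : 0 < z.re) : Integrable (heatKer z) := by
  have hz0 : z ≠ 0 := by rintro rfl; simp at hz
  have h : 0 < ((4 * z)⁻¹).re := by
    rw [re_inv_four_mul]
    have : 0 < ‖z‖ := norm_pos_iff.2 hz0
    positivity
  have := (GaussianFourier.integrable_cexp_neg_mul_sq_norm_add h 0
    (0 : EuclideanSpace ℝ (Fin 2))).const_mul (4 * π * z)⁻¹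
  refine this.congr (Filter.Eventually.of_forall fun x => ?_)
  simp [heatKer]

lemma integral_heatKer_mul {z w : ℂ} (hz : 0 < z.re) (hw : 0 < w.re)
    (y y' : EuclideanSpace ℝ (Fin 2)) :
    ∫ x, heatKer z (x - y) * heatKer w (x - y') = heatKer (z + w) (y - y') := by
  have hz0 : z ≠ 0 := by rintro rfl; simp at hz
  have hw0 : w ≠ 0 := by rintro rfl; simp at hw
  have hzw0 : z + w ≠ 0 := by
    intro h
    have := congrArg Complex.re h
    simp at this
    linarith
  have hz1 : 0 < ((4 * z)⁻¹).re := by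
    rw [re_inv_four_mul]
    have : 0 < ‖z‖ := norm_pos_iff.2 hz0
    positivity
  have hw1 : 0 < ((4 * w)⁻¹).re := by
    rw [re_inv_four_mul]
    have : 0 < ‖w‖ := norm_pos_iff.2 hw0
    positivity
  have hb : 0 < ((4 * z)⁻¹ + (4 * w)⁻¹).re := by
    rw [Complex.add_re]; exact add_pos hz1 hw1
  rw [← integral_add_right_eq_self _ y]
  set d := y - y' with hd
  have key := GaussianFourier.integral_cexp_neg_mul_sq_norm_add hb (-2 * (4 * w)⁻¹) d
  have hpt : ∀ x : EuclideanSpace ℝ (Fin 2),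
      heatKer z (x + y - y) * heatKer w (x + y - y') =
      ((4 * π * z)⁻¹ * (4 * π * w)⁻¹ * cexp (-(4 * w)⁻¹ * (‖d‖ : ℂ) ^ 2)) *
        cexp (-((4 * z)⁻¹ + (4 * w)⁻¹) * (‖x‖ : ℂ) ^ 2 + (-2 * (4 * w)⁻¹) * (inner ℝ d x : ℝ)) := by
    intro x
    have h1 : x + y - y = x := by abel
    have h2 : x + y - y' = d + x := by rw [hd]; abel
    have h3 : ((‖d + x‖ : ℝ) : ℂ) ^ 2 = (‖d‖ : ℂ) ^ 2 + 2 * (inner ℝ d x : ℝ) + (‖x‖ : ℂ) ^ 2 := by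
      have := norm_add_sq_real d x
      exact_mod_cast this
    rw [h1, h2, heatKer, heatKer, h3]
    rw [show ∀ a b c e : ℂ, a * b * (c * e) = (a * c) * (b * e) from fun _ _ _ _ => by ring,
      ← Complex.exp_add, mul_assoc ((4 * (π : ℂ) * z)⁻¹ * _), ← Complex.exp_add]
    congr 2
    ring
  simp_rw [hpt]
  rw [integral_const_mul, key, heatKer]
  simp only [finrank_euclideanSpace, Fintype.card_fin, Nat.cast_ofNat]
  rw [show ((2 : ℂ) / 2) = 1 by norm_num, Complex.cpow_one]
  rw [show ∀ a b c e : ℂ, a * b * (c * e) = (a * c) * (b * e) from fun _ _ _ _ => by ring,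
    ← Complex.exp_add]
  have hpi : (π : ℂ) ≠ 0 := by exact_mod_cast Real.pi_ne_zero
  have hwz0 : w + z ≠ 0 := by rwa [add_comm]
  congr 1
  · field_simp
    ring
  · congr 1
    field_simp
    ring

lemma integral_heatKer {z : ℂ} (hz : 0 < z.re) : ∫ x, heatKer z x = 1 := by
  have hz0 : z ≠ 0 := by rintro rfl; simp at hz
  have h : 0 < ((4 * z)⁻¹).re := by
    rw [re_inv_four_mul]
    have : 0 < ‖z‖ := norm_pos_iff.2 hz0
    positivity
  have := GaussianFourier.integral_cexp_neg_mul_sq_norm (V := EuclideanSpace ℝ (Fin 2)) h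
  simp only [heatKer]
  rw [integral_const_mul, this]
  simp only [finrank_euclideanSpace, Fintype.card_fin, Nat.cast_ofNat]
  rw [show ((2 : ℂ) / 2) = 1 by norm_num, Complex.cpow_one]
  have hpi : (π : ℂ) ≠ 0 := by exact_mod_cast Real.pi_ne_zero
  field_simp

lemma norm_heatKer_ofReal {ε : ℝ} (hε : 0 < ε) (x : EuclideanSpace ℝ (Fin 2)) :
    (‖heatKer ε x‖ : ℂ) = heatKer ε x := by
  have : ‖(ε : ℂ)‖ = ε := by simp [abs_of_pos hε]
  rw [norm_heatKer, this, heatKer]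
  push_cast
  simp only [Complex.ofReal_re]
  congr 3
  field_simp

lemma integral_norm_heatKer_ofReal {ε : ℝ} (hε : 0 < ε) :
    ∫ x, ‖heatKer ε x‖ = 1 := by
  have h := integral_heatKer (z := ε) (by simpa using hε)
  have h2 : ∫ x, heatKer ε x = ((∫ x, ‖heatKer ε x‖ : ℝ) : ℂ) := by
    rw [← integral_complex_ofReal]
    exact integral_congr_ae (Filter.Eventually.of_forall fun x => (norm_heatKer_ofReal hε x).symm)
  rw [h2] at h
  exact_mod_cast h

lemma enorm_integral_mul_le_eLpNorm' {α : Type*} [MeasurableSpace α] {μ : Measure α} {p q : ℝ}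
    (hpq : p.HolderConjugate q) {f g : α → ℂ} (hf : Measurable f) (hg : Measurable g) :
    ‖∫ x, f x * g x ∂μ‖ₑ ≤ eLpNorm' f p μ * eLpNorm' g q μ := by
  refine (enorm_integral_le_lintegral_enorm _).trans ?_
  simp only [enorm_mul]
  exact ENNReal.lintegral_mul_le_Lp_mul_Lq μ hpq hf.enorm.aemeasurable hg.enorm.aemeasurable

/-- The `T T*` identity for an integral operator with bounded kernel. -/
lemma integral_norm_sq_integral_mul {α X : Type*} [MeasurableSpace α] [MeasurableSpace X]
    {m : Measure α} {μ : Measure X}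
    [SFinite m] [SFinite μ] {k : X → α → ℂ}
    (hk : Measurable (Function.uncurry k)) {κ L : ℝ} (hκ0 : 0 ≤ κ) (hκ : ∀ x a, ‖k x a‖ ≤ κ)
    (hki : ∀ a, Integrable (fun x => k x a) μ) (hL : ∀ a, ∫ x, ‖k x a‖ ∂μ ≤ L)
    {F : α → ℂ} (hFm : Measurable F) (hF : Integrable F m) :
    Integrable (fun x => ‖∫ a, k x a * F a ∂m‖ ^ 2) μ ∧
    ((∫ x, ‖∫ a, k x a * F a ∂m‖ ^ 2 ∂μ : ℝ) : ℂ) =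
      ∫ p, (F p.1 * (starRingEnd ℂ) (F p.2)) *
        (∫ x, k x p.1 * (starRingEnd ℂ) (k x p.2) ∂μ) ∂(m.prod m) := by
  set H : X → α × α → ℂ := fun x p =>
    (k x p.1 * F p.1) * (starRingEnd ℂ) (k x p.2 * F p.2) with hH
  have hconj : Measurable (starRingEnd ℂ) := Complex.continuous_conj.measurable
  have hHm : Measurable (Function.uncurry H) := by
    have h1 : Measurable (fun q : X × α × α => k q.1 q.2.1) :=
      hk.comp (measurable_fst.prodMk (measurable_fst.comp measurable_snd))
    have h2 : Measurable (fun q : X × α × α => k q.1 q.2.2) :=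
      hk.comp (measurable_fst.prodMk (measurable_snd.comp measurable_snd))
    have h3 : Measurable (fun q : X × α × α => F q.2.1) := by fun_prop
    have h4 : Measurable (fun q : X × α × α => F q.2.2) := by fun_prop
    exact (h1.mul h3).mul (hconj.comp (h2.mul h4))
  have hsq : ∀ x, ∫ p, H x p ∂(m.prod m) = ((‖∫ a, k x a * F a ∂m‖ ^ 2 : ℝ) : ℂ) := by
    intro x
    rw [hH]
    simp only
    rw [integral_prod_mul (fun a => k x a * F a) (fun a => (starRingEnd ℂ) (k x a * F a)),
      integral_conj, Complex.mul_conj, Complex.normSq_eq_norm_sq]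
  have hHi : Integrable (Function.uncurry H) (μ.prod (m.prod m)) := by
    rw [integrable_prod_iff' hHm.aestronglyMeasurable]
    constructor
    · refine Filter.Eventually.of_forall fun p => ?_
      have : Integrable (fun x => k x p.1 * (F p.1 * (starRingEnd ℂ) (k x p.2 * F p.2))) μ := by
        refine (hki p.1).mul_bdd (c := ‖F p.1‖ * (κ * ‖F p.2‖)) ?_ ?_
        · have h2 : Measurable (fun x => k x p.2) := hk.comp (measurable_id.prodMk measurable_const)
          exact (measurable_const.mul (hconj.comp (h2.mul_const _))).aestronglyMeasurable
        · refine Filter.Eventually.of_forall fun x => ?_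
          simp only [norm_mul, RCLike.norm_conj]
          gcongr
          exact hκ _ _
      refine this.congr (Filter.Eventually.of_forall fun x => ?_)
      simp [hH, mul_assoc]
    · have hdom : Integrable (fun p : α × α => (κ * L) * (‖F p.1‖ * ‖F p.2‖)) (m.prod m) :=
        (hF.norm.mul_prod hF.norm).const_mul _
      refine hdom.mono' ?_ ?_
      · exact (hHm.norm.stronglyMeasurable.integral_prod_left').aestronglyMeasurable
      · refine Filter.Eventually.of_forall fun p => ?_
        have hi := (hki p.1).norm.mul_const (κ * (‖F p.1‖ * ‖F p.2‖))
        rw [Real.norm_of_nonneg (integral_nonneg fun _ => norm_nonneg _)]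
        calc ∫ x, ‖Function.uncurry H (x, p)‖ ∂μ
            ≤ ∫ x, ‖k x p.1‖ * (κ * (‖F p.1‖ * ‖F p.2‖)) ∂μ := by
              refine integral_mono_of_nonneg (Filter.Eventually.of_forall fun _ => norm_nonneg _) hi
                (Filter.Eventually.of_forall fun x => ?_)
              simp only [Function.uncurry, hH, norm_mul, RCLike.norm_conj]
              calc _ = ‖k x p.1‖ * (‖k x p.2‖ * (‖F p.1‖ * ‖F p.2‖)) := by ring
                _ ≤ _ := by gcongr; exact hκ _ _
          _ = (∫ x, ‖k x p.1‖ ∂μ) * (κ * (‖F p.1‖ * ‖F p.2‖)) := integral_mul_const _ _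
          _ ≤ L * (κ * (‖F p.1‖ * ‖F p.2‖)) := by
              gcongr; exact hL _
          _ = _ := by ring
  constructor
  · have := hHi.integral_prod_left
    simp only [Function.uncurry] at this
    simp_rw [hsq] at this
    refine this.re.congr (Filter.Eventually.of_forall fun x => ?_)
    exact Complex.ofReal_re _
  · rw [← integral_complex_ofReal]
    simp_rw [← hsq]
    rw [integral_integral_swap hHi]
    refine integral_congr_ae (Filter.Eventually.of_forall fun p => ?_)
    simp only [hH]
    rw [← integral_const_mul]
    congr 1
    ext x
    simp only [map_mul]
    ring

/-- The complex-time heat operator `exp (z Δ)` on `ℝ²`. -/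
def heatOp (z : ℂ) (f : EuclideanSpace ℝ (Fin 2) → ℂ) (x : EuclideanSpace ℝ (Fin 2)) : ℂ :=
  ∫ y, heatKer z (x - y) * f y

/-- The bilinear form of `exp (z Δ)`. -/
def heatForm (z : ℂ) (f g : EuclideanSpace ℝ (Fin 2) → ℂ) : ℂ :=
  ∫ p : EuclideanSpace ℝ (Fin 2) × EuclideanSpace ℝ (Fin 2), heatKer z (p.1 - p.2) * (f p.2 * g p.1)

lemma measurable_heatOp (z : ℂ) {f : EuclideanSpace ℝ (Fin 2) → ℂ} (hf : Measurable f) :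
    Measurable (heatOp z f) := by
  unfold heatOp
  have : StronglyMeasurable (fun p : EuclideanSpace ℝ (Fin 2) × EuclideanSpace ℝ (Fin 2) =>
      heatKer z (p.1 - p.2) * f p.2) := by
    have := continuous_heatKer z
    exact Measurable.stronglyMeasurable (by fun_prop)
  exact this.integral_prod_right'.measurable

lemma integrable_heatForm {z : ℂ} (hz : 0 ≤ z.re) {f g : EuclideanSpace ℝ (Fin 2) → ℂ}
    (hf : Integrable f) (hg : Integrable g) :
    Integrable (fun p : EuclideanSpace ℝ (Fin 2) × EuclideanSpace ℝ (Fin 2) =>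
      heatKer z (p.1 - p.2) * (f p.2 * g p.1)) := by
  have h : Integrable (fun p : EuclideanSpace ℝ (Fin 2) × EuclideanSpace ℝ (Fin 2) =>
      f p.2 * g p.1) := by
    have := hg.mul_prod hf
    exact this.congr (Filter.Eventually.of_forall fun p => mul_comm _ _)
  refine h.bdd_mul (c := (4 * π * ‖z‖)⁻¹) ?_ (Filter.Eventually.of_forall fun p =>
    norm_heatKer_le hz _)
  have := continuous_heatKer z
  exact Continuous.aestronglyMeasurable (by fun_prop)

lemma heatForm_eq {z : ℂ} (hz : 0 ≤ z.re) {f g : EuclideanSpace ℝ (Fin 2) → ℂ}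
    (hf : Integrable f) (hg : Integrable g) :
    heatForm z f g = ∫ x, heatOp z f x * g x := by
  have := integrable_heatForm hz hf hg
  rw [heatForm, Measure.volume_eq_prod, integral_prod _ this]
  refine integral_congr_ae (Filter.Eventually.of_forall fun x => ?_)
  simp only [heatOp]
  rw [← integral_mul_const]
  congr 1; ext y; ring

lemma heatForm_comm {z : ℂ} {f g : EuclideanSpace ℝ (Fin 2) → ℂ} :
    heatForm z f g = heatForm z g f := by
  rw [heatForm, heatForm, Measure.volume_eq_prod, ← integral_prod_swap]
  refine integral_congr_ae (Filter.Eventually.of_forall fun p => ?_)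
  simp only [Prod.fst_swap, Prod.snd_swap]
  rw [heatKer_sub_comm, mul_comm (f _)]

lemma eLpNorm'_heatOp_two_le {z : ℂ} (hz : 0 < z.re) {f : EuclideanSpace ℝ (Fin 2) → ℂ}
    (hfm : Measurable f) (hf : Integrable f) :
    eLpNorm' (heatOp z f) 2 volume ≤ eLpNorm' f 2 volume := by
  have hk : Measurable (Function.uncurry
      (fun x y : EuclideanSpace ℝ (Fin 2) => heatKer z (x - y))) := by
    have := continuous_heatKer z
    unfold Function.uncurry
    fun_prop
  obtain ⟨h1, h2⟩ := integral_norm_sq_integral_mul (m := volume) (μ := volume) hk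
    (by positivity) (fun x y => norm_heatKer_le hz.le _)
    (fun y => (integrable_heatKer hz).comp_sub_right y)
    (L := ∫ x, ‖heatKer z x‖)
    (fun y => (integral_sub_right_eq_self (fun x => ‖heatKer z x‖) y).le) hfm hf
  have hz' : 0 < ((starRingEnd ℂ) z).re := by simpa using hz
  have hsum : z + (starRingEnd ℂ) z = ((2 * z.re : ℝ) : ℂ) := by
    rw [Complex.add_conj]
  simp_rw [conj_heatKer, integral_heatKer_mul hz hz', hsum] at h2
  refine ENNReal.rpow_le_rpow ?_ (by norm_num)
  change Integrable (fun x => ‖heatOp z f x‖ ^ 2) at h1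
  have e1 : ∫⁻ x, ‖heatOp z f x‖ₑ ^ (2 : ℝ) = ‖((∫ x, ‖heatOp z f x‖ ^ 2 : ℝ) : ℂ)‖ₑ := by
    rw [← ofReal_norm, Complex.norm_real, Real.norm_of_nonneg (by positivity),
      ofReal_integral_eq_lintegral_ofReal h1 (Filter.Eventually.of_forall fun _ => by positivity)]
    refine lintegral_congr fun x => ?_
    rw [ENNReal.ofReal_pow (norm_nonneg _), ofReal_norm]
    simp
  rw [e1]
  unfold heatOp
  rw [h2]
  refine (enorm_integral_le_lintegral_enorm _).trans ?_
  have hr : 0 < 2 * z.re := by linarith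
  set K : EuclideanSpace ℝ (Fin 2) → ℝ≥0∞ := fun x => ‖heatKer (2 * z.re : ℝ) x‖ₑ with hK
  have hKm : Measurable K := (continuous_heatKer _).measurable.enorm
  have hK1 : ∫⁻ x, K x = 1 := by
    have := integral_norm_heatKer_ofReal hr
    have h3 := ofReal_integral_norm_eq_lintegral_enorm
      (integrable_heatKer (z := ((2 * z.re : ℝ) : ℂ)) (by simpa using hz))
    rw [this] at h3
    simpa [hK] using h3.symm
  have hKs : ∀ x y, K (x - y) = K (y - x) := fun x y => by simp only [hK]; rw [heatKer_sub_comm]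
  rw [← ENNReal.mul_le_mul_iff_right (a := 2) (by simp) (by simp),
    ← lintegral_const_mul' _ _ (by simp)]
  calc ∫⁻ p : EuclideanSpace ℝ (Fin 2) × EuclideanSpace ℝ (Fin 2),
        2 * ‖f p.1 * (starRingEnd ℂ) (f p.2) * heatKer (2 * z.re : ℝ) (p.1 - p.2)‖ₑ
          ∂(volume.prod volume)
      ≤ ∫⁻ p : EuclideanSpace ℝ (Fin 2) × EuclideanSpace ℝ (Fin 2),
        (‖f p.1‖ₑ ^ (2 : ℝ) * K (p.1 - p.2) + ‖f p.2‖ₑ ^ (2 : ℝ) * K (p.1 - p.2))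
          ∂(volume.prod volume) := by
        refine lintegral_mono fun p => ?_
        simp only [enorm_mul, RCLike.enorm_conj, ENNReal.rpow_two]
        rw [← add_mul, ← mul_assoc, ← mul_assoc]
        gcongr
        simp only [enorm_eq_nnnorm]
        exact_mod_cast two_mul_le_add_sq ‖f p.1‖₊ ‖f p.2‖₊
    _ = 2 * ∫⁻ x, ‖f x‖ₑ ^ (2 : ℝ) := by
        have hfe := hfm.enorm
        rw [lintegral_add_left (by fun_prop), lintegral_prod _ (by fun_prop),
          lintegral_prod_symm _ (by fun_prop)]
        have a1 : ∀ x, ∫⁻ y, ‖f x‖ₑ ^ (2 : ℝ) * K (x - y) = ‖f x‖ₑ ^ (2 : ℝ) := fun x => by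
          rw [lintegral_const_mul _ (by fun_prop)]
          simp_rw [hKs x]
          rw [lintegral_sub_right_eq_self, hK1, mul_one]
        have a2 : ∀ y, ∫⁻ x, ‖f y‖ₑ ^ (2 : ℝ) * K (x - y) = ‖f y‖ₑ ^ (2 : ℝ) := fun x => by
          rw [lintegral_const_mul _ (by fun_prop), lintegral_sub_right_eq_self, hK1, mul_one]
        simp only [a1, a2, two_mul]

/-- Bounded integrable measurable functions. -/
structure IsBddIntegrable (f : EuclideanSpace ℝ (Fin 2) → ℂ) : Prop where
  measurable : Measurable f
  bdd : ∃ M, ∀ x, ‖f x‖ ≤ M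
  integrable : Integrable f

lemma enorm_heatForm_le_two {z : ℂ} (hz : 0 < z.re) {f g : EuclideanSpace ℝ (Fin 2) → ℂ}
    (hfm : Measurable f) (hf : Integrable f) (hgm : Measurable g) (hg : Integrable g) :
    ‖heatForm z f g‖ₑ ≤ eLpNorm' f 2 volume * eLpNorm' g 2 volume := by
  rw [heatForm_eq hz.le hf hg]
  refine (enorm_integral_mul_le_eLpNorm' Real.HolderConjugate.two_two
    (measurable_heatOp z hfm) hgm).trans ?_
  gcongr
  exact eLpNorm'_heatOp_two_le hz hfm hf

lemma enorm_heatForm_le_one {z : ℂ} (hz : 0 ≤ z.re) {f g : EuclideanSpace ℝ (Fin 2) → ℂ}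
    (hfm : Measurable f) (hgm : Measurable g) :
    ‖heatForm z f g‖ₑ ≤ ENNReal.ofReal (4 * π * ‖z‖)⁻¹ * ((∫⁻ x, ‖f x‖ₑ) * ∫⁻ x, ‖g x‖ₑ) := by
  have hfe := hfm.enorm
  have hge := hgm.enorm
  calc ‖heatForm z f g‖ₑ
      ≤ ∫⁻ p : EuclideanSpace ℝ (Fin 2) × EuclideanSpace ℝ (Fin 2),
          ENNReal.ofReal (4 * π * ‖z‖)⁻¹ * (‖g p.1‖ₑ * ‖f p.2‖ₑ) := by
        refine (enorm_integral_le_lintegral_enorm _).trans (lintegral_mono fun p => ?_)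
        simp only [enorm_mul]
        rw [mul_comm ‖f p.2‖ₑ]
        gcongr
        rw [← ofReal_norm]
        exact ENNReal.ofReal_le_ofReal (norm_heatKer_le hz _)
    _ = _ := by
        rw [lintegral_const_mul _ (by fun_prop), Measure.volume_eq_prod,
          lintegral_prod_mul hge.aemeasurable hfe.aemeasurable]
        ring

/-- The analytic family of scalars used for complex interpolation. -/
def interpScalar (ρ : ℝ) (c ζ : ℂ) : ℂ := c * cexp ((ρ * (1 + ζ) / 2 - 1) * Real.log ‖c‖)

lemma interpScalar_zero (ρ : ℝ) (ζ : ℂ) : interpScalar ρ 0 ζ = 0 := by simp [interpScalar]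

lemma norm_interpScalar {ρ : ℝ} (hρ : 0 < ρ) (c : ℂ) {ζ : ℂ} (hζ : 0 ≤ ζ.re) :
    ‖interpScalar ρ c ζ‖ = ‖c‖ ^ (ρ * (1 + ζ.re) / 2) := by
  by_cases hc : c = 0
  · have : ρ * (1 + ζ.re) / 2 ≠ 0 := by positivity
    simp [hc, interpScalar_zero, Real.zero_rpow this]
  · have hc' : 0 < ‖c‖ := norm_pos_iff.2 hc
    have h : ((ρ * (1 + ζ) / 2 - 1) * (Real.log ‖c‖ : ℂ)).re =
        (ρ * (1 + ζ.re) / 2 - 1) * Real.log ‖c‖ := by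
      have h2 : (ρ * (1 + ζ) / 2 - 1 : ℂ).re = ρ * (1 + ζ.re) / 2 - 1 := by
        have : (ρ * (1 + ζ) / 2 - 1 : ℂ) = ((ρ / 2 : ℝ) : ℂ) * (1 + ζ) - 1 := by
          push_cast; ring
        rw [this]
        simp
        ring
      rw [Complex.re_mul_ofReal, h2]
    rw [interpScalar, norm_mul, Complex.norm_exp, h, Real.rpow_def_of_pos hc']
    nth_rw 1 [← Real.exp_log hc']
    rw [← Real.exp_add]
    congr 1
    ring

lemma enorm_interpScalar {ρ : ℝ} (hρ : 0 < ρ) (c : ℂ) {ζ : ℂ} (hζ : 0 ≤ ζ.re) :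
    ‖interpScalar ρ c ζ‖ₑ = ‖c‖ₑ ^ (ρ * (1 + ζ.re) / 2) := by
  rw [← ofReal_norm, norm_interpScalar hρ c hζ, ← ofReal_norm,
    ENNReal.ofReal_rpow_of_nonneg (norm_nonneg _) (by positivity)]

lemma norm_heatForm_simpleFunc_le {z : ℂ} (hz : 0 < z.re) {θ : ℝ} (h0 : 0 ≤ θ) (h1 : θ ≤ 1)
    (f g : SimpleFunc (EuclideanSpace ℝ (Fin 2)) ℂ) (hf : Integrable f) (hg : Integrable g) :
    ‖heatForm z f g‖ₑ ≤ ENNReal.ofReal (4 * π * ‖z‖)⁻¹ ^ θ *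
      (eLpNorm' f (2 / (1 + θ)) volume * eLpNorm' g (2 / (1 + θ)) volume) := by
  set ρ := 2 / (1 + θ) with hρdef
  have hρ : 0 < ρ := by positivity
  set S : SimpleFunc (EuclideanSpace ℝ (Fin 2)) ℂ → ℂ →
      SimpleFunc (EuclideanSpace ℝ (Fin 2)) ℂ := fun f ζ => f.map (interpScalar ρ · ζ) with hS
  have hfin : ∀ f : SimpleFunc (EuclideanSpace ℝ (Fin 2)) ℂ, Integrable f →
      ∀ ζ, Integrable (S f ζ) := fun f hf ζ =>
    (SimpleFunc.integrable_iff_finMeasSupp.2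
      ((SimpleFunc.integrable_iff_finMeasSupp.1 hf).map (interpScalar_zero ρ ζ)))
  have hsum : ∀ (f : SimpleFunc (EuclideanSpace ℝ (Fin 2)) ℂ) (ζ : ℂ) (x),
      S f ζ x = ∑ c ∈ f.range.filter (· ≠ 0), interpScalar ρ c ζ *
        (f ⁻¹' {c}).indicator (fun _ => (1 : ℂ)) x := by
    intro f ζ x
    simp only [hS, SimpleFunc.map_apply]
    by_cases hx : f x = 0
    · rw [hx, interpScalar_zero, Finset.sum_eq_zero]
      intro c hc
      rw [Set.indicator_of_notMem, mul_zero]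
      intro h
      simp only [Set.mem_preimage, Set.mem_singleton_iff] at h
      exact (Finset.mem_filter.1 hc).2 (h.symm.trans hx)
    · rw [Finset.sum_eq_single (f x)]
      · simp
      · intro c _ hc
        rw [Set.indicator_of_notMem, mul_zero]
        intro h
        simp only [Set.mem_preimage, Set.mem_singleton_iff] at h
        exact hc h.symm
      · intro h
        exact absurd (Finset.mem_filter.2 ⟨f.mem_range_self x, hx⟩) h
  have hind : ∀ (f : SimpleFunc (EuclideanSpace ℝ (Fin 2)) ℂ), Integrable f →
      ∀ c ∈ f.range.filter (· ≠ 0), Integrable ((f ⁻¹' {c}).indicator (fun _ => (1 : ℂ))) := by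
    intro f hf c hc
    refine (integrable_indicator_iff (f.measurableSet_preimage _)).2 ?_
    exact integrableOn_const
      ((SimpleFunc.integrable_iff.1 hf c (Finset.mem_filter.1 hc).2).ne)
  set H : ℂ → ℂ := fun ζ => heatForm z (S f ζ) (S g ζ) with hH
  have hHeq : ∀ ζ, H ζ = ∑ c ∈ f.range.filter (· ≠ 0), ∑ d ∈ g.range.filter (· ≠ 0),
      interpScalar ρ c ζ * interpScalar ρ d ζ *
        heatForm z ((f ⁻¹' {c}).indicator (fun _ => (1 : ℂ)))
          ((g ⁻¹' {d}).indicator (fun _ => (1 : ℂ))) := by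
    intro ζ
    simp only [hH, heatForm, ← integral_const_mul]
    have hI : ∀ c ∈ f.range.filter (· ≠ 0), ∀ d ∈ g.range.filter (· ≠ 0), _ := fun c hc d hd =>
      (integrable_heatForm hz.le (hind f hf c hc) (hind g hg d hd)).const_mul
        (interpScalar ρ c ζ * interpScalar ρ d ζ)
    rw [Finset.sum_congr rfl fun c hc => (integral_finsetSum _ (hI c hc)).symm,
      ← integral_finsetSum _ fun c hc => integrable_finsetSum _ (hI c hc)]
    congr 1
    ext p
    rw [hsum, hsum, Finset.sum_mul_sum, Finset.mul_sum]
    refine Finset.sum_congr rfl fun c _ => ?_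
    rw [Finset.mul_sum]
    refine Finset.sum_congr rfl fun d _ => ?_
    ring
  have hdiff : Differentiable ℂ H := by
    have : H = _ := funext hHeq
    rw [this]
    unfold interpScalar
    fun_prop
  have hbdd : BddAbove ((norm ∘ H) '' HadamardThreeLines.verticalClosedStrip 0 1) := by
    refine ⟨∑ c ∈ f.range.filter (· ≠ 0), ∑ d ∈ g.range.filter (· ≠ 0),
      max 1 (‖c‖ ^ ρ) * max 1 (‖d‖ ^ ρ) *
        ‖heatForm z ((f ⁻¹' {c}).indicator (fun _ => (1 : ℂ)))
          ((g ⁻¹' {d}).indicator (fun _ => (1 : ℂ)))‖, ?_⟩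
    rintro _ ⟨ζ, hζ, rfl⟩
    simp only [HadamardThreeLines.verticalClosedStrip, Set.mem_preimage, Set.mem_Icc] at hζ
    simp only [Function.comp_apply, hHeq]
    have hb : ∀ c : ℂ, ‖interpScalar ρ c ζ‖ ≤ max 1 (‖c‖ ^ ρ) := by
      intro c
      rw [norm_interpScalar hρ c hζ.1]
      rcases le_total ‖c‖ 1 with h | h
      · exact (Real.rpow_le_one (norm_nonneg _) h (by have := hζ.1; positivity)).trans
          (le_max_left _ _)
      · refine (Real.rpow_le_rpow_of_exponent_le h ?_).trans (le_max_right _ _)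
        nlinarith [hζ.2]
    refine (norm_sum_le _ _).trans (Finset.sum_le_sum fun c _ => ?_)
    refine (norm_sum_le _ _).trans (Finset.sum_le_sum fun d _ => ?_)
    rw [norm_mul, norm_mul]
    gcongr
    · exact hb c
    · exact hb d
  have hNf : ∀ f : SimpleFunc (EuclideanSpace ℝ (Fin 2)) ℂ, Integrable f →
      ∫⁻ x, ‖f x‖ₑ ^ ρ ≠ ⊤ := by
    intro f hf
    have hmem := (SimpleFunc.memLp_iff_finMeasSupp (p := ENNReal.ofReal ρ) (by simpa using hρ)
      (by simp)).2 (SimpleFunc.integrable_iff_finMeasSupp.1 hf)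
    have := lintegral_rpow_enorm_lt_top_of_eLpNorm_lt_top (by simpa using hρ) (by simp) hmem.2
    rw [ENNReal.toReal_ofReal hρ.le] at this
    exact this.ne
  set A := ∫⁻ x, ‖f x‖ₑ ^ ρ with hA
  set B := ∫⁻ x, ‖g x‖ₑ ^ ρ with hB
  have hA' : A ≠ ⊤ := hNf f hf
  have hB' : B ≠ ⊤ := hNf g hg
  set D := ENNReal.ofReal (4 * π * ‖z‖)⁻¹ with hD
  have hb0 : ∀ ζ ∈ re ⁻¹' {(0 : ℝ)}, ‖H ζ‖ ≤ (A ^ (1 / 2 : ℝ) * B ^ (1 / 2 : ℝ)).toReal := by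
    intro ζ hζ
    simp only [Set.mem_preimage, Set.mem_singleton_iff] at hζ
    rw [← ENNReal.ofReal_le_ofReal_iff ENNReal.toReal_nonneg, ofReal_norm, ENNReal.ofReal_toReal
      (ENNReal.mul_ne_top (ENNReal.rpow_ne_top_of_nonneg (by norm_num) hA')
        (ENNReal.rpow_ne_top_of_nonneg (by norm_num) hB'))]
    refine (enorm_heatForm_le_two hz (S f ζ).measurable (hfin f hf ζ) (S g ζ).measurable
      (hfin g hg ζ)).trans (le_of_eq ?_)
    simp only [eLpNorm', hS, SimpleFunc.map_apply, enorm_interpScalar hρ _ hζ.ge, hζ,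
      ← ENNReal.rpow_mul]
    rw [show ρ * (1 + 0) / 2 * 2 = ρ by ring]
  have hb1 : ∀ ζ ∈ re ⁻¹' {(1 : ℝ)}, ‖H ζ‖ ≤ (D * (A * B)).toReal := by
    intro ζ hζ
    simp only [Set.mem_preimage, Set.mem_singleton_iff] at hζ
    rw [← ENNReal.ofReal_le_ofReal_iff ENNReal.toReal_nonneg, ofReal_norm, ENNReal.ofReal_toReal
      (ENNReal.mul_ne_top ENNReal.ofReal_ne_top (ENNReal.mul_ne_top hA' hB'))]
    refine (enorm_heatForm_le_one hz.le (S f ζ).measurable (S g ζ).measurable).trans (le_of_eq ?_)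
    have : 0 ≤ ζ.re := by rw [hζ]; norm_num
    simp only [hS, SimpleFunc.map_apply, enorm_interpScalar hρ _ this, hζ]
    rw [show ρ * (1 + 1) / 2 = ρ by ring]
  have key := HadamardThreeLines.norm_le_interp_of_mem_verticalClosedStrip₀₁' H (z := (θ : ℂ))
    (by simp [HadamardThreeLines.verticalClosedStrip, h0, h1]) hdiff.diffContOnCl hbdd hb0 hb1
  have hHθ : H θ = heatForm z f g := by
    have hone : (ρ * (1 + θ) / 2 - 1 : ℂ) = 0 := by
      have : ρ * (1 + θ) / 2 - 1 = 0 := by rw [hρdef]; field_simp; ring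
      exact_mod_cast this
    have : ∀ f : SimpleFunc (EuclideanSpace ℝ (Fin 2)) ℂ, ⇑(S f θ) = f := by
      intro f
      ext x
      simp [hS, SimpleFunc.map_apply, interpScalar, hone]
    simp only [hH, this]
  rw [hHθ, Complex.ofReal_re] at key
  have h1θ : 0 ≤ 1 - θ := by linarith
  have key2 := ENNReal.ofReal_le_ofReal key
  rw [ofReal_norm, ENNReal.ofReal_mul (by positivity),
    ← ENNReal.ofReal_rpow_of_nonneg ENNReal.toReal_nonneg h1θ,
    ← ENNReal.ofReal_rpow_of_nonneg ENNReal.toReal_nonneg h0,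
    ENNReal.ofReal_toReal
      (ENNReal.mul_ne_top (ENNReal.rpow_ne_top_of_nonneg (by norm_num) hA')
        (ENNReal.rpow_ne_top_of_nonneg (by norm_num) hB')),
    ENNReal.ofReal_toReal
      (ENNReal.mul_ne_top ENNReal.ofReal_ne_top (ENNReal.mul_ne_top hA' hB'))] at key2
  refine key2.trans (le_of_eq ?_)
  simp only [eLpNorm', ← hA, ← hB]
  rw [ENNReal.mul_rpow_of_nonneg _ _ h1θ, ENNReal.mul_rpow_of_nonneg _ _ h0,
    ENNReal.mul_rpow_of_nonneg _ _ h0, ← ENNReal.rpow_mul, ← ENNReal.rpow_mul]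
  have e : 1 / ρ = 1 / 2 * (1 - θ) + θ := by rw [hρdef]; field_simp; ring
  rw [e, ENNReal.rpow_add_of_nonneg _ _ (by positivity) h0,
    ENNReal.rpow_add_of_nonneg _ _ (by positivity) h0]
  ring

lemma IsBddIntegrable.lintegral_rpow_ne_top {f : EuclideanSpace ℝ (Fin 2) → ℂ}
    (hf : IsBddIntegrable f) {p : ℝ} (hp : 1 ≤ p) : ∫⁻ x, ‖f x‖ₑ ^ p ≠ ⊤ := by
  obtain ⟨M, hM⟩ := hf.bdd
  have h : ∀ x, ‖f x‖ₑ ^ p ≤ ENNReal.ofReal M ^ (p - 1) * ‖f x‖ₑ := by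
    intro x
    have hM' : ‖f x‖ₑ ≤ ENNReal.ofReal M := by
      rw [← ofReal_norm]; exact ENNReal.ofReal_le_ofReal (hM x)
    calc ‖f x‖ₑ ^ p = ‖f x‖ₑ ^ (p - 1) * ‖f x‖ₑ ^ (1 : ℝ) := by
          rw [← ENNReal.rpow_add_of_nonneg _ _ (by linarith) zero_le_one]
          congr 1; ring
      _ ≤ _ := by
          rw [ENNReal.rpow_one]
          gcongr
  refine ((lintegral_mono h).trans_lt ?_).ne
  rw [lintegral_const_mul _ hf.measurable.enorm]
  exact ENNReal.mul_lt_top (ENNReal.rpow_lt_top_of_nonneg (by linarith) ENNReal.ofReal_ne_top)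
    hf.integrable.2

lemma IsBddIntegrable.eLpNorm'_ne_top {f : EuclideanSpace ℝ (Fin 2) → ℂ}
    (hf : IsBddIntegrable f) {p : ℝ} (hp : 1 ≤ p) : eLpNorm' f p volume ≠ ⊤ :=
  ENNReal.rpow_ne_top_of_nonneg (by positivity) (hf.lintegral_rpow_ne_top hp)

lemma tendsto_eLpNorm'_of_dominated {f : EuclideanSpace ℝ (Fin 2) → ℂ}
    (hf : IsBddIntegrable f) {p : ℝ} (hp : 1 ≤ p) {F : ℕ → EuclideanSpace ℝ (Fin 2) → ℂ}
    (hFm : ∀ n, Measurable (F n)) (hF : ∀ n x, ‖F n x‖ ≤ ‖f x‖ + ‖f x‖)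
    (hlim : ∀ x, Filter.Tendsto (fun n => F n x) Filter.atTop (nhds (f x))) :
    Filter.Tendsto (fun n => eLpNorm' (F n) p volume) Filter.atTop
      (nhds (eLpNorm' f p volume)) := by
  have hp0 : 0 ≤ p := by linarith
  unfold eLpNorm'
  refine Filter.Tendsto.ennrpow_const _ ?_
  refine tendsto_lintegral_of_dominated_convergence (fun x => (2 * ‖f x‖ₑ) ^ p)
    (fun n => (hFm n).enorm.pow_const _) (fun n => Filter.Eventually.of_forall fun x => ?_) ?_
    (Filter.Eventually.of_forall fun x => ?_)
  · refine ENNReal.rpow_le_rpow ?_ hp0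
    have := ENNReal.ofReal_le_ofReal (hF n x)
    rwa [ENNReal.ofReal_add (norm_nonneg _) (norm_nonneg _), ofReal_norm, ofReal_norm,
      ← two_mul] at this
  · simp_rw [ENNReal.mul_rpow_of_nonneg _ _ hp0]
    rw [lintegral_const_mul _ (hf.measurable.enorm.pow_const _)]
    exact ENNReal.mul_ne_top (ENNReal.rpow_ne_top_of_nonneg hp0 (by simp))
      (hf.lintegral_rpow_ne_top hp)
  · exact ((hlim x).enorm).ennrpow_const _

lemma enorm_heatForm_le {z : ℂ} (hz : 0 < z.re) {θ : ℝ} (h0 : 0 ≤ θ) (h1 : θ ≤ 1)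
    {f g : EuclideanSpace ℝ (Fin 2) → ℂ} (hf : IsBddIntegrable f) (hg : IsBddIntegrable g) :
    ‖heatForm z f g‖ₑ ≤ ENNReal.ofReal |z.im| ^ (-θ) *
      (eLpNorm' f (2 / (1 + θ)) volume * eLpNorm' g (2 / (1 + θ)) volume) := by
  have hρ : 1 ≤ 2 / (1 + θ) := by
    rw [le_div_iff₀ (by positivity)]; linarith
  have hz0 : 0 < ‖z‖ := norm_pos_iff.2 (by rintro rfl; simp at hz)
  have hmain : ‖heatForm z f g‖ₑ ≤ ENNReal.ofReal (4 * π * ‖z‖)⁻¹ ^ θ *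
      (eLpNorm' f (2 / (1 + θ)) volume * eLpNorm' g (2 / (1 + θ)) volume) := by
    set F : ℕ → SimpleFunc (EuclideanSpace ℝ (Fin 2)) ℂ := fun n =>
      SimpleFunc.approxOn f hf.measurable Set.univ 0 (Set.mem_univ _) n with hF
    set G : ℕ → SimpleFunc (EuclideanSpace ℝ (Fin 2)) ℂ := fun n =>
      SimpleFunc.approxOn g hg.measurable Set.univ 0 (Set.mem_univ _) n with hG
    have hFb : ∀ n x, ‖F n x‖ ≤ ‖f x‖ + ‖f x‖ := fun n x =>
      SimpleFunc.norm_approxOn_zero_le hf.measurable (Set.mem_univ _) x n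
    have hGb : ∀ n x, ‖G n x‖ ≤ ‖g x‖ + ‖g x‖ := fun n x =>
      SimpleFunc.norm_approxOn_zero_le hg.measurable (Set.mem_univ _) x n
    have hFl : ∀ x, Filter.Tendsto (fun n => F n x) Filter.atTop (nhds (f x)) := fun x =>
      SimpleFunc.tendsto_approxOn hf.measurable (Set.mem_univ _) (by simp)
    have hGl : ∀ x, Filter.Tendsto (fun n => G n x) Filter.atTop (nhds (g x)) := fun x =>
      SimpleFunc.tendsto_approxOn hg.measurable (Set.mem_univ _) (by simp)
    have hFi : ∀ n, Integrable (F n) := fun n =>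
      (hf.integrable.norm.add hf.integrable.norm).mono' (F n).aestronglyMeasurable
        (Filter.Eventually.of_forall (hFb n))
    have hGi : ∀ n, Integrable (G n) := fun n =>
      (hg.integrable.norm.add hg.integrable.norm).mono' (G n).aestronglyMeasurable
        (Filter.Eventually.of_forall (hGb n))
    have hlim : Filter.Tendsto (fun n => heatForm z (F n) (G n)) Filter.atTop
        (nhds (heatForm z f g)) := by
      refine tendsto_integral_of_dominated_convergence
        (fun p => (4 * π * ‖z‖)⁻¹ * ((‖g p.1‖ + ‖g p.1‖) * (‖f p.2‖ + ‖f p.2‖)))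
        (fun n => (integrable_heatForm hz.le (hFi n) (hGi n)).aestronglyMeasurable) ?_ ?_ ?_
      · exact ((hg.integrable.norm.add hg.integrable.norm).mul_prod
          (hf.integrable.norm.add hf.integrable.norm)).const_mul _
      · refine fun n => Filter.Eventually.of_forall fun p => ?_
        rw [norm_mul, norm_mul, mul_comm ‖F n _‖]
        gcongr
        · exact norm_heatKer_le hz.le _
        · exact hGb n _
        · exact hFb n _
      · refine Filter.Eventually.of_forall fun p => ?_
        exact tendsto_const_nhds.mul ((hFl _).mul (hGl _))
    refine le_of_tendsto_of_tendsto' hlim.enorm ?_ fun n =>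
      norm_heatForm_simpleFunc_le hz h0 h1 (F n) (G n) (hFi n) (hGi n)
    have t1 := tendsto_eLpNorm'_of_dominated hf hρ (fun n => (F n).measurable) hFb hFl
    have t2 := tendsto_eLpNorm'_of_dominated hg hρ (fun n => (G n).measurable) hGb hGl
    refine ENNReal.Tendsto.const_mul (ENNReal.Tendsto.mul t1 (Or.inr (hg.eLpNorm'_ne_top hρ)) t2
      (Or.inr (hf.eLpNorm'_ne_top hρ))) (Or.inr ?_)
    exact ENNReal.rpow_ne_top_of_nonneg h0 ENNReal.ofReal_ne_top
  refine hmain.trans ?_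
  gcongr
  rw [ENNReal.rpow_neg, ← ENNReal.inv_rpow]
  gcongr
  rw [ENNReal.ofReal_inv_of_pos (by positivity)]
  rw [ENNReal.inv_le_inv]
  refine ENNReal.ofReal_le_ofReal ((Complex.abs_im_le_norm z).trans ?_)
  have : 1 ≤ 4 * π := by linarith [Real.pi_gt_three]
  nlinarith

lemma lintegral_comp_abs_eq (φ : ℝ → ℝ≥0∞) :
    ∫⁻ x, φ |x| = 2 * ∫⁻ x in Set.Ioi (0 : ℝ), φ x := by
  have h1 : ∫⁻ x in Set.Ioi (0 : ℝ), φ |x| = ∫⁻ x in Set.Ioi (0 : ℝ), φ x :=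
    setLIntegral_congr_fun measurableSet_Ioi fun x hx => by rw [abs_of_pos hx]
  have h2 : ∫⁻ x in Set.Iio (0 : ℝ), φ |x| = ∫⁻ x in Set.Ioi (0 : ℝ), φ x := by
    rw [← h1, ← (Measure.measurePreserving_neg (volume : Measure ℝ)).setLIntegral_comp_preimage_emb
      (MeasurableEquiv.neg ℝ).measurableEmbedding]
    simp
  rw [← lintegral_add_compl _ (measurableSet_Ioi (a := (0 : ℝ))), h1, Set.compl_Ioi,
    setLIntegral_congr Iio_ae_eq_Iic.symm, h2, two_mul]

lemma lintegral_abs_rpow_near {θ δ : ℝ} (h1 : θ < 1) (hδ : 0 < δ) :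
    ∫⁻ x : ℝ in {x | |x| < δ}, ENNReal.ofReal |x| ^ (-θ) =
      2 * ENNReal.ofReal (δ ^ (1 - θ) / (1 - θ)) := by
  have hm : MeasurableSet {x : ℝ | |x| < δ} := measurableSet_lt (by fun_prop) (by fun_prop)
  rw [← lintegral_indicator hm]
  have := lintegral_comp_abs_eq ((Set.Iio δ).indicator (fun x => ENNReal.ofReal x ^ (-θ)))
  refine (lintegral_congr fun x => ?_).trans (this.trans ?_)
  · simp [Set.indicator]
  congr 1
  rw [lintegral_indicator measurableSet_Iio, Measure.restrict_restrict measurableSet_Iio,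
    Set.Iio_inter_Ioi, ← setLIntegral_congr Ioo_ae_eq_Ioc.symm,
    setLIntegral_congr_fun (g := fun x => ENNReal.ofReal (x ^ (-θ))) measurableSet_Ioc
      fun x hx => ENNReal.ofReal_rpow_of_pos hx.1,
    ← ofReal_integral_eq_lintegral_ofReal]
  · rw [← intervalIntegral.integral_of_le hδ.le, integral_rpow (Or.inl (by linarith))]
    rw [Real.zero_rpow (by linarith), sub_zero, neg_add_eq_sub]
  · exact (intervalIntegrable_iff_integrableOn_Ioc_of_le hδ.le).1
      (intervalIntegral.intervalIntegrable_rpow' (by linarith))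
  · exact (ae_restrict_mem measurableSet_Ioc).mono fun x hx => by
      have := hx.1.le; positivity

lemma lintegral_abs_rpow_far {δ : ℝ} (hδ : 0 < δ) :
    ∫⁻ x : ℝ in {x | |x| < δ}ᶜ, ENNReal.ofReal |x| ^ (-2 : ℝ) = 2 * ENNReal.ofReal (δ⁻¹) := by
  have hm : MeasurableSet {x : ℝ | |x| < δ}ᶜ :=
    (measurableSet_lt (by fun_prop) (by fun_prop)).compl
  rw [← lintegral_indicator hm]
  have := lintegral_comp_abs_eq ((Set.Ici δ).indicator (fun x => ENNReal.ofReal x ^ (-2 : ℝ)))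
  refine (lintegral_congr fun x => ?_).trans (this.trans ?_)
  · simp only [Set.indicator, Set.mem_compl_iff, Set.mem_ofPred_eq, not_lt, Set.mem_Ici]
  congr 1
  rw [lintegral_indicator measurableSet_Ici, Measure.restrict_restrict measurableSet_Ici,
    Set.inter_eq_left.2 (Set.Ici_subset_Ioi.2 hδ),
    ← setLIntegral_congr Ioi_ae_eq_Ici,
    setLIntegral_congr_fun (g := fun x => ENNReal.ofReal (x ^ (-2 : ℝ))) measurableSet_Ioi
      fun x hx => ENNReal.ofReal_rpow_of_pos (hδ.trans hx),
    ← ofReal_integral_eq_lintegral_ofReal]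
  · rw [integral_Ioi_rpow_of_lt (by norm_num) hδ]
    congr 1
    rw [show (-2 : ℝ) + 1 = -1 by norm_num, Real.rpow_neg_one]
    simp
  · exact integrableOn_Ioi_rpow_of_lt (by norm_num) hδ
  · exact (ae_restrict_mem measurableSet_Ioi).mono fun x hx => by
      have := (hδ.trans hx).le; positivity

lemma lintegral_min_mul_abs_rpow_le {θ : ℝ} (h0 : 0 < θ) (h1 : θ < 1) {g : ℝ → ℝ≥0∞}
    (hg : Measurable g) (hg1 : ∫⁻ t, g t ^ (2 / (2 - θ)) ≤ 1) {m : ℝ≥0∞} (hm0 : m ≠ 0)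
    (hm : m ≠ ⊤) (s : ℝ) :
    ∫⁻ t, min (g t) m * ENNReal.ofReal |t - s| ^ (-θ) ≤
      (ENNReal.ofReal (2 / (1 - θ)) + 2 ^ (θ / 2)) * m ^ (2 / (2 - θ) - 1) := by
  have hθ2 : 0 < 2 - θ := by linarith
  have hθ1 : 0 < 1 - θ := by linarith
  set p : ℝ := 2 / (2 - θ) with hp
  have hp1 : 1 < p := by rw [hp, lt_div_iff₀ hθ2]; linarith
  obtain ⟨a, rfl⟩ : ∃ a : ℝ, m = ENNReal.ofReal a := ⟨m.toReal, (ENNReal.ofReal_toReal hm).symm⟩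
  have ha : 0 < a := by simpa using hm0
  set δ : ℝ := a ^ (-p) with hδd
  have hδ : 0 < δ := Real.rpow_pos_of_pos ha _
  set κ : ℝ → ℝ≥0∞ := fun x => ENNReal.ofReal |x| ^ (-θ) with hκ
  have hκm : Measurable κ := by fun_prop
  set S : Set ℝ := {x | |x| < δ} with hS
  have hSm : MeasurableSet S := measurableSet_lt (by fun_prop) (by fun_prop)
  have hsub : ∫⁻ t, min (g t) (ENNReal.ofReal a) * κ (t - s) =
      ∫⁻ t, min (g (t + s)) (ENNReal.ofReal a) * κ t := by
    rw [← lintegral_add_right_eq_self _ s]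
    simp
  change ∫⁻ t, min (g t) (ENNReal.ofReal a) * κ (t - s) ≤ _
  rw [hsub, ← lintegral_add_compl _ hSm, add_mul]
  refine add_le_add ?_ ?_
  · calc ∫⁻ t in S, min (g (t + s)) (ENNReal.ofReal a) * κ t
        ≤ ∫⁻ t in S, ENNReal.ofReal a * κ t := by
          refine lintegral_mono fun t => ?_
          gcongr
          exact min_le_right _ _
      _ = ENNReal.ofReal a * (2 * ENNReal.ofReal (δ ^ (1 - θ) / (1 - θ))) := by
          rw [lintegral_const_mul _ hκm, lintegral_abs_rpow_near h1 hδ]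
      _ = _ := by
          rw [ENNReal.ofReal_rpow_of_pos ha, ← ENNReal.ofReal_mul (by positivity),
            show (2 : ℝ≥0∞) = ENNReal.ofReal 2 by simp, ← ENNReal.ofReal_mul (by norm_num),
            ← ENNReal.ofReal_mul ha.le]
          congr 1
          rw [hδd, ← Real.rpow_mul ha.le]
          have : a * a ^ (-p * (1 - θ)) = a ^ (p - 1) := by
            nth_rewrite 1 [← Real.rpow_one a]
            rw [← Real.rpow_add ha]
            congr 1
            rw [hp]; field_simp; ring
          rw [← this]; ring
  · have hpq : p.HolderConjugate (2 / θ) := by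
      refine (Real.holderConjugate_iff).2 ⟨hp1, ?_⟩
      rw [hp]; field_simp; ring
    calc ∫⁻ t in Sᶜ, min (g (t + s)) (ENNReal.ofReal a) * κ t
        ≤ ∫⁻ t in Sᶜ, ((fun t => g (t + s)) * κ) t := by
          refine lintegral_mono fun t => ?_
          simp only [Pi.mul_apply]
          gcongr
          exact min_le_left _ _
      _ ≤ (∫⁻ t in Sᶜ, g (t + s) ^ p) ^ (1 / p) * (∫⁻ t in Sᶜ, κ t ^ (2 / θ)) ^ (1 / (2 / θ)) :=
          ENNReal.lintegral_mul_le_Lp_mul_Lq _ hpq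
            (by fun_prop) hκm.aemeasurable
      _ ≤ 1 * (2 ^ (θ / 2) * ENNReal.ofReal a ^ (p - 1)) := by
          gcongr
          · refine ENNReal.rpow_le_one ?_ (by positivity)
            refine (setLIntegral_le_lintegral _ _).trans ?_
            rwa [lintegral_add_right_eq_self (fun t => g t ^ p) s]
          · have : ∀ t, κ t ^ (2 / θ) = ENNReal.ofReal |t| ^ (-2 : ℝ) := fun t => by
              rw [hκ, ← ENNReal.rpow_mul]
              congr 1; field_simp
            simp_rw [this]
            rw [lintegral_abs_rpow_far hδ, ENNReal.mul_rpow_of_nonneg _ _ (by positivity),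
              one_div_div, ENNReal.ofReal_rpow_of_pos (by positivity),
              ENNReal.ofReal_rpow_of_pos ha]
            gcongr 2 ^ (θ / 2) * ENNReal.ofReal ?_
            rw [hδd, ← Real.rpow_neg ha.le, neg_neg, ← Real.rpow_mul ha.le]
            apply le_of_eq
            congr 1
            rw [hp]; field_simp; ring
      _ = _ := one_mul _

lemma hls_normalized {θ : ℝ} (h0 : 0 < θ) (h1 : θ < 1) {f g : ℝ → ℝ≥0∞}
    (hf : Measurable f) (hg : Measurable g) (hf1 : ∫⁻ t, f t ^ (2 / (2 - θ)) ≤ 1)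
    (hg1 : ∫⁻ t, g t ^ (2 / (2 - θ)) ≤ 1) :
    ∫⁻ s, ∫⁻ t, f s * g t * ENNReal.ofReal |t - s| ^ (-θ) ≤
      2 * (ENNReal.ofReal (2 / (1 - θ)) + 2 ^ (θ / 2)) := by
  have hθ2 : 0 < 2 - θ := by linarith
  set K := ENNReal.ofReal (2 / (1 - θ)) + 2 ^ (θ / 2) with hK
  have key : ∀ f g : ℝ → ℝ≥0∞, Measurable f → Measurable g →
      ∫⁻ t, f t ^ (2 / (2 - θ)) ≤ 1 → ∫⁻ t, g t ^ (2 / (2 - θ)) ≤ 1 →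
      ∫⁻ s, ∫⁻ t, f s * (min (g t) (f s) * ENNReal.ofReal |t - s| ^ (-θ)) ≤ K := by
    intro f g hf hg hf1 hg1
    have htop : ∀ᵐ s, f s ≠ ⊤ := by
      have := ae_lt_top (hf.pow_const (2 / (2 - θ))) (hf1.trans_lt ENNReal.one_lt_top).ne
      filter_upwards [this] with s hs h
      rw [h, ENNReal.top_rpow_of_pos (by positivity)] at hs
      exact lt_irrefl _ hs
    calc ∫⁻ s, ∫⁻ t, f s * (min (g t) (f s) * ENNReal.ofReal |t - s| ^ (-θ))
        ≤ ∫⁻ s, K * f s ^ (2 / (2 - θ)) := by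
          refine lintegral_mono_ae (htop.mono fun s hs => ?_)
          rw [lintegral_const_mul _ (by fun_prop)]
          rcases eq_or_ne (f s) 0 with h | h
          · simp [h]
          refine (mul_le_mul_right (lintegral_min_mul_abs_rpow_le h0 h1 hg hg1 h hs s) _).trans
            (le_of_eq ?_)
          rw [mul_left_comm]
          congr 1
          nth_rewrite 1 [← ENNReal.rpow_one (f s)]
          rw [← ENNReal.rpow_add _ _ h hs]
          congr 1; ring
      _ ≤ K := by
          rw [lintegral_const_mul _ (by fun_prop)]
          exact mul_le_of_le_one_right' hf1
  calc ∫⁻ s, ∫⁻ t, f s * g t * ENNReal.ofReal |t - s| ^ (-θ)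
      ≤ ∫⁻ s, ∫⁻ t, (f s * (min (g t) (f s) * ENNReal.ofReal |t - s| ^ (-θ)) +
          g t * (min (f s) (g t) * ENNReal.ofReal |s - t| ^ (-θ))) := by
        refine lintegral_mono fun s => lintegral_mono fun t => ?_
        simp only []
        rw [abs_sub_comm s t]
        rcases le_total (g t) (f s) with h | h
        · rw [min_eq_left h, mul_assoc]
          exact le_self_add
        · rw [min_eq_left h, mul_comm (f s), mul_assoc (g t)]
          exact le_add_self
    _ = (∫⁻ s, ∫⁻ t, f s * (min (g t) (f s) * ENNReal.ofReal |t - s| ^ (-θ))) +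
          ∫⁻ t, ∫⁻ s, g t * (min (f s) (g t) * ENNReal.ofReal |s - t| ^ (-θ)) := by
        rw [lintegral_lintegral_swap (f := fun t s =>
          g t * (min (f s) (g t) * ENNReal.ofReal |s - t| ^ (-θ))) (by fun_prop)]
        rw [← lintegral_add_left (by fun_prop)]
        refine lintegral_congr fun s => ?_
        rw [lintegral_add_left (by fun_prop)]
    _ ≤ K + K := add_le_add (key f g hf hg hf1 hg1) (key g f hg hf hg1 hf1)
    _ = 2 * K := (two_mul _).symm

/-- The diagonal Hardy-Littlewood-Sobolev inequality on the line, with constant `C`. -/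
def HLSBound (θ : ℝ) (C : ℝ≥0∞) : Prop :=
  ∀ f g : ℝ → ℝ≥0∞, Measurable f → Measurable g →
    ∫⁻ s, ∫⁻ t, f s * g t * ENNReal.ofReal |t - s| ^ (-θ) ≤
      C * ((∫⁻ t, f t ^ (2 / (2 - θ))) ^ ((2 - θ) / 2) *
        (∫⁻ t, g t ^ (2 / (2 - θ))) ^ ((2 - θ) / 2))

lemma exists_hls {θ : ℝ} (h0 : 0 ≤ θ) (h1 : θ < 1) :
    ∃ C : ℝ≥0∞, C ≠ ⊤ ∧ HLSBound θ C := by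
  rcases h0.eq_or_lt with rfl | h0
  · refine ⟨1, by simp, fun f g hf hg => ?_⟩
    simp only [neg_zero, ENNReal.rpow_zero, mul_one, sub_zero, one_mul]
    rw [lintegral_congr fun s => lintegral_const_mul _ hg, lintegral_mul_const _ hf]
    norm_num
  have hθ2 : 0 < 2 - θ := by linarith
  set p : ℝ := 2 / (2 - θ) with hp
  have hp0 : 0 < p := by positivity
  have hpi : (2 - θ) / 2 = p⁻¹ := by rw [hp, inv_div]
  refine ⟨2 * (ENNReal.ofReal (2 / (1 - θ)) + 2 ^ (θ / 2)), ?_, fun f g hf hg => ?_⟩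
  · refine ENNReal.mul_ne_top (by simp) (ENNReal.add_ne_top.2 ⟨ENNReal.ofReal_ne_top, ?_⟩)
    exact ENNReal.rpow_ne_top_of_nonneg (by positivity) (by simp)
  set K := 2 * (ENNReal.ofReal (2 / (1 - θ)) + 2 ^ (θ / 2)) with hK
  have hKne : K ≠ 0 := by
    have : (0 : ℝ) < 2 / (1 - θ) := div_pos two_pos (by linarith)
    simp [hK, this.not_ge]
  rw [hpi]
  set A := (∫⁻ t, f t ^ p) ^ p⁻¹ with hA
  set B := (∫⁻ t, g t ^ p) ^ p⁻¹ with hB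
  have zero : ∀ f : ℝ → ℝ≥0∞, Measurable f → (∫⁻ t, f t ^ p) ^ p⁻¹ = 0 → ∀ᵐ t, f t = 0 := by
    intro f hf h
    rw [ENNReal.rpow_eq_zero_iff_of_pos (by positivity), lintegral_eq_zero_iff (by fun_prop)] at h
    filter_upwards [h] with t ht
    exact (ENNReal.rpow_eq_zero_iff_of_pos hp0).1 ht
  rcases eq_or_ne A 0 with hA0 | hA0
  · have := zero f hf hA0
    rw [lintegral_congr_ae (g := fun _ => 0) (this.mono fun s hs => by simp [hs])]
    simp
  rcases eq_or_ne B 0 with hB0 | hB0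
  · have := zero g hg hB0
    rw [lintegral_congr fun s => lintegral_congr_ae (g := fun _ => 0)
      (this.mono fun s hs => by simp [hs])]
    simp
  rcases eq_or_ne A ⊤ with hAt | hAt
  · rw [hAt, ENNReal.top_mul hB0, ENNReal.mul_top hKne]; exact le_top
  rcases eq_or_ne B ⊤ with hBt | hBt
  · rw [hBt, ENNReal.mul_top hA0, ENNReal.mul_top hKne]; exact le_top
  have nrm : ∀ (f : ℝ → ℝ≥0∞) (A : ℝ≥0∞), Measurable f → A = (∫⁻ t, f t ^ p) ^ p⁻¹ → A ≠ 0 →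
      A ≠ ⊤ → ∫⁻ t, (A⁻¹ * f t) ^ p ≤ 1 := by
    intro f A hf hA h0 ht
    simp_rw [ENNReal.mul_rpow_of_nonneg _ _ hp0.le]
    rw [lintegral_const_mul _ (by fun_prop)]
    have : ∫⁻ t, f t ^ p = A ^ p := by
      rw [hA, ← ENNReal.rpow_mul, inv_mul_cancel₀ hp0.ne', ENNReal.rpow_one]
    rw [this, ← ENNReal.mul_rpow_of_nonneg _ _ hp0.le, ENNReal.inv_mul_cancel h0 ht,
      ENNReal.one_rpow]
  have := hls_normalized h0 h1 (hf.const_mul A⁻¹) (hg.const_mul B⁻¹)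
    (nrm f A hf hA hA0 hAt) (nrm g B hg hB hB0 hBt)
  calc ∫⁻ s, ∫⁻ t, f s * g t * ENNReal.ofReal |t - s| ^ (-θ)
      = ∫⁻ s, ∫⁻ t, (A * B) * (A⁻¹ * f s * (B⁻¹ * g t) * ENNReal.ofReal |t - s| ^ (-θ)) := by
        refine lintegral_congr fun s => lintegral_congr fun t => ?_
        calc f s * g t * ENNReal.ofReal |t - s| ^ (-θ)
            = (A * A⁻¹) * (B * B⁻¹) * (f s * g t * ENNReal.ofReal |t - s| ^ (-θ)) := by
              rw [ENNReal.mul_inv_cancel hA0 hAt, ENNReal.mul_inv_cancel hB0 hBt, one_mul, one_mul]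
          _ = _ := by ring
    _ = (A * B) * ∫⁻ s, ∫⁻ t, (A⁻¹ * f s * (B⁻¹ * g t) * ENNReal.ofReal |t - s| ^ (-θ)) := by
        rw [← lintegral_const_mul _ (by fun_prop)]
        refine lintegral_congr fun s => ?_
        rw [lintegral_const_mul _ (by fun_prop)]
    _ ≤ (A * B) * K := by gcongr
    _ = _ := mul_comm _ _

abbrev Plane := EuclideanSpace ℝ (Fin 2)

/-- A bounded measurable family of functions with common bounded support. -/
structure IsNiceFamily (F : ℝ → Plane → ℂ) : Prop where
  measurable : Measurable (Function.uncurry F)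
  bdd : ∃ M R : ℝ, ∀ t x, ‖F t x‖ ≤ (Metric.closedBall (0 : Plane) R).indicator (fun _ => M) x

lemma IsNiceFamily.isBddIntegrable {F : ℝ → Plane → ℂ} (hF : IsNiceFamily F) (t : ℝ) :
    IsBddIntegrable (F t) := by
  obtain ⟨M, R, h⟩ := hF.bdd
  have hm : Measurable (F t) := hF.measurable.comp measurable_prodMk_left
  refine ⟨hm, ⟨|M|, fun x => (h t x).trans ?_⟩, ?_⟩
  · by_cases hx : x ∈ Metric.closedBall (0 : Plane) R
    · rw [Set.indicator_of_mem hx]; exact le_abs_self M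
    · rw [Set.indicator_of_notMem hx]; exact abs_nonneg M
  · refine Integrable.mono' (g := (Metric.closedBall (0 : Plane) R).indicator (fun _ => M)) ?_
      hm.aestronglyMeasurable (Filter.Eventually.of_forall (h t))
    refine (integrable_indicator_iff Metric.isClosed_closedBall.measurableSet).2 ?_
    exact integrableOn_const (isCompact_closedBall _ _).measure_lt_top.ne

lemma le_rpow_of_le_mul_rpow {X A : ℝ≥0∞} {p q : ℝ} (hpq : p.HolderConjugate q) (hX : X ≠ ⊤)
    (h : X ≤ A * X ^ (1 / q)) : X ≤ A ^ p := by
  rcases eq_or_ne X 0 with rfl | h0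
  · exact zero_le
  have h1 : X ^ (1 / p) ≤ A := by
    have hq := hpq.symm.pos
    have e : X ^ (1 / p) * X ^ (1 / q) = X := by
      rw [← ENNReal.rpow_add _ _ h0 hX]
      have := hpq.inv_add_inv_eq_one
      rw [one_div, one_div, this, ENNReal.rpow_one]
    have hne : X ^ (1 / q) ≠ 0 := by
      simp [ENNReal.rpow_eq_zero_iff, h0, hX]
    have hnt : X ^ (1 / q) ≠ ⊤ := ENNReal.rpow_ne_top_of_nonneg (by positivity) hX
    rw [← e] at h
    refine (ENNReal.mul_le_mul_iff_left hne hnt).1 ?_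
    rwa [e] at h ⊢
  calc X = (X ^ (1 / p)) ^ p := by
        rw [← ENNReal.rpow_mul, one_div_mul_cancel hpq.ne_zero, ENNReal.rpow_one]
    _ ≤ A ^ p := ENNReal.rpow_le_rpow h1 hpq.nonneg

/-- The function dual to `w` in `L^p`. -/
def dualFun (p : ℝ) (S : Set Plane) (w : Plane → ℂ) : Plane → ℂ :=
  S.indicator fun x => (starRingEnd ℂ (w x)) * ((‖w x‖ ^ (p - 2) : ℝ) : ℂ)

lemma mul_dualFun (p : ℝ) (hp : p ≠ 0) (S : Set Plane) (w : Plane → ℂ) (x : Plane) :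
    w x * dualFun p S w x = ((S.indicator (fun x => ‖w x‖ ^ p) x : ℝ) : ℂ) := by
  by_cases hx : x ∈ S
  · rw [dualFun, Set.indicator_of_mem hx, Set.indicator_of_mem hx, ← mul_assoc, Complex.mul_conj,
      Complex.normSq_eq_norm_sq]
    rw [← Complex.ofReal_mul]
    congr 1
    rcases eq_or_ne ‖w x‖ 0 with h | h
    · simp [h, Real.zero_rpow hp]
    · rw [← Real.rpow_natCast, ← Real.rpow_add (lt_of_le_of_ne (norm_nonneg _) h.symm)]
      congr 1; push_cast; ring
  · simp [dualFun, hx]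

lemma norm_dualFun (p : ℝ) (hp : p ≠ 1) (S : Set Plane) (w : Plane → ℂ) (x : Plane) :
    ‖dualFun p S w x‖ = S.indicator (fun x => ‖w x‖ ^ (p - 1)) x := by
  by_cases hx : x ∈ S
  · rw [dualFun, Set.indicator_of_mem hx, Set.indicator_of_mem hx, norm_mul, RCLike.norm_conj,
      Complex.norm_real, Real.norm_of_nonneg (by positivity)]
    rcases eq_or_ne ‖w x‖ 0 with h | h
    · simp [h, Real.zero_rpow (sub_ne_zero.2 hp)]
    · nth_rewrite 1 [← Real.rpow_one ‖w x‖]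
      rw [← Real.rpow_add (lt_of_le_of_ne (norm_nonneg _) h.symm)]
      congr 1; ring
  · simp [dualFun, hx]

/-- Truncation region in space and size. -/
def truncSet (n : ℕ) (w : Plane → ℂ) : Set Plane := {x | ‖x‖ ≤ n ∧ ‖w x‖ ≤ n}

lemma measurableSet_truncSet (n : ℕ) {w : Plane → ℂ} (hw : Measurable w) :
    MeasurableSet (truncSet n w) :=
  (measurableSet_le measurable_norm measurable_const).inter
    (measurableSet_le hw.norm measurable_const)

lemma lintegral_truncSet_le (n : ℕ) (w : Plane → ℂ) {p : ℝ} (hp : 0 ≤ p) :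
    ∫⁻ x in truncSet n w, ‖w x‖ₑ ^ p ≤
      (n : ℝ≥0∞) ^ p * volume (Metric.closedBall (0 : Plane) n) := by
  calc ∫⁻ x in truncSet n w, ‖w x‖ₑ ^ p ≤ ∫⁻ x in truncSet n w, (n : ℝ≥0∞) ^ p := by
        refine setLIntegral_mono (by fun_prop) fun x hx => ?_
        refine ENNReal.rpow_le_rpow ?_ hp
        rw [← ofReal_norm, ← ENNReal.ofReal_natCast]
        exact ENNReal.ofReal_le_ofReal hx.2
    _ ≤ _ := by
        rw [setLIntegral_const]
        gcongr
        intro x hx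
        simpa using hx.1

lemma tendsto_lintegral_truncSet {w : Plane → ℂ} (hw : Measurable w) (p : ℝ) :
    Filter.Tendsto (fun n => ∫⁻ x in truncSet n w, ‖w x‖ₑ ^ p) Filter.atTop
      (nhds (∫⁻ x, ‖w x‖ₑ ^ p)) := by
  simp_rw [← lintegral_indicator (measurableSet_truncSet _ hw)]
  refine lintegral_tendsto_of_tendsto_of_monotone
    (fun n => ((hw.enorm.pow_const p).indicator (measurableSet_truncSet n hw)).aemeasurable)
    (Filter.Eventually.of_forall fun x n m hnm => ?_) (Filter.Eventually.of_forall fun x => ?_)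
  · refine Set.indicator_le_indicator_of_subset ?_ (fun _ => zero_le) x
    rintro y ⟨h1, h2⟩
    have : (n : ℝ) ≤ m := by exact_mod_cast hnm
    exact ⟨h1.trans this, h2.trans this⟩
  · obtain ⟨N, hN⟩ := exists_nat_ge (max ‖x‖ ‖w x‖)
    refine tendsto_const_nhds.congr' ?_
    filter_upwards [Filter.eventually_ge_atTop N] with n hn
    have : (N : ℝ) ≤ n := by exact_mod_cast hn
    rw [Set.indicator_of_mem]
    exact ⟨((le_max_left _ _).trans hN).trans this, ((le_max_right _ _).trans hN).trans this⟩

lemma measurable_dualFun (p : ℝ) {S : Set Plane} (hS : MeasurableSet S) {w : Plane → ℂ}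
    (hw : Measurable w) : Measurable (dualFun p S w) := by
  refine Measurable.indicator ?_ hS
  fun_prop

lemma enorm_dualFun_rpow {p q : ℝ} (hpq : p.HolderConjugate q) (S : Set Plane) (w : Plane → ℂ)
    (x : Plane) : ‖dualFun p S w x‖ₑ ^ q = S.indicator (fun x => ‖w x‖ₑ ^ p) x := by
  rw [← ofReal_norm, norm_dualFun p hpq.lt.ne']
  by_cases hx : x ∈ S
  · rw [Set.indicator_of_mem hx, Set.indicator_of_mem hx, ← ENNReal.ofReal_rpow_of_nonneg
      (norm_nonneg _) (by linarith [hpq.lt]), ofReal_norm, ← ENNReal.rpow_mul, hpq.sub_one_mul_conj]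
  · simp [hx, hpq.symm.pos]

lemma integral_mul_dualFun {p : ℝ} (hp : 0 < p) {S : Set Plane} (hS : MeasurableSet S)
    {w : Plane → ℂ} (hw : Measurable w) :
    ∫ x, w x * dualFun p S w x = ((∫⁻ x in S, ‖w x‖ₑ ^ p).toReal : ℂ) := by
  rw [integral_congr_ae (Filter.Eventually.of_forall (mul_dualFun p hp.ne' S w)),
    integral_complex_ofReal, integral_eq_lintegral_of_nonneg_ae
      (Filter.Eventually.of_forall (Set.indicator_nonneg fun _ _ => by positivity))
      ((hw.norm.pow_const p).indicator hS).aestronglyMeasurable, ← lintegral_indicator hS]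
  congr 2
  refine lintegral_congr fun x => ?_
  by_cases hx : x ∈ S
  · rw [Set.indicator_of_mem hx, Set.indicator_of_mem hx,
      ← ENNReal.ofReal_rpow_of_nonneg (norm_nonneg _) hp.le, ofReal_norm]
  · simp [hx]

lemma norm_dualFun_truncSet_le {p : ℝ} (hp : 1 < p) (n : ℕ) (w : Plane → ℂ) (x : Plane) :
    ‖dualFun p (truncSet n w) w x‖ ≤
      (Metric.closedBall (0 : Plane) n).indicator (fun _ => (n : ℝ) ^ (p - 1)) x := by
  rw [norm_dualFun p hp.ne']
  by_cases hx : x ∈ truncSet n w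
  · rw [Set.indicator_of_mem hx, Set.indicator_of_mem (by simpa using hx.1)]
    exact Real.rpow_le_rpow (norm_nonneg _) hx.2 (by linarith)
  · rw [Set.indicator_of_notMem hx]
    exact Set.indicator_nonneg (fun _ _ => by positivity) _

lemma lintegral_truncSet_ne_top (n : ℕ) (w : Plane → ℂ) {p : ℝ} (hp : 0 ≤ p) :
    ∫⁻ x in truncSet n w, ‖w x‖ₑ ^ p ≠ ⊤ := by
  refine ((lintegral_truncSet_le n w hp).trans_lt ?_).ne
  exact ENNReal.mul_lt_top (ENNReal.rpow_lt_top_of_nonneg hp (by simp))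
    (isCompact_closedBall _ _).measure_lt_top

/-- Converse of Hölder's inequality. -/
lemma lintegral_rpow_le_of_pairing {p q : ℝ} (hpq : p.HolderConjugate q) {w : Plane → ℂ}
    (hw : Measurable w) {b : ℝ≥0∞}
    (h : ∀ g, IsBddIntegrable g → ‖∫ x, w x * g x‖ₑ ≤ b * eLpNorm' g q volume) :
    ∫⁻ x, ‖w x‖ₑ ^ p ≤ b ^ p := by
  refine le_of_tendsto' (tendsto_lintegral_truncSet hw p) fun n => ?_
  have hSm := measurableSet_truncSet n hw
  have hfin := lintegral_truncSet_ne_top n w hpq.nonneg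
  refine le_rpow_of_le_mul_rpow hpq hfin ?_
  have hg : IsBddIntegrable (dualFun p (truncSet n w) w) :=
    (IsNiceFamily.mk (F := fun _ => dualFun p (truncSet n w) w)
      ((measurable_dualFun p hSm hw).comp measurable_snd)
      ⟨_, n, fun _ => norm_dualFun_truncSet_le hpq.lt n w⟩).isBddIntegrable 0
  have := h _ hg
  rwa [eLpNorm', lintegral_congr (enorm_dualFun_rpow hpq _ w), lintegral_indicator hSm,
    integral_mul_dualFun hpq.pos hSm hw, ← ofReal_norm, Complex.norm_real,
    Real.norm_of_nonneg ENNReal.toReal_nonneg, ENNReal.ofReal_toReal hfin] at this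

/-- Truncated spatial moments of a space-time function. -/
def truncMoment (r : ℝ) (v : ℝ → Plane → ℂ) (n : ℕ) (t : ℝ) : ℝ≥0∞ :=
  ∫⁻ x in truncSet n (v t), ‖v t x‖ₑ ^ r

lemma measurableSet_truncSet_prod (n : ℕ) {v : ℝ → Plane → ℂ}
    (hv : Measurable (Function.uncurry v)) :
    MeasurableSet {z : ℝ × Plane | z.2 ∈ truncSet n (v z.1)} :=
  (measurableSet_le measurable_snd.norm measurable_const).inter
    (measurableSet_le hv.norm measurable_const)

lemma measurable_truncMoment (r : ℝ) {v : ℝ → Plane → ℂ} (hv : Measurable (Function.uncurry v))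
    (n : ℕ) : Measurable (truncMoment r v n) := by
  have h1 : ∀ t, truncMoment r v n t =
      ∫⁻ x, {z : ℝ × Plane | z.2 ∈ truncSet n (v z.1)}.indicator
        (fun z => ‖Function.uncurry v z‖ₑ ^ r) (t, x) := by
    intro t
    have hm : Measurable (v t) := hv.comp measurable_prodMk_left
    rw [truncMoment, ← lintegral_indicator (measurableSet_truncSet n hm)]
    rfl
  rw [show truncMoment r v n = _ from funext h1]
  exact ((hv.enorm.pow_const r).indicator (measurableSet_truncSet_prod n hv)).lintegral_prod_right'

/-- Converse of the mixed-norm Hölder inequality. -/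
lemma lintegral_rpow_lintegral_le_of_pairing {q q' r r' : ℝ} (hq : q.HolderConjugate q')
    (hr : r.HolderConjugate r') {m : Measure ℝ} [IsFiniteMeasure m] {v : ℝ → Plane → ℂ}
    (hv : Measurable (Function.uncurry v)) {A : ℝ≥0∞}
    (h : ∀ F, IsNiceFamily F → ‖∫ t, (∫ x, v t x * F t x) ∂m‖ₑ ≤
      A * (∫⁻ t, eLpNorm' (F t) r' volume ^ q' ∂m) ^ (1 / q')) :
    ∫⁻ t, (∫⁻ x, ‖v t x‖ₑ ^ r) ^ (q / r) ∂m ≤ A ^ q := by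
  have hvt : ∀ t, Measurable (v t) := fun t => hv.comp measurable_prodMk_left
  have hIm := measurable_truncMoment r hv
  have hIt : ∀ n t, truncMoment r v n t ≠ ⊤ := fun n t =>
    lintegral_truncSet_ne_top n (v t) hr.nonneg
  set U : ℕ → Set ℝ := fun n => {t | (n : ℝ≥0∞)⁻¹ < truncMoment r v n t} with hU
  have hUm : ∀ n, MeasurableSet (U n) := fun n => measurableSet_lt measurable_const (hIm n)
  have hqr : 0 < q / r := div_pos hq.pos hr.pos
  have key : ∀ n, ∫⁻ t, (U n).indicator (fun t => truncMoment r v n t ^ (q / r)) t ∂m ≤ A ^ q := by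
    intro n
    rw [lintegral_indicator (hUm n)]
    set B : ℝ≥0∞ := (n : ℝ≥0∞) ^ r * volume (Metric.closedBall (0 : Plane) n) with hB
    have hIB : ∀ t, truncMoment r v n t ≤ B := fun t => lintegral_truncSet_le n (v t) hr.nonneg
    have hBt : B ≠ ⊤ := (ENNReal.mul_lt_top (ENNReal.rpow_lt_top_of_nonneg hr.nonneg (by simp))
      (isCompact_closedBall _ _).measure_lt_top).ne
    have hfin : ∫⁻ t in U n, truncMoment r v n t ^ (q / r) ∂m ≠ ⊤ := by
      refine ne_top_of_le_ne_top ?_ (lintegral_mono fun t => ENNReal.rpow_le_rpow (hIB t) hqr.le)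
      rw [lintegral_const]
      exact ENNReal.mul_ne_top (ENNReal.rpow_ne_top_of_nonneg hqr.le hBt) (measure_ne_top _ _)
    refine le_rpow_of_le_mul_rpow hq hfin ?_
    set c : ℝ → ℝ := (U n).indicator
      fun t => ((truncMoment r v n t) ^ (q / r - 1)).toReal with hc
    have hc0 : ∀ t, 0 ≤ c t := fun t => Set.indicator_nonneg (fun _ _ => ENNReal.toReal_nonneg) t
    have hcm : Measurable c := ((hIm n).pow_const _).ennreal_toReal.indicator (hUm n)
    set F : ℝ → Plane → ℂ := fun t x => (c t : ℂ) * dualFun r (truncSet n (v t)) (v t) x with hF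
    have hpos : ∀ t ∈ U n, truncMoment r v n t ≠ 0 := fun t ht =>
      (lt_of_le_of_lt zero_le ht).ne'
    have hFn : IsNiceFamily F := by
      constructor
      · refine ((Complex.measurable_ofReal.comp hcm).comp measurable_fst).mul ?_
        have : (fun z : ℝ × Plane => dualFun r (truncSet n (v z.1)) (v z.1) z.2) =
            {z : ℝ × Plane | z.2 ∈ truncSet n (v z.1)}.indicator fun z =>
              (starRingEnd ℂ (Function.uncurry v z)) *
                ((‖Function.uncurry v z‖ ^ (r - 2) : ℝ) : ℂ) := rfl
        rw [this]
        refine Measurable.indicator ?_ (measurableSet_truncSet_prod n hv)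
        fun_prop
      · obtain ⟨K, hK⟩ : ∃ K : ℝ, ∀ t, c t ≤ K := by
          refine ⟨max (B ^ (q / r - 1)).toReal (((n : ℝ≥0∞)⁻¹) ^ (q / r - 1)).toReal,
            fun t => ?_⟩
          by_cases ht : t ∈ U n
          · rw [hc, Set.indicator_of_mem ht]
            have hBp : B ≠ 0 := fun h => hpos t ht (le_antisymm (h ▸ hIB t) zero_le)
            have hn : (n : ℝ≥0∞)⁻¹ ≠ ⊤ := ((ht : (n : ℝ≥0∞)⁻¹ < _).trans_le le_top).ne
            rcases le_total 0 (q / r - 1) with h | h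
            · refine le_max_of_le_left (ENNReal.toReal_mono ?_ (ENNReal.rpow_le_rpow (hIB t) h))
              exact ENNReal.rpow_ne_top_of_nonneg h hBt
            · refine le_max_of_le_right (ENNReal.toReal_mono ?_ ?_)
              · exact ENNReal.rpow_ne_top_of_ne_zero (by simp) hn
              · rw [← neg_neg (q / r - 1), ENNReal.rpow_neg, ENNReal.rpow_neg _ (-(q / r - 1))]
                exact ENNReal.inv_le_inv.2 (ENNReal.rpow_le_rpow ht.le (by linarith))
          · rw [hc, Set.indicator_of_notMem ht]
            exact le_max_of_le_left ENNReal.toReal_nonneg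
        refine ⟨K * (n : ℝ) ^ (r - 1), n, fun t x => ?_⟩
        have hK0 : 0 ≤ K := (hc0 0).trans (hK 0)
        rw [hF, norm_mul, Complex.norm_real, Real.norm_of_nonneg (hc0 t)]
        refine (mul_le_mul (hK t) (norm_dualFun_truncSet_le hr.lt n (v t) x) (norm_nonneg _)
          hK0).trans (le_of_eq ?_)
        by_cases hx : x ∈ Metric.closedBall (0 : Plane) (n : ℝ)
        · rw [Set.indicator_of_mem hx, Set.indicator_of_mem hx]
        · rw [Set.indicator_of_notMem hx, Set.indicator_of_notMem hx, mul_zero]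
    have h2 := h F hFn
    have hpair : ∀ t, ∫ x, v t x * F t x =
        (((U n).indicator (fun t => truncMoment r v n t ^ (q / r)) t).toReal : ℂ) := by
      intro t
      simp_rw [hF, mul_left_comm (v t _)]
      rw [integral_const_mul, integral_mul_dualFun hr.pos (measurableSet_truncSet n (hvt t)) (hvt t)]
      by_cases ht : t ∈ U n
      · rw [hc, Set.indicator_of_mem ht, Set.indicator_of_mem ht, ← Complex.ofReal_mul,
          ← ENNReal.toReal_mul]
        congr 2
        change truncMoment r v n t ^ (q / r - 1) * truncMoment r v n t = _
        nth_rewrite 2 [← ENNReal.rpow_one (truncMoment r v n t)]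
        rw [← ENNReal.rpow_add _ _ (hpos t ht) (hIt n t), sub_add_cancel]
      · rw [hc, Set.indicator_of_notMem ht, Set.indicator_of_notMem ht]
        simp
    have hnorm : ∀ t, eLpNorm' (F t) r' volume ^ q' =
        (U n).indicator (fun t => truncMoment r v n t ^ (q / r)) t := by
      intro t
      have e1 : ∫⁻ x, ‖F t x‖ₑ ^ r' = ENNReal.ofReal (c t) ^ r' * truncMoment r v n t := by
        simp_rw [hF, enorm_mul, ENNReal.mul_rpow_of_nonneg _ _ hr.symm.nonneg]
        rw [lintegral_const_mul _ (((measurable_dualFun r (measurableSet_truncSet n (hvt t))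
          (hvt t)).enorm).pow_const _), lintegral_congr (enorm_dualFun_rpow hr _ _),
          lintegral_indicator (measurableSet_truncSet n (hvt t))]
        congr 2
        rw [← ofReal_norm, Complex.norm_real, Real.norm_of_nonneg (hc0 t)]
      rw [eLpNorm', e1]
      by_cases ht : t ∈ U n
      · rw [hc, Set.indicator_of_mem ht, Set.indicator_of_mem ht, ENNReal.ofReal_toReal
          (ENNReal.rpow_ne_top_of_ne_zero (hpos t ht) (hIt n t)), ← ENNReal.rpow_mul,
          ← ENNReal.rpow_mul (truncMoment r v n t)]
        nth_rewrite 2 [← ENNReal.rpow_one (truncMoment r v n t)]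
        rw [← ENNReal.rpow_add _ _ (hpos t ht) (hIt n t), ← ENNReal.rpow_mul]
        congr 1
        have a1 := hr.sub_one_mul_conj
        have a2 := hq.sub_one_mul_conj
        have a3 := hr.symm.pos
        have a4 := hr.pos
        field_simp
        linear_combination (-q') * a1 + r' * a2
      · rw [hc, Set.indicator_of_notMem ht, Set.indicator_of_notMem ht]
        simp [hr.symm.pos, hq.symm.pos]
    rw [lintegral_congr hnorm, lintegral_indicator (hUm n), integral_congr_ae
      (Filter.Eventually.of_forall hpair), integral_complex_ofReal,
      integral_toReal (((hIm n).pow_const _).indicator (hUm n)).aemeasurable,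
      lintegral_indicator (hUm n), ← ofReal_norm, Complex.norm_real,
      Real.norm_of_nonneg ENNReal.toReal_nonneg, ENNReal.ofReal_toReal hfin] at h2
    · exact h2
    · refine Filter.Eventually.of_forall fun t => ?_
      by_cases ht : t ∈ U n
      · rw [Set.indicator_of_mem ht]
        exact ENNReal.rpow_lt_top_of_nonneg hqr.le (hIt n t)
      · rw [Set.indicator_of_notMem ht]; exact ENNReal.zero_lt_top
  calc ∫⁻ t, (∫⁻ x, ‖v t x‖ₑ ^ r) ^ (q / r) ∂m
      ≤ ∫⁻ t, Filter.liminf (fun n => (U n).indicator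
          (fun t => truncMoment r v n t ^ (q / r)) t) Filter.atTop ∂m := by
        refine lintegral_mono fun t => ?_
        have ht := tendsto_lintegral_truncSet (hvt t) r
        rcases eq_or_ne (∫⁻ x, ‖v t x‖ₑ ^ r) 0 with h0 | h0
        · simp [h0, hqr]
        refine le_of_eq (Filter.Tendsto.liminf_eq ?_).symm
        refine (ht.ennrpow_const (q / r)).congr' ?_
        have : ∀ᶠ n : ℕ in Filter.atTop, (n : ℝ≥0∞)⁻¹ < truncMoment r v n t :=
          ENNReal.tendsto_inv_nat_nhds_zero.eventually_lt ht (pos_iff_ne_zero.2 h0)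
        filter_upwards [this] with n hn
        rw [Set.indicator_of_mem (show t ∈ U n from hn)]
        rfl
    _ ≤ Filter.liminf (fun n => ∫⁻ t, (U n).indicator
          (fun t => truncMoment r v n t ^ (q / r)) t ∂m) Filter.atTop :=
        lintegral_liminf_le fun n => ((hIm n).pow_const _).indicator (hUm n)
    _ ≤ A ^ q := Filter.liminf_le_of_frequently_le' (Filter.Frequently.of_forall key)

/-- Rearrangement of a fourfold product. -/
def prodPairEquiv (α β : Type*) [MeasurableSpace α] [MeasurableSpace β] :
    (α × α) × (β × β) ≃ᵐ (α × β) × (α × β) :=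
  MeasurableEquiv.prodAssoc.trans <|
    ((MeasurableEquiv.refl α).prodCongr MeasurableEquiv.prodAssoc.symm).trans <|
    ((MeasurableEquiv.refl α).prodCongr MeasurableEquiv.prodComm).trans
      MeasurableEquiv.prodAssoc.symm

lemma prodPairEquiv_apply {α β : Type*} [MeasurableSpace α] [MeasurableSpace β]
    (p : (α × α) × (β × β)) :
    prodPairEquiv α β p = ((p.1.1, p.2.2), (p.1.2, p.2.1)) := rfl

lemma measurePreserving_prodPairEquiv {α β : Type*} [MeasurableSpace α] [MeasurableSpace β]
    (μ : Measure α) (ν : Measure β) [SFinite μ] [SFinite ν] :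
    MeasurePreserving (prodPairEquiv α β) ((μ.prod μ).prod (ν.prod ν))
      ((μ.prod ν).prod (μ.prod ν)) := by
  refine (measurePreserving_prodAssoc μ μ (ν.prod ν)).trans ?_
  refine MeasurePreserving.trans (μb := μ.prod ((μ.prod ν).prod ν)) ?_ ?_
  · exact (MeasurePreserving.id μ).prod (MeasurePreserving.symm _ (measurePreserving_prodAssoc μ ν ν))
  refine MeasurePreserving.trans (μb := μ.prod (ν.prod (μ.prod ν))) ?_ ?_
  · exact (MeasurePreserving.id μ).prod Measure.measurePreserving_swap
  · exact MeasurePreserving.symm _ (measurePreserving_prodAssoc μ ν (μ.prod ν))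

lemma IsBddIntegrable.conj {f : Plane → ℂ} (hf : IsBddIntegrable f) :
    IsBddIntegrable fun x => (starRingEnd ℂ) (f x) := by
  obtain ⟨M, hM⟩ := hf.bdd
  refine ⟨?_, ⟨M, fun x => by rw [RCLike.norm_conj]; exact hM x⟩, ?_⟩
  · have := hf.measurable; fun_prop
  · refine hf.integrable.norm.mono' ?_ (Filter.Eventually.of_forall fun x => ?_)
    · have := hf.measurable
      exact Measurable.aestronglyMeasurable (by fun_prop)
    · rw [RCLike.norm_conj]

lemma IsNiceFamily.integrable {F : ℝ → Plane → ℂ} (hF : IsNiceFamily F) (m : Measure ℝ)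
    [IsFiniteMeasure m] : Integrable (Function.uncurry F) (m.prod volume) := by
  obtain ⟨M, R, h⟩ := hF.bdd
  refine Integrable.mono' (g := fun z : ℝ × Plane =>
    (1 : ℝ) * (Metric.closedBall (0 : Plane) R).indicator (fun _ => M) z.2) ?_
    hF.measurable.aestronglyMeasurable
    (Filter.Eventually.of_forall fun z => (h z.1 z.2).trans_eq (one_mul _).symm)
  refine Integrable.mul_prod (f := fun _ : ℝ => (1 : ℝ)) (integrable_const 1) ?_
  refine (integrable_indicator_iff Metric.isClosed_closedBall.measurableSet).2 ?_
  exact integrableOn_const (isCompact_closedBall _ _).measure_lt_top.ne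

lemma measurable_eLpNorm'_slice {F : ℝ → Plane → ℂ} (hF : Measurable (Function.uncurry F))
    (p : ℝ) : Measurable fun t => eLpNorm' (F t) p volume := by
  have h1 : Measurable fun z : ℝ × Plane => ‖F z.1 z.2‖ₑ ^ p := hF.enorm.pow_const _
  exact (h1.lintegral_prod_right').pow_const _

/-- The space-time superposition of heat kernels dual to the free evolution. -/
def dualOp (m : Measure ℝ) (ε s : ℝ) (F : ℝ → Plane → ℂ) (x : Plane) : ℂ :=
  ∫ a : ℝ × Plane, heatKer (ε + (a.1 - s : ℝ) * I) (x - a.2) * F a.1 a.2 ∂(m.prod volume)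

lemma measurable_dualKer (ε s : ℝ) : Measurable fun z : Plane × (ℝ × Plane) =>
    heatKer (ε + (z.2.1 - s : ℝ) * I) (z.1 - z.2.2) :=
  measurable_heatKer.comp (f := fun z : Plane × (ℝ × Plane) =>
    (((ε : ℂ) + (z.2.1 - s : ℝ) * I), z.1 - z.2.2)) (by fun_prop)

lemma norm_heatKer_le_of_re {ε : ℝ} (hε : 0 < ε) {z : ℂ} (hz : z.re = ε) (x : Plane) :
    ‖heatKer z x‖ ≤ (4 * π * ε)⁻¹ := by
  refine (norm_heatKer_le (by rw [hz]; exact hε.le) x).trans ?_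
  gcongr
  rw [← hz]
  exact (le_abs_self _).trans (Complex.abs_re_le_norm z)

lemma integral_norm_heatKer {z : ℂ} (hz : 0 < z.re) : ∫ x, ‖heatKer z x‖ = ‖z‖ / z.re := by
  have hz0 : 0 < ‖z‖ := norm_pos_iff.2 (by rintro rfl; simp at hz)
  have hδ : 0 < ‖z‖ ^ 2 / z.re := by positivity
  have h := integral_norm_heatKer_ofReal hδ
  have e : ∀ x, ‖heatKer z x‖ = ‖z‖ / z.re * ‖heatKer ((‖z‖ ^ 2 / z.re : ℝ) : ℂ) x‖ := by
    intro x
    rw [norm_heatKer, norm_heatKer, Complex.norm_real, Real.norm_of_nonneg hδ.le, Complex.ofReal_re]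
    have : z.re / (4 * ‖z‖ ^ 2) = ‖z‖ ^ 2 / z.re / (4 * (‖z‖ ^ 2 / z.re) ^ 2) := by
      field_simp
    rw [this, ← mul_assoc]
    congr 1
    field_simp
  simp_rw [e]
  rw [integral_const_mul, h, mul_one]

lemma lintegral_enorm_dualOp_le {θ : ℝ} (h0 : 0 ≤ θ) (h1 : θ < 1) {C : ℝ≥0∞}
    (hC : HLSBound θ C)
    {ε : ℝ} (hε : 0 < ε) (s : ℝ) {I₀ : Set ℝ} (hI₀ : MeasurableSet I₀) {T : ℝ} (hT0 : 0 ≤ T)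
    (hT : I₀ ⊆ Set.Ioc 0 T) {F : ℝ → Plane → ℂ} (hF : IsNiceFamily F) :
    Measurable (dualOp (volume.restrict I₀) ε s F) ∧
    ∫⁻ x, ‖dualOp (volume.restrict I₀) ε s F x‖ₑ ^ (2 : ℝ) ≤
      C * (∫⁻ t in I₀, eLpNorm' (F t) (2 / (1 + θ)) volume ^ (2 / (2 - θ))) ^ (2 - θ) := by
  have hfinI : volume I₀ < ⊤ := (measure_mono hT).trans_lt measure_Ioc_lt_top
  set m : Measure ℝ := volume.restrict I₀ with hm
  have : IsFiniteMeasure m := ⟨by rw [hm, Measure.restrict_apply_univ]; exact hfinI⟩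
  set k : Plane → ℝ × Plane → ℂ := fun x a =>
    I₀.indicator (fun t => heatKer (ε + (t - s : ℝ) * I) (x - a.2)) a.1 with hk
  set z : ℝ → ℂ := fun t => ε + (t - s : ℝ) * I with hz
  have hzre : ∀ t, (z t).re = ε := fun t => by simp [hz]
  have hkm : Measurable (Function.uncurry k) := by
    have : Function.uncurry k = {p : Plane × (ℝ × Plane) | p.2.1 ∈ I₀}.indicator
      fun p => heatKer (ε + (p.2.1 - s : ℝ) * I) (p.1 - p.2.2) := rfl
    rw [this]
    exact (measurable_dualKer ε s).indicator (hI₀.preimage (by fun_prop))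
  have hκ : ∀ x a, ‖k x a‖ ≤ (4 * π * ε)⁻¹ := fun x a => by
    rw [hk]
    refine (norm_indicator_le_norm_self _ _).trans (norm_heatKer_le_of_re hε (hzre a.1) _)
  have hki : ∀ a, Integrable (fun x => k x a) := fun a => by
    by_cases ha : a.1 ∈ I₀
    · simp only [hk, Set.indicator_of_mem ha]
      exact (integrable_heatKer (by rw [hzre]; exact hε)).comp_sub_right a.2
    · simp [hk, Set.indicator_of_notMem ha]
  have hL : ∀ a, ∫ x, ‖k x a‖ ≤ (ε + (T + |s|)) / ε := fun a => by
    by_cases ha : a.1 ∈ I₀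
    · simp only [hk, Set.indicator_of_mem ha]
      have := integral_norm_heatKer (z := z a.1) (by rw [hzre]; exact hε)
      rw [integral_sub_right_eq_self (fun x => ‖heatKer (z a.1) x‖) a.2, this, hzre]
      gcongr
      refine (norm_add_le _ _).trans ?_
      rw [norm_mul, Complex.norm_I, mul_one, Complex.norm_real, Complex.norm_real,
        Real.norm_of_nonneg hε.le, Real.norm_eq_abs]
      gcongr
      refine (abs_sub _ _).trans ?_
      gcongr
      rw [abs_of_pos (hT ha).1]
      exact (hT ha).2
    · simp only [hk, Set.indicator_of_notMem ha, norm_zero, integral_zero]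
      positivity
  have hmem : ∀ᵐ a ∂(m.prod (volume : Measure Plane)), a.1 ∈ I₀ :=
    Measure.quasiMeasurePreserving_fst.ae (ae_restrict_mem hI₀)
  have hW : ∀ x, dualOp m ε s F x = ∫ a, k x a * Function.uncurry F a ∂(m.prod volume) := by
    intro x
    refine integral_congr_ae (hmem.mono fun a ha => ?_)
    simp only [hk, Set.indicator_of_mem ha]
    rfl
  obtain ⟨hi, heq⟩ := integral_norm_sq_integral_mul (m := m.prod volume) (μ := volume)
    hkm (by positivity) hκ hki hL hF.measurable (hF.integrable m)
  have hWm : Measurable (dualOp m ε s F) := by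
    rw [funext hW]
    refine StronglyMeasurable.measurable ?_
    refine StronglyMeasurable.integral_prod_right' (f := fun z : Plane × (ℝ × Plane) =>
      k z.1 z.2 * Function.uncurry F z.2) ?_
    exact (hkm.mul (hF.measurable.comp measurable_snd)).stronglyMeasurable
  refine ⟨hWm, ?_⟩
  set Z : ℝ × ℝ → ℂ := fun t => (2 * ε : ℝ) + (t.1 - t.2 : ℝ) * I with hZ
  have hZre : ∀ t, (Z t).re = 2 * ε := fun t => by simp [hZ]
  have hZim : ∀ t, (Z t).im = t.1 - t.2 := fun t => by simp [hZ]
  set Φ : (ℝ × Plane) × (ℝ × Plane) → ℂ := fun p =>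
    (Function.uncurry F p.1 * (starRingEnd ℂ) (Function.uncurry F p.2)) *
      heatKer (Z (p.1.1, p.2.1)) (p.1.2 - p.2.2) with hΦ
  have hFi := hF.integrable m
  have hFci : Integrable (fun a => (starRingEnd ℂ) (Function.uncurry F a)) (m.prod volume) := by
    refine hFi.norm.mono' ?_ (Filter.Eventually.of_forall fun x => ?_)
    · have := hF.measurable
      exact Measurable.aestronglyMeasurable (by fun_prop)
    · rw [RCLike.norm_conj]
  have hΦi : Integrable Φ ((m.prod volume).prod (m.prod volume)) := by
    refine (hFi.mul_prod hFci).mul_bdd (c := (4 * π * (2 * ε))⁻¹) ?_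
      (Filter.Eventually.of_forall fun p => norm_heatKer_le_of_re (by positivity) (hZre _) _)
    refine Measurable.aestronglyMeasurable ?_
    exact measurable_heatKer.comp (f := fun p : (ℝ × Plane) × (ℝ × Plane) =>
      (Z (p.1.1, p.2.1), p.1.2 - p.2.2)) (by fun_prop)
  have hinner : ∫ p, (Function.uncurry F p.1 * (starRingEnd ℂ) (Function.uncurry F p.2)) *
      (∫ x, k x p.1 * (starRingEnd ℂ) (k x p.2)) ∂((m.prod volume).prod (m.prod volume)) =
      ∫ p, Φ p ∂((m.prod volume).prod (m.prod volume)) := by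
    have a1 : ∀ᵐ p ∂((m.prod (volume : Measure Plane)).prod (m.prod (volume : Measure Plane))),
      p.1.1 ∈ I₀ := Measure.quasiMeasurePreserving_fst.ae hmem
    have a2 : ∀ᵐ p ∂((m.prod (volume : Measure Plane)).prod (m.prod (volume : Measure Plane))),
      p.2.1 ∈ I₀ := Measure.quasiMeasurePreserving_snd.ae hmem
    refine integral_congr_ae ?_
    filter_upwards [a1, a2] with p h1 h2
    simp only [hk, hΦ, Set.indicator_of_mem h1, Set.indicator_of_mem h2, conj_heatKer]
    rw [integral_heatKer_mul]
    · congr 2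
      simp only [hZ, map_add, map_mul, Complex.conj_ofReal, Complex.conj_I]
      push_cast
      ring
    · simpa using hε
    · simpa using hε
  have hform : ∫ p, Φ p ∂((m.prod volume).prod (m.prod volume)) =
      ∫ t, heatForm (Z t) (F t.1) (fun x => (starRingEnd ℂ) (F t.2 x)) ∂(m.prod m) := by
    have mp := measurePreserving_prodPairEquiv m (volume : Measure Plane)
    rw [← mp.integral_comp' Φ, integral_prod]
    · refine integral_congr_ae (Filter.Eventually.of_forall fun t => ?_)
      refine integral_congr_ae (Filter.Eventually.of_forall fun p => ?_)
      simp only [prodPairEquiv_apply, hΦ, Function.uncurry_apply_pair]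
      rw [heatKer_sub_comm, mul_comm]
    · exact (mp.integrable_comp_emb (MeasurableEquiv.measurableEmbedding _)).2 hΦi
  set N : ℝ → ℝ≥0∞ := fun t => eLpNorm' (F t) (2 / (1 + θ)) volume with hN
  have hNm : Measurable N := measurable_eLpNorm'_slice hF.measurable _
  have hconj : ∀ t, eLpNorm' (fun x => (starRingEnd ℂ) (F t x)) (2 / (1 + θ)) volume = N t := by
    intro t
    simp only [hN, eLpNorm']
    simp_rw [← ofReal_norm, RCLike.norm_conj]
  calc ∫⁻ x, ‖dualOp m ε s F x‖ₑ ^ (2 : ℝ)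
      = ‖((∫ x, ‖∫ a, k x a * Function.uncurry F a ∂(m.prod volume)‖ ^ 2 : ℝ) : ℂ)‖ₑ := by
        rw [← ofReal_norm, Complex.norm_real, Real.norm_of_nonneg
          (integral_nonneg fun _ => by positivity), ofReal_integral_eq_lintegral_ofReal hi
          (Filter.Eventually.of_forall fun _ => by positivity)]
        refine lintegral_congr fun x => ?_
        rw [hW, ENNReal.ofReal_pow (norm_nonneg _), ofReal_norm, ← ENNReal.rpow_natCast]
        norm_num
    _ = ‖∫ t, heatForm (Z t) (F t.1) (fun x => (starRingEnd ℂ) (F t.2 x)) ∂(m.prod m)‖ₑ := by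
        rw [heq, hinner, hform]
    _ ≤ ∫⁻ t, N t.1 * N t.2 * ENNReal.ofReal |t.2 - t.1| ^ (-θ) ∂(m.prod m) := by
        refine (enorm_integral_le_lintegral_enorm _).trans (lintegral_mono fun t => ?_)
        refine (enorm_heatForm_le (by rw [hZre]; positivity) h0 h1.le (hF.isBddIntegrable t.1)
          (hF.isBddIntegrable t.2).conj).trans (le_of_eq ?_)
        rw [hconj, hZim, abs_sub_comm, mul_comm]
    _ = ∫⁻ t, ∫⁻ t', I₀.indicator N t * I₀.indicator N t' * ENNReal.ofReal |t' - t| ^ (-θ) := by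
        rw [lintegral_prod _ (by fun_prop), hm, ← lintegral_indicator hI₀]
        refine lintegral_congr fun t => ?_
        by_cases ht : t ∈ I₀
        · rw [Set.indicator_of_mem ht, ← lintegral_indicator hI₀]
          refine lintegral_congr fun t' => ?_
          by_cases ht' : t' ∈ I₀
          · simp only [Set.indicator_of_mem ht', Set.indicator_of_mem ht]
          · simp [Set.indicator_of_notMem ht']
        · simp [Set.indicator_of_notMem ht]
    _ ≤ C * ((∫⁻ t, I₀.indicator N t ^ (2 / (2 - θ))) ^ ((2 - θ) / 2) *
          (∫⁻ t, I₀.indicator N t ^ (2 / (2 - θ))) ^ ((2 - θ) / 2)) :=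
        hC _ _ (hNm.indicator hI₀) (hNm.indicator hI₀)
    _ = _ := by
        have hp : 0 < 2 / (2 - θ) := div_pos two_pos (by linarith)
        have : ∀ t, I₀.indicator N t ^ (2 / (2 - θ)) =
            I₀.indicator (fun t => N t ^ (2 / (2 - θ))) t := by
          intro t
          by_cases ht : t ∈ I₀
          · simp only [Set.indicator_of_mem ht]
          · simp [Set.indicator_of_notMem ht, hp]
        simp_rw [this]
        rw [lintegral_indicator hI₀, ← ENNReal.rpow_add_of_nonneg _ _ (by linarith) (by linarith),
          add_halves]

lemma measurable_heatOp_param {α : Type*} [MeasurableSpace α] {z : α → ℂ} (hz : Measurable z)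
    {f : α → Plane → ℂ} (hf : Measurable (Function.uncurry f)) {y : α → Plane}
    (hy : Measurable y) : Measurable fun a => heatOp (z a) (f a) (y a) := by
  refine StronglyMeasurable.measurable ?_
  refine StronglyMeasurable.integral_prod_right' (f := fun p : α × Plane =>
    heatKer (z p.1) (y p.1 - p.2) * f p.1 p.2) ?_
  refine Measurable.stronglyMeasurable (Measurable.mul ?_ hf)
  exact measurable_heatKer.comp (f := fun p : α × Plane => (z p.1, y p.1 - p.2)) (by fun_prop)

lemma re_add_mul_I (ε τ : ℝ) : ((ε : ℂ) + (τ : ℂ) * I).re = ε := by simp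

lemma im_add_mul_I (ε τ : ℝ) : ((ε : ℂ) + (τ : ℂ) * I).im = τ := by simp

lemma integral_heatOp_mul_eq {ε : ℝ} (hε : 0 < ε) (s : ℝ) (m : Measure ℝ) [IsFiniteMeasure m]
    {f : Plane → ℂ} (hf : IsBddIntegrable f) {F : ℝ → Plane → ℂ} (hF : IsNiceFamily F) :
    ∫ t, (∫ y, heatOp (ε + (t - s : ℝ) * I) f y * F t y) ∂m =
      ∫ x, f x * dualOp m ε s F x := by
  have hFi := hF.integrable m
  have hInt : Integrable (Function.uncurry fun (a : ℝ × Plane) (x : Plane) =>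
      heatKer (ε + (a.1 - s : ℝ) * I) (a.2 - x) * (f x * F a.1 a.2))
      ((m.prod volume).prod volume) := by
    refine (hFi.mul_prod hf.integrable).bdd_mul (c := (4 * π * ε)⁻¹)
      (f := fun p : (ℝ × Plane) × Plane => heatKer (ε + (p.1.1 - s : ℝ) * I) (p.1.2 - p.2))
      ?_ (Filter.Eventually.of_forall fun p => norm_heatKer_le_of_re hε (re_add_mul_I _ _) _) |>.congr
      (Filter.Eventually.of_forall fun p => ?_)
    · refine Measurable.aestronglyMeasurable ?_
      exact measurable_heatKer.comp (f := fun p : (ℝ × Plane) × Plane =>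
        ((ε : ℂ) + (p.1.1 - s : ℝ) * I, p.1.2 - p.2)) (by fun_prop)
    · simp only [Function.uncurry]
      ring
  have h1 : ∀ a : ℝ × Plane, ∫ x, heatKer (ε + (a.1 - s : ℝ) * I) (a.2 - x) *
      (f x * F a.1 a.2) = heatOp (ε + (a.1 - s : ℝ) * I) f a.2 * F a.1 a.2 := by
    intro a
    rw [heatOp, ← integral_mul_const]
    simp_rw [mul_assoc]
  calc ∫ t, (∫ y, heatOp (ε + (t - s : ℝ) * I) f y * F t y) ∂m
      = ∫ a : ℝ × Plane, heatOp (ε + (a.1 - s : ℝ) * I) f a.2 * F a.1 a.2 ∂(m.prod volume) := by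
        rw [integral_prod]
        have := hInt.integral_prod_left
        simp only [Function.uncurry_apply_pair, h1] at this
        exact this
    _ = ∫ a : ℝ × Plane, (∫ x, heatKer (ε + (a.1 - s : ℝ) * I) (a.2 - x) *
          (f x * F a.1 a.2)) ∂(m.prod volume) := by simp_rw [h1]
    _ = ∫ x, (∫ a : ℝ × Plane, heatKer (ε + (a.1 - s : ℝ) * I) (a.2 - x) *
          (f x * F a.1 a.2) ∂(m.prod volume)) := integral_integral_swap hInt
    _ = _ := by
        refine integral_congr_ae (Filter.Eventually.of_forall fun x => ?_)
        simp only [dualOp]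
        rw [← integral_const_mul]
        refine integral_congr_ae (Filter.Eventually.of_forall fun a => ?_)
        simp only []
        rw [heatKer_sub_comm]
        ring

lemma eLpNorm'_dualOp_two_le {θ : ℝ} (h0 : 0 ≤ θ) (h1 : θ < 1) {C : ℝ≥0∞} (hC : HLSBound θ C)
    {ε : ℝ} (hε : 0 < ε) (s : ℝ) {I₀ : Set ℝ} (hI₀ : MeasurableSet I₀) {T : ℝ} (hT0 : 0 ≤ T)
    (hT : I₀ ⊆ Set.Ioc 0 T) {F : ℝ → Plane → ℂ} (hF : IsNiceFamily F) :
    eLpNorm' (dualOp (volume.restrict I₀) ε s F) 2 volume ≤ C ^ (1 / 2 : ℝ) *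
      (∫⁻ t in I₀, eLpNorm' (F t) (2 / (1 + θ)) volume ^ (2 / (2 - θ))) ^ ((2 - θ) / 2) := by
  have := (lintegral_enorm_dualOp_le h0 h1 hC hε s hI₀ hT0 hT hF).2
  rw [eLpNorm']
  refine (ENNReal.rpow_le_rpow this (by norm_num)).trans (le_of_eq ?_)
  rw [ENNReal.mul_rpow_of_nonneg _ _ (by norm_num), ← ENNReal.rpow_mul, mul_one_div]

/-- Dual form of the homogeneous Strichartz estimate, regularized. -/
lemma enorm_integral_heatOp_mul_le {θ : ℝ} (h0 : 0 ≤ θ) (h1 : θ < 1) {C : ℝ≥0∞}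
    (hC : HLSBound θ C) {ε : ℝ} (hε : 0 < ε) (s : ℝ) {I₀ : Set ℝ} (hI₀ : MeasurableSet I₀) {T : ℝ}
    (hT0 : 0 ≤ T) (hT : I₀ ⊆ Set.Ioc 0 T) {f : Plane → ℂ} (hf : IsBddIntegrable f)
    {F : ℝ → Plane → ℂ} (hF : IsNiceFamily F) :
    ‖∫ t in I₀, ∫ y, heatOp (ε + (t - s : ℝ) * I) f y * F t y‖ₑ ≤ C ^ (1 / 2 : ℝ) *
      eLpNorm' f 2 volume *
      (∫⁻ t in I₀, eLpNorm' (F t) (2 / (1 + θ)) volume ^ (2 / (2 - θ))) ^ ((2 - θ) / 2) := by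
  have hfinI : volume I₀ < ⊤ := (measure_mono hT).trans_lt measure_Ioc_lt_top
  have : IsFiniteMeasure (volume.restrict I₀) :=
    ⟨by rw [Measure.restrict_apply_univ]; exact hfinI⟩
  rw [integral_heatOp_mul_eq hε s _ hf hF]
  refine (enorm_integral_mul_le_eLpNorm' Real.HolderConjugate.two_two hf.measurable
    (lintegral_enorm_dualOp_le h0 h1 hC hε s hI₀ hT0 hT hF).1).trans ?_
  rw [mul_comm (C ^ _), mul_assoc]
  gcongr
  exact eLpNorm'_dualOp_two_le h0 h1 hC hε s hI₀ hT0 hT hF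

/-- Regularized homogeneous Strichartz estimate. -/
lemma lintegral_eLpNorm'_heatOp_le {θ : ℝ} (h0 : 0 < θ) (h1 : θ < 1) {C : ℝ≥0∞}
    (hC : HLSBound θ C) {ε : ℝ} (hε : 0 < ε) (s : ℝ) {I₀ : Set ℝ} (hI₀ : MeasurableSet I₀) {T : ℝ}
    (hT0 : 0 ≤ T) (hT : I₀ ⊆ Set.Ioc 0 T) {f : Plane → ℂ} (hf : IsBddIntegrable f) :
    ∫⁻ t in I₀, eLpNorm' (heatOp (ε + (t - s : ℝ) * I) f) (2 / (1 - θ)) volume ^ (2 / θ) ≤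
      (C ^ (1 / 2 : ℝ) * eLpNorm' f 2 volume) ^ (2 / θ) := by
  have hfinI : volume I₀ < ⊤ := (measure_mono hT).trans_lt measure_Ioc_lt_top
  have : IsFiniteMeasure (volume.restrict I₀) :=
    ⟨by rw [Measure.restrict_apply_univ]; exact hfinI⟩
  have hθ : 0 < 1 - θ := by linarith
  have hθ2 : 0 < 2 - θ := by linarith
  have hq : (2 / θ).HolderConjugate (2 / (2 - θ)) := by
    refine Real.holderConjugate_iff.2 ⟨?_, ?_⟩
    · rw [lt_div_iff₀ h0]; linarith
    · field_simp; ring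
  have hr : (2 / (1 - θ)).HolderConjugate (2 / (1 + θ)) := by
    refine Real.holderConjugate_iff.2 ⟨?_, ?_⟩
    · rw [lt_div_iff₀ hθ]; linarith
    · field_simp; ring
  have hv : Measurable (Function.uncurry fun t y => heatOp (ε + (t - s : ℝ) * I) f y) :=
    measurable_heatOp_param (α := ℝ × Plane) (z := fun p => ε + (p.1 - s : ℝ) * I)
      (f := fun _ => f) (y := fun p => p.2) (by fun_prop) (hf.measurable.comp measurable_snd)
      (by fun_prop)
  have := lintegral_rpow_lintegral_le_of_pairing hq hr (m := volume.restrict I₀) hv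
    (A := C ^ (1 / 2 : ℝ) * eLpNorm' f 2 volume) fun F hF => by
      rw [one_div_div]
      exact enorm_integral_heatOp_mul_le h0.le h1 hC hε s hI₀ hT0 hT hf hF
  refine le_trans (le_of_eq (lintegral_congr fun t => ?_)) this
  rw [eLpNorm', ← ENNReal.rpow_mul, one_div_mul_eq_div]

lemma exists_enorm_heatOp_le {ε : ℝ} (hε : 0 < ε) (L : ℝ) {p q : ℝ} (hpq : p.HolderConjugate q) :
    ∃ c : ℝ≥0∞, c ≠ ⊤ ∧ ∀ z : ℂ, z.re = ε → ‖z‖ ≤ L → ∀ f : Plane → ℂ, Measurable f →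
      ∀ y, ∫⁻ x, ‖heatKer z (y - x) * f x‖ₑ ≤ c * eLpNorm' f q volume := by
  refine ⟨(ENNReal.ofReal ((4 * π * ε)⁻¹ ^ (p - 1) * (L / ε))) ^ (1 / p), ?_,
    fun z hz hL f hf y => ?_⟩
  · exact ENNReal.rpow_ne_top_of_nonneg (one_div_nonneg.2 hpq.nonneg) ENNReal.ofReal_ne_top
  have hzp : 0 < z.re := hz ▸ hε
  have hm : Measurable fun x => heatKer z (y - x) :=
    (continuous_heatKer z).measurable.comp (by fun_prop)
  simp_rw [enorm_mul]
  refine (ENNReal.lintegral_mul_le_Lp_mul_Lq volume hpq hm.enorm.aemeasurable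
    hf.enorm.aemeasurable).trans ?_
  rw [eLpNorm']
  have hpi : 0 ≤ 1 / p := one_div_nonneg.2 hpq.nonneg
  gcongr
  have hi : Integrable fun x => ‖heatKer z (y - x)‖ := ((integrable_heatKer hzp).comp_sub_left y).norm
  calc ∫⁻ x, ‖heatKer z (y - x)‖ₑ ^ p
      ≤ ∫⁻ x, ENNReal.ofReal ((4 * π * ε)⁻¹ ^ (p - 1)) * ENNReal.ofReal ‖heatKer z (y - x)‖ := by
        refine lintegral_mono fun x => ?_
        rw [← ENNReal.ofReal_mul (by positivity), ← ofReal_norm,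
          ENNReal.ofReal_rpow_of_nonneg (norm_nonneg _) hpq.nonneg]
        refine ENNReal.ofReal_le_ofReal ?_
        rw [show p = (p - 1) + 1 by ring, Real.rpow_add_of_nonneg (norm_nonneg _)
          (by linarith [hpq.lt]) zero_le_one, Real.rpow_one, add_sub_cancel_right]
        gcongr
        · linarith [hpq.lt]
        · exact norm_heatKer_le_of_re hε hz _
    _ = ENNReal.ofReal ((4 * π * ε)⁻¹ ^ (p - 1) * (‖z‖ / ε)) := by
        rw [lintegral_const_mul _ (by fun_prop), ← ofReal_integral_eq_lintegral_ofReal hi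
          (Filter.Eventually.of_forall fun _ => norm_nonneg _),
          integral_sub_left_eq_self (fun x => ‖heatKer z x‖), integral_norm_heatKer hzp, hz,
          ← ENNReal.ofReal_mul (by positivity)]
    _ ≤ _ := by gcongr

/-- Logarithmic convexity of the `L^p` norms. -/
lemma eLpNorm'_interp {α : Type*} [MeasurableSpace α] {μ : Measure α} {w : α → ℂ}
    (hw : Measurable w) {θ η : ℝ} (h0 : 0 ≤ θ) (h1 : θ < 1) (hη0 : 0 ≤ η) (hη1 : η ≤ 1) :
    eLpNorm' w (2 / (1 - η * θ)) μ ≤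
      eLpNorm' w 2 μ ^ (1 - η) * eLpNorm' w (2 / (1 - θ)) μ ^ η := by
  have hθ : 0 < 1 - θ := by linarith
  have hηθ : 0 < 1 - η * θ := by nlinarith
  have ha : 0 ≤ (1 - η) / (1 - η * θ) := div_nonneg (by linarith) hηθ.le
  have hb : 0 ≤ η * (1 - θ) / (1 - η * θ) := by positivity
  have hab : (1 - η) / (1 - η * θ) + η * (1 - θ) / (1 - η * θ) = 1 := by field_simp; ring
  have := ENNReal.lintegral_mul_norm_pow_le (μ := μ) (hw.enorm.pow_const (2 : ℝ)).aemeasurable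
    (hw.enorm.pow_const (2 / (1 - θ))).aemeasurable ha hb hab
  have e : ∀ x, (‖w x‖ₑ ^ (2 : ℝ)) ^ ((1 - η) / (1 - η * θ)) *
      (‖w x‖ₑ ^ (2 / (1 - θ))) ^ (η * (1 - θ) / (1 - η * θ)) = ‖w x‖ₑ ^ (2 / (1 - η * θ)) := by
    intro x
    rw [← ENNReal.rpow_mul, ← ENNReal.rpow_mul, ← ENNReal.rpow_add_of_nonneg _ _
      (by positivity) (by positivity)]
    congr 1
    field_simp
    ring
  rw [lintegral_congr e] at this
  rw [eLpNorm']
  refine (ENNReal.rpow_le_rpow this (by positivity)).trans (le_of_eq ?_)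
  rw [ENNReal.mul_rpow_of_nonneg _ _ (by positivity), eLpNorm', eLpNorm', ← ENNReal.rpow_mul,
    ← ENNReal.rpow_mul, ← ENNReal.rpow_mul, ← ENNReal.rpow_mul]
  congr 2
  · field_simp
  · field_simp

lemma holderConjugate_two_div {θ : ℝ} (h0 : 0 ≤ θ) (h1 : θ < 1) :
    (2 / (1 - θ)).HolderConjugate (2 / (1 + θ)) := by
  have hθ : 0 < 1 - θ := by linarith
  refine Real.holderConjugate_iff.2 ⟨?_, ?_⟩
  · rw [lt_div_iff₀ hθ]; linarith
  · field_simp; ring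

lemma eLpNorm'_dualOp_le {θ : ℝ} (h0 : 0 ≤ θ) (h1 : θ < 1) {C : ℝ≥0∞} (hC : HLSBound θ C)
    {ε : ℝ} (hε : 0 < ε) (s : ℝ) {I₀ : Set ℝ} (hI₀ : MeasurableSet I₀) {T : ℝ} (hT0 : 0 ≤ T)
    (hT : I₀ ⊆ Set.Ioc 0 T) {F : ℝ → Plane → ℂ} (hF : IsNiceFamily F) :
    eLpNorm' (dualOp (volume.restrict I₀) ε s F) (2 / (1 - θ)) volume ≤
      ∫⁻ t in I₀, eLpNorm' (F t) (2 / (1 + θ)) volume * ENNReal.ofReal |t - s| ^ (-θ) := by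
  have hfinI : volume I₀ < ⊤ := (measure_mono hT).trans_lt measure_Ioc_lt_top
  have : IsFiniteMeasure (volume.restrict I₀) :=
    ⟨by rw [Measure.restrict_apply_univ]; exact hfinI⟩
  have hr := holderConjugate_two_div h0 h1
  have hWm := (lintegral_enorm_dualOp_le h0 h1 hC hε s hI₀ hT0 hT hF).1
  have hNm := measurable_eLpNorm'_slice hF.measurable (2 / (1 + θ))
  have := lintegral_rpow_le_of_pairing hr hWm (b := ∫⁻ t in I₀,
    eLpNorm' (F t) (2 / (1 + θ)) volume * ENNReal.ofReal |t - s| ^ (-θ)) fun g hg => by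
      simp_rw [mul_comm (dualOp _ _ _ _ _)]
      rw [← integral_heatOp_mul_eq hε s _ hg hF, ← lintegral_mul_const _ (by fun_prop)]
      refine (enorm_integral_le_lintegral_enorm _).trans (lintegral_mono fun t => ?_)
      rw [← heatForm_eq (by simpa using hε.le) hg.integrable (hF.isBddIntegrable t).integrable]
      refine (enorm_heatForm_le (by simpa using hε) h0 h1.le hg (hF.isBddIntegrable t)).trans
        (le_of_eq ?_)
      rw [im_add_mul_I]
      ring
  rw [eLpNorm']
  refine (ENNReal.rpow_le_rpow this (one_div_nonneg.2 hr.nonneg)).trans (le_of_eq ?_)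
  rw [← ENNReal.rpow_mul, mul_one_div_cancel hr.ne_zero, ENNReal.rpow_one]

lemma le_one_add_rpow (a : ℝ≥0∞) {p : ℝ} (hp : 1 ≤ p) : a ≤ 1 + a ^ p := by
  rcases le_total a 1 with h | h
  · exact h.trans le_self_add
  · refine le_trans ?_ le_add_self
    nth_rewrite 1 [← ENNReal.rpow_one a]
    exact ENNReal.rpow_le_rpow_of_exponent_le h hp

/-- Interpolation of the time integral in the retarded estimate. -/
lemma lintegral_mul_rpow_hls_le {θ η : ℝ} (h0 : 0 ≤ θ) (h1 : θ < 1) (hη0 : 0 ≤ η) (hη1 : η ≤ 1)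
    {C : ℝ≥0∞} (hC : HLSBound θ C) {g N : ℝ → ℝ≥0∞} (hg : Measurable g) (hN : Measurable N)
    (A : ℝ≥0∞) :
    ∫⁻ s, g s * (A ^ (1 - η) * (∫⁻ t, N t * ENNReal.ofReal |t - s| ^ (-θ)) ^ η) ≤
      A ^ (1 - η) * (C * (∫⁻ t, N t ^ (2 / (2 - θ))) ^ ((2 - θ) / 2)) ^ η *
        (∫⁻ s, g s ^ (2 / (2 - η * θ))) ^ ((2 - η * θ) / 2) := by
  have hθ2 : 0 < 2 - θ := by linarith
  have hηθ : 0 < 2 - η * θ := by nlinarith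
  set b : ℝ → ℝ≥0∞ := fun s => ∫⁻ t, N t * ENNReal.ofReal |t - s| ^ (-θ) with hb
  have hbm : Measurable b := by
    refine Measurable.lintegral_prod_right' (f := fun z : ℝ × ℝ =>
      N z.2 * ENNReal.ofReal |z.2 - z.1| ^ (-θ)) ?_
    fun_prop
  set α : ℝ := (2 - θ) / (2 - η * θ) with hα
  have hα0 : 0 ≤ α := by positivity
  have hexp : α * η + 2 / (2 - η * θ) * (1 - η) = 1 := by
    rw [hα, div_mul_eq_mul_div, div_mul_eq_mul_div, ← add_div, div_eq_one_iff_eq hηθ.ne']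
    ring
  have e : ∀ s, g s * (A ^ (1 - η) * b s ^ η) =
      A ^ (1 - η) * ((g s ^ α * b s) ^ η * (g s ^ (2 / (2 - η * θ))) ^ (1 - η)) := by
    intro s
    rw [ENNReal.mul_rpow_of_nonneg _ _ hη0, ← ENNReal.rpow_mul, ← ENNReal.rpow_mul]
    have : g s = g s ^ (α * η) * g s ^ (2 / (2 - η * θ) * (1 - η)) := by
      rw [← ENNReal.rpow_add_of_nonneg _ _ (by positivity)
        (mul_nonneg (by positivity) (by linarith)), hexp, ENNReal.rpow_one]
    nth_rewrite 1 [this]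
    ring
  rw [lintegral_congr e, lintegral_const_mul _ (by fun_prop), mul_assoc]
  gcongr
  refine (ENNReal.lintegral_mul_norm_pow_le (by fun_prop) (by fun_prop) hη0 (by linarith)
    (by ring)).trans ?_
  have hls := hC (fun s => g s ^ α) N (by fun_prop) hN
  have e2 : ∀ s, ∫⁻ t, g s ^ α * N t * ENNReal.ofReal |t - s| ^ (-θ) = g s ^ α * b s := by
    intro s
    simp only [hb]
    rw [← lintegral_const_mul _ (by fun_prop)]
    simp_rw [mul_assoc]
  have e3 : ∀ s, (g s ^ α) ^ (2 / (2 - θ)) = g s ^ (2 / (2 - η * θ)) := by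
    intro s
    rw [← ENNReal.rpow_mul]
    congr 1
    rw [hα]; field_simp
  rw [lintegral_congr e2, lintegral_congr e3] at hls
  refine (mul_le_mul_left (ENNReal.rpow_le_rpow hls hη0) _).trans (le_of_eq ?_)
  set Y := ∫⁻ s, g s ^ (2 / (2 - η * θ))
  rw [mul_left_comm C, ENNReal.mul_rpow_of_nonneg (Y ^ _) _ hη0, mul_comm, ← mul_assoc, mul_comm,
    ← ENNReal.rpow_mul, ← ENNReal.rpow_add_of_nonneg _ _ (by linarith) (by positivity)]
  congr 2
  ring

lemma enorm_heatOp_le_lintegral (z : ℂ) (f : Plane → ℂ) (y : Plane) :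
    ‖heatOp z f y‖ₑ ≤ ∫⁻ x, ‖heatKer z (y - x) * f x‖ₑ :=
  enorm_integral_le_lintegral_enorm _

lemma norm_add_mul_I_le {ε τ T : ℝ} (hε : 0 < ε) (hτ : |τ| ≤ T) :
    ‖(ε : ℂ) + (τ : ℂ) * I‖ ≤ ε + T := by
  refine (norm_add_le _ _).trans ?_
  simp only [norm_real, norm_mul, norm_I, mul_one, Real.norm_eq_abs, abs_of_pos hε]
  linarith

lemma lintegral_ne_top_of_rpow {g : ℝ → ℝ≥0∞} {p : ℝ} (hp : 1 ≤ p) {m : Measure ℝ}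
    [IsFiniteMeasure m] (h : ∫⁻ s, g s ^ p ∂m ≠ ⊤) : ∫⁻ s, g s ∂m ≠ ⊤ := by
  refine ((lintegral_mono fun s => le_one_add_rpow (g s) hp).trans_lt ?_).ne
  rw [lintegral_add_left measurable_const]
  simp only [lintegral_const, one_mul]
  exact ENNReal.add_lt_top.2 ⟨measure_lt_top _ _, h.lt_top⟩

/-- Dual form of the regularized retarded Strichartz estimate. -/
lemma enorm_integral_retarded_le {θ η : ℝ} (h0 : 0 ≤ θ) (h1 : θ < 1) (hη0 : 0 ≤ η) (hη1 : η ≤ 1)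
    {C : ℝ≥0∞} (hC : HLSBound θ C) {ε : ℝ} (hε : 0 < ε) {T : ℝ} (hT0 : 0 ≤ T)
    {G : ℝ → Plane → ℂ} (hGm : Measurable (Function.uncurry G)) (hG : ∀ s, IsBddIntegrable (G s))
    (hfin : ∫⁻ s in Set.Ioc 0 T,
      eLpNorm' (G s) (2 / (1 + η * θ)) volume ^ (2 / (2 - η * θ)) ≠ ⊤)
    {F : ℝ → Plane → ℂ} (hF : IsNiceFamily F) :
    ‖∫ t in Set.Ioc 0 T, ∫ y, (∫ s in Set.Ioc 0 t, heatOp (ε + (t - s : ℝ) * I) (G s) y) * F t y‖ₑ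
      ≤ (C ^ (1 / 2 : ℝ) * (∫⁻ t in Set.Ioc 0 T,
          eLpNorm' (F t) (2 / (1 + θ)) volume ^ (2 / (2 - θ))) ^ ((2 - θ) / 2)) ^ (1 - η) *
        (C * (∫⁻ t in Set.Ioc 0 T,
          eLpNorm' (F t) (2 / (1 + θ)) volume ^ (2 / (2 - θ))) ^ ((2 - θ) / 2)) ^ η *
        (∫⁻ s in Set.Ioc 0 T, eLpNorm' (G s) (2 / (1 + η * θ)) volume ^ (2 / (2 - η * θ))) ^
          ((2 - η * θ) / 2) := by
  have hηθ0 : 0 ≤ η * θ := by positivity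
  have hηθ1 : η * θ < 1 := by nlinarith
  have hθ2 : 0 < 2 - θ := by linarith
  have hηθ2 : 0 < 2 - η * θ := by linarith
  set m : Measure ℝ := volume.restrict (Set.Ioc 0 T) with hm
  have hconj := holderConjugate_two_div hηθ0 hηθ1
  set g : ℝ → ℝ≥0∞ := fun s => eLpNorm' (G s) (2 / (1 + η * θ)) volume with hg
  set N : ℝ → ℝ≥0∞ := fun t => eLpNorm' (F t) (2 / (1 + θ)) volume with hN
  have hgm : Measurable g := measurable_eLpNorm'_slice hGm _
  have hNm : Measurable N := measurable_eLpNorm'_slice hF.measurable _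
  have hg1 : ∫⁻ s, g s ∂m ≠ ⊤ := by
    refine lintegral_ne_top_of_rpow (p := 2 / (2 - η * θ)) ?_ hfin
    rw [le_div_iff₀ hηθ2]; linarith
  have hFi := hF.integrable m
  obtain ⟨c, hc, hcb⟩ := exists_enorm_heatOp_le hε (ε + T) hconj
  set K : ℝ × (ℝ × Plane) → ℂ := fun p => {p : ℝ × (ℝ × Plane) | p.1 ≤ p.2.1}.indicator
    (fun p => heatOp (ε + (p.2.1 - p.1 : ℝ) * I) (G p.1) p.2.2 * F p.2.1 p.2.2) p with hK
  have hKm : Measurable K := by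
    refine Measurable.indicator (Measurable.mul ?_ ?_) (measurableSet_le (by fun_prop) (by fun_prop))
    · refine measurable_heatOp_param (α := ℝ × ℝ × Plane)
        (z := fun p => (ε : ℂ) + (p.2.1 - p.1 : ℝ) * I) (f := fun p => G p.1)
        (y := fun p => p.2.2) (by fun_prop) ?_ (by fun_prop)
      exact hGm.comp (f := fun p : (ℝ × ℝ × Plane) × Plane => (p.1.1, p.2)) (by fun_prop)
    · exact hF.measurable.comp (f := fun p : ℝ × ℝ × Plane => (p.2.1, p.2.2)) (by fun_prop)
  have hKb : ∀ s ∈ Set.Ioc 0 T, ∀ᵐ a ∂(m.prod (volume : Measure Plane)),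
      ‖K (s, a)‖ₑ ≤ c * g s * ‖Function.uncurry F a‖ₑ := by
    intro s hs
    have hae : ∀ᵐ a ∂(m.prod (volume : Measure Plane)), a.1 ∈ Set.Ioc 0 T :=
      Measure.quasiMeasurePreserving_fst.ae (ae_restrict_mem measurableSet_Ioc)
    filter_upwards [hae] with a ha
    refine (enorm_indicator_le_enorm_self _ _).trans ?_
    rw [enorm_mul]
    refine mul_le_mul_left ((enorm_heatOp_le_lintegral _ _ _).trans ?_) _
    refine hcb _ (re_add_mul_I _ _) (norm_add_mul_I_le hε ?_) _ (hG s).measurable _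
    rw [abs_le]; constructor <;> linarith [hs.1, hs.2, ha.1, ha.2]
  have hKi : Integrable K (m.prod (m.prod volume)) := by
    refine ⟨hKm.aestronglyMeasurable, ?_⟩
    rw [hasFiniteIntegral_iff_enorm, lintegral_prod _ hKm.enorm.aemeasurable]
    refine lt_of_le_of_lt (b := ∫⁻ s, c * g s * (∫⁻ a, ‖Function.uncurry F a‖ₑ ∂(m.prod volume)) ∂m)
      ?_ ?_
    · refine lintegral_mono_ae ?_
      filter_upwards [ae_restrict_mem measurableSet_Ioc] with s hs
      rw [← lintegral_const_mul _ hF.measurable.enorm]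
      exact lintegral_mono_ae (hKb s hs)
    · rw [lintegral_mul_const _ (by fun_prop), lintegral_const_mul _ hgm]
      exact ENNReal.mul_lt_top (ENNReal.mul_lt_top hc.lt_top hg1.lt_top)
        (hasFiniteIntegral_iff_enorm.1 hFi.2)
  have hswap : ∫ t in Set.Ioc 0 T, ∫ y,
      (∫ s in Set.Ioc 0 t, heatOp (ε + (t - s : ℝ) * I) (G s) y) * F t y =
      ∫ s, (∫ a, K (s, a) ∂(m.prod volume)) ∂m := by
    rw [integral_integral_swap (f := fun s a => K (s, a)) hKi, integral_prod]
    · refine setIntegral_congr_fun measurableSet_Ioc fun t ht => ?_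
      refine integral_congr_ae (Filter.Eventually.of_forall fun y => ?_)
      simp only []
      rw [← integral_mul_const, hm, ← integral_indicator measurableSet_Ioc,
        ← integral_indicator measurableSet_Ioc]
      refine integral_congr_ae (Filter.Eventually.of_forall fun s => ?_)
      simp only [hK, Set.indicator_apply, Set.mem_Ioc, Set.mem_ofPred_eq]
      by_cases hs : 0 < s
      · by_cases hst : s ≤ t
        · simp [hs, hst, hst.trans ht.2]
        · simp [hst]
      · simp [hs]
    · exact hKi.integral_prod_right
  rw [hswap]
  set X := ∫⁻ t in Set.Ioc 0 T, N t ^ (2 / (2 - θ)) with hX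
  set A := C ^ (1 / 2 : ℝ) * X ^ ((2 - θ) / 2) with hA
  have hin : ∀ s ∈ Set.Ioc 0 T, ‖∫ a, K (s, a) ∂(m.prod volume)‖ₑ ≤
      g s * (A ^ (1 - η) * (∫⁻ t in Set.Ioc 0 T, N t * ENNReal.ofReal |t - s| ^ (-θ)) ^ η) := by
    intro s hs
    have hsub : Set.Icc s T ⊆ Set.Ioc 0 T := fun t ht => ⟨hs.1.trans_le ht.1, ht.2⟩
    have : IsFiniteMeasure (volume.restrict (Set.Icc s T)) := inferInstance
    have hKs : Integrable (fun a => K (s, a)) (m.prod volume) := by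
      refine ⟨(hKm.comp (by fun_prop)).aestronglyMeasurable, ?_⟩
      rw [hasFiniteIntegral_iff_enorm]
      refine (lintegral_mono_ae (hKb s hs)).trans_lt ?_
      rw [lintegral_const_mul _ hF.measurable.enorm]
      refine ENNReal.mul_lt_top (ENNReal.mul_lt_top hc.lt_top ?_)
        (hasFiniteIntegral_iff_enorm.1 hFi.2)
      refine ((hG s).eLpNorm'_ne_top ?_).lt_top
      rw [le_div_iff₀ (by linarith)]; linarith
    have e1 : ∫ a, K (s, a) ∂(m.prod volume) =
        ∫ x, G s x * dualOp (volume.restrict (Set.Icc s T)) ε s F x := by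
      rw [← integral_heatOp_mul_eq hε s _ (hG s) hF, integral_prod _ hKs, hm,
        ← integral_indicator measurableSet_Ioc, ← integral_indicator measurableSet_Icc]
      refine integral_congr_ae (Filter.Eventually.of_forall fun t => ?_)
      simp only [hK, Set.indicator_apply, Set.mem_Ioc, Set.mem_Icc, Set.mem_ofPred_eq]
      by_cases hst : s ≤ t
      · simp [hst, hs.1.trans_le hst]
      · simp [hst]
    rw [e1]
    have hd := lintegral_enorm_dualOp_le h0 h1 hC hε s measurableSet_Icc hT0 hsub hF
    refine (enorm_integral_mul_le_eLpNorm' hconj.symm (hG s).measurable hd.1).trans ?_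
    refine mul_le_mul_right ((eLpNorm'_interp hd.1 h0 h1 hη0 hη1).trans ?_) _
    have : 0 ≤ 1 - η := by linarith
    gcongr
    · refine (eLpNorm'_dualOp_two_le h0 h1 hC hε s measurableSet_Icc hT0 hsub hF).trans ?_
      rw [hA]
      gcongr
      exact lintegral_mono_set hsub
    · refine (eLpNorm'_dualOp_le h0 h1 hC hε s measurableSet_Icc hT0 hsub hF).trans ?_
      gcongr
  refine (enorm_integral_le_lintegral_enorm _).trans
    ((setLIntegral_mono' measurableSet_Ioc hin).trans ?_)
  have hfinal := lintegral_mul_rpow_hls_le h0 h1 hη0 hη1 hC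
    (hgm.indicator (measurableSet_Ioc (a := 0) (b := T)))
    (hNm.indicator (measurableSet_Ioc (a := 0) (b := T))) A
  have hpow : ∀ (f : ℝ → ℝ≥0∞) (p : ℝ), 0 < p → ∫⁻ s, (Set.Ioc 0 T).indicator f s ^ p =
      ∫⁻ s in Set.Ioc 0 T, f s ^ p := by
    intro f p hp
    rw [← lintegral_indicator measurableSet_Ioc]
    refine lintegral_congr fun s => ?_
    simp only [Set.indicator_apply]
    split_ifs <;> simp [hp]
  rw [hpow _ _ (by positivity), hpow _ _ (by positivity)] at hfinal
  refine le_trans (le_of_eq ?_) hfinal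
  rw [← lintegral_indicator measurableSet_Ioc]
  refine lintegral_congr fun s => ?_
  have : ∫⁻ t, (Set.Ioc 0 T).indicator N t * ENNReal.ofReal |t - s| ^ (-θ) =
      ∫⁻ t in Set.Ioc 0 T, N t * ENNReal.ofReal |t - s| ^ (-θ) := by
    rw [← lintegral_indicator measurableSet_Ioc]
    refine lintegral_congr fun t => ?_
    simp only [Set.indicator_apply]
    split_ifs <;> simp
  rw [this]
  simp only [Set.indicator_apply]
  split_ifs <;> simp

lemma hasDerivAt_time {u : ℝ → Plane → ℂ} (hu : ContDiff ℝ ∞ (Function.uncurry u)) (s : ℝ)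
    (x : Plane) :
    HasDerivAt (fun s => u s x) (fderiv ℝ (Function.uncurry u) (s, x) (1, 0)) s := by
  have h := (hu.differentiable (by simp) (s, x)).hasFDerivAt
  exact h.comp_hasDerivAt s ((hasDerivAt_id s).prodMk (hasDerivAt_const s x))

lemma continuous_deriv_time {u : ℝ → Plane → ℂ} (hu : ContDiff ℝ ∞ (Function.uncurry u)) :
    Continuous fun p : ℝ × Plane => deriv (fun s => u s p.2) p.1 := by
  simp_rw [fun p : ℝ × Plane => (hasDerivAt_time hu p.1 p.2).deriv]
  exact (hu.continuous_fderiv (by simp)).clm_apply continuous_const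

lemma contDiff_slice {u : ℝ → Plane → ℂ} (hu : ContDiff ℝ ∞ (Function.uncurry u)) (s : ℝ) :
    ContDiff ℝ ∞ (u s) :=
  hu.comp (contDiff_const.prodMk contDiff_id)

lemma contDiff_pd {f : Plane → ℂ} (hf : ContDiff ℝ ∞ f) (j : Fin 2) : ContDiff ℝ ∞ (pd j f) :=
  (hf.fderiv_right (by simp)).clm_apply contDiff_const

lemma continuous_lap {f : Plane → ℂ} (hf : ContDiff ℝ ∞ f) : Continuous (lap f) :=
  continuous_finsetSum _ fun j _ => (contDiff_pd (contDiff_pd hf j) j).continuous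

lemma hasCompactSupport_pd {f : Plane → ℂ} (hf : HasCompactSupport f) (j : Fin 2) :
    HasCompactSupport (pd j f) :=
  (hf.fderiv ℝ).comp_left (g := fun L : Plane →L[ℝ] ℂ => L (EuclideanSpace.single j 1)) rfl

lemma integral_pd_mul {f g : Plane → ℂ} (hf : ContDiff ℝ ∞ f) (hg : ContDiff ℝ ∞ g)
    (hgs : HasCompactSupport g) (j : Fin 2) :
    ∫ x, pd j f x * g x = -∫ x, f x * pd j g x := by
  have := integral_mul_fderiv_eq_neg_fderiv_mul_of_integrable (μ := (volume : Measure Plane))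
    (𝕜 := ℂ) (v := EuclideanSpace.single j 1) (f := f) (g := g)
    (((contDiff_pd hf j).continuous.mul hg.continuous).integrable_of_hasCompactSupport
      hgs.mul_left)
    ((hf.continuous.mul (contDiff_pd hg j).continuous).integrable_of_hasCompactSupport
      (hasCompactSupport_pd hgs j).mul_left)
    ((hf.continuous.mul hg.continuous).integrable_of_hasCompactSupport hgs.mul_left)
    (fun x _ => hf.differentiable (by simp) x) (fun x _ => hg.differentiable (by simp) x)
  simp only [pd]
  rw [this, neg_neg]

lemma integral_lap_mul {f g : Plane → ℂ} (hf : ContDiff ℝ ∞ f) (hg : ContDiff ℝ ∞ g)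
    (hgs : HasCompactSupport g) : ∫ x, lap f x * g x = ∫ x, f x * lap g x := by
  simp only [lap, Finset.sum_mul, Finset.mul_sum]
  rw [integral_finsetSum, integral_finsetSum]
  · refine Finset.sum_congr rfl fun j _ => ?_
    rw [integral_pd_mul (contDiff_pd hf j) hg hgs, integral_pd_mul hf (contDiff_pd hg j)
      (hasCompactSupport_pd hgs j), neg_neg]
  · intro j _
    exact (hf.continuous.mul (contDiff_pd (contDiff_pd hg j) j).continuous).integrable_of_hasCompactSupport
      (hasCompactSupport_pd (hasCompactSupport_pd hgs j) j).mul_left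
  · intro j _
    exact ((contDiff_pd (contDiff_pd hf j) j).continuous.mul hg.continuous).integrable_of_hasCompactSupport
      hgs.mul_left

lemma integrable_prod_of_continuous {g : ℝ × Plane → ℂ} (hg : Continuous g) {R : ℝ}
    (hR : ∀ s x, R < ‖x‖ → g (s, x) = 0) (a b : ℝ) :
    Integrable g ((volume.restrict (Set.Ioc a b)).prod volume) := by
  have h1 : IntegrableOn g (Set.Icc a b ×ˢ Metric.closedBall 0 R) (volume.prod volume) :=
    hg.continuousOn.integrableOn_compact (isCompact_Icc.prod (isCompact_closedBall _ _))
  have h2 : IntegrableOn g (Set.Ioc a b ×ˢ Set.univ) (volume.prod volume) := by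
    refine IntegrableOn.of_forall_sdiff_eq_zero (s := Set.Ioc a b ×ˢ Metric.closedBall 0 R)
      (h1.mono_set (Set.prod_mono Set.Ioc_subset_Icc_self subset_rfl))
      (measurableSet_Ioc.prod MeasurableSet.univ) ?_
    rintro ⟨s, x⟩ ⟨⟨hs, -⟩, hx⟩
    refine hR s x ?_
    by_contra h
    exact hx ⟨hs, by simpa using h⟩
  rw [IntegrableOn, ← Measure.prod_restrict, Measure.restrict_univ] at h2
  exact h2

/-- Smooth solutions of the inhomogeneous linear Schrödinger equation with Schwartz slices. -/
structure IsSchrodingerSol (T : ℝ) (u G : ℝ → Plane → ℂ) : Prop where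
  contDiff : ContDiff ℝ ∞ (Function.uncurry u)
  contDiff_source : ContDiff ℝ ∞ (Function.uncurry G)
  isSchwartz : ∀ t ∈ Set.Icc (0 : ℝ) T, IsSchwartz (u t)
  isSchwartz_source : ∀ t ∈ Set.Icc (0 : ℝ) T, IsSchwartz (G t)
  eq : ∀ t ∈ Set.Icc (0 : ℝ) T, ∀ x, I * deriv (fun s => u s x) t + lap (u t) x = G t x

/-- Weak formulation of the equation. -/
lemma IsSchrodingerSol.weak {T : ℝ} {u G : ℝ → Plane → ℂ} (h : IsSchrodingerSol T u G)
    {Φ : ℝ → Plane → ℂ} (hΦ : ContDiff ℝ ∞ (Function.uncurry Φ)) {R : ℝ}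
    (hR : ∀ s x, R < ‖x‖ → Φ s x = 0) {t : ℝ} (ht : t ∈ Set.Icc 0 T) :
    (∫ x, u t x * Φ t x) - ∫ x, u 0 x * Φ 0 x = ∫ s in Set.Ioc 0 t,
      ∫ x, (-I * (G s x * Φ s x) + u s x * (I * lap (Φ s) x + deriv (fun s => Φ s x) s)) := by
  have hcs : ∀ s, HasCompactSupport (Φ s) := fun s => by
    refine HasCompactSupport.intro (isCompact_closedBall (0 : Plane) R) fun x hx => hR s x ?_
    simpa using hx
  have hΦ' : ∀ s x, R < ‖x‖ → deriv (fun s => Φ s x) s = 0 := by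
    intro s x hx
    have : (fun s => Φ s x) = fun _ => 0 := funext fun s => hR s x hx
    rw [this, deriv_const]
  have hcont := h.contDiff.continuous
  have hΦc := hΦ.continuous
  have hu' := continuous_deriv_time h.contDiff
  have hΦ'c := continuous_deriv_time hΦ
  have hg : Continuous fun p : ℝ × Plane => deriv (fun s => u s p.2) p.1 * Φ p.1 p.2 +
      u p.1 p.2 * deriv (fun s => Φ s p.2) p.1 :=
    (hu'.mul hΦc).add (hcont.mul hΦ'c)
  have hgi := integrable_prod_of_continuous hg (R := R)
    (fun s x hx => by simp [hR s x hx, hΦ' s x hx]) 0 t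
  have hslice : ∀ s, Integrable fun x => u s x * Φ s x := fun s =>
    ((contDiff_slice h.contDiff s).continuous.mul
      (contDiff_slice hΦ s).continuous).integrable_of_hasCompactSupport (hcs s).mul_left
  have hftc : ∀ x, ∫ s in Set.Ioc 0 t, (deriv (fun s => u s x) s * Φ s x +
      u s x * deriv (fun s => Φ s x) s) = u t x * Φ t x - u 0 x * Φ 0 x := by
    intro x
    rw [← intervalIntegral.integral_of_le ht.1]
    refine intervalIntegral.integral_eq_sub_of_hasDerivAt (f := fun s => u s x * Φ s x)
      (fun s _ => ?_) ?_
    · rw [(hasDerivAt_time h.contDiff s x).deriv, (hasDerivAt_time hΦ s x).deriv]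
      exact (hasDerivAt_time h.contDiff s x).mul (hasDerivAt_time hΦ s x)
    · exact (hg.comp (f := fun s => (s, x)) (by fun_prop)).intervalIntegrable _ _
  rw [← integral_sub (hslice t) (hslice 0)]
  simp_rw [← hftc]
  rw [← integral_integral_swap hgi]
  refine setIntegral_congr_fun measurableSet_Ioc fun s hs => ?_
  have hsT : s ∈ Set.Icc 0 T := ⟨hs.1.le, hs.2.trans ht.2⟩
  have cu := contDiff_slice h.contDiff s
  have cG := contDiff_slice h.contDiff_source s
  have cΦ := contDiff_slice hΦ s
  have i1 : Integrable fun x => lap (u s) x * Φ s x :=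
    ((continuous_lap cu).mul cΦ.continuous).integrable_of_hasCompactSupport (hcs s).mul_left
  have i2 : Integrable fun x => G s x * Φ s x :=
    (cG.continuous.mul cΦ.continuous).integrable_of_hasCompactSupport (hcs s).mul_left
  have hls : HasCompactSupport (lap (Φ s)) := by
    refine HasCompactSupport.intro (isCompact_closedBall (0 : Plane) R) fun x hx => ?_
    refine Finset.sum_eq_zero fun j _ => ?_
    have h2 : tsupport (pd j (pd j (Φ s))) ⊆ tsupport (Φ s) := by
      have e : ∀ f : Plane → ℂ, tsupport (pd j f) ⊆ tsupport f := fun f =>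
        tsupport_fderiv_apply_subset ℝ _
      exact (e _).trans (e _)
    have h3 : tsupport (Φ s) ⊆ Metric.closedBall 0 R :=
      closure_minimal (fun x hx => by
        by_contra hh
        exact hx (hR s x (by simpa using hh))) Metric.isClosed_closedBall
    exact image_eq_zero_of_notMem_tsupport fun hh => hx (h3 (h2 hh))
  have i3 : Integrable fun x => u s x * lap (Φ s) x :=
    (cu.continuous.mul (continuous_lap cΦ)).integrable_of_hasCompactSupport hls.mul_left
  have i4 : Integrable fun x => u s x * deriv (fun s => Φ s x) s := by
    refine (cu.continuous.mul (hΦ'c.comp (f := fun x => (s, x)) (by fun_prop))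
      ).integrable_of_hasCompactSupport (HasCompactSupport.mul_left ?_)
    refine HasCompactSupport.intro (isCompact_closedBall (0 : Plane) R) fun x hx => hΦ' s x ?_
    simpa using hx
  have e : ∀ x, deriv (fun s => u s x) s = -I * G s x + I * lap (u s) x := by
    intro x
    rw [← h.eq s hsT x, mul_add, ← mul_assoc, neg_mul, I_mul_I]
    ring
  calc ∫ x, (deriv (fun s => u s x) s * Φ s x + u s x * deriv (fun s => Φ s x) s)
      = ∫ x, (-I * (G s x * Φ s x) + I * (lap (u s) x * Φ s x) +
          u s x * deriv (fun s => Φ s x) s) := by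
        refine integral_congr_ae (Filter.Eventually.of_forall fun x => ?_)
        simp only [e]
        ring
    _ = -I * (∫ x, G s x * Φ s x) + I * (∫ x, u s x * lap (Φ s) x) +
          ∫ x, u s x * deriv (fun s => Φ s x) s := by
        rw [integral_add (f := fun x => -I * (G s x * Φ s x) + I * (lap (u s) x * Φ s x))
          ((i2.const_mul _).add (i1.const_mul _)) i4,
          integral_add (i2.const_mul _) (i1.const_mul _),
          integral_const_mul, integral_const_mul,
          integral_lap_mul cu cΦ (hcs s)]
    _ = ∫ x, (-I * (G s x * Φ s x) + I * (u s x * lap (Φ s) x) +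
          u s x * deriv (fun s => Φ s x) s) := by
        rw [integral_add (f := fun x => -I * (G s x * Φ s x) + I * (u s x * lap (Φ s) x))
          ((i2.const_mul _).add (i3.const_mul _)) i4,
          integral_add (i2.const_mul _) (i3.const_mul _),
          integral_const_mul, integral_const_mul]
    _ = _ := by
        refine integral_congr_ae (Filter.Eventually.of_forall fun x => ?_)
        simp only []
        ring

lemma pd_mul {f g : Plane → ℂ} {x : Plane} (hf : DifferentiableAt ℝ f x)
    (hg : DifferentiableAt ℝ g x) (j : Fin 2) :
    pd j (fun x => f x * g x) x = pd j f x * g x + f x * pd j g x := by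
  simp only [pd]
  rw [fderiv_fun_mul hf hg]
  simp only [add_apply, smul_apply, smul_eq_mul]
  ring

lemma lap_mul {f g : Plane → ℂ} (hf : ContDiff ℝ ∞ f) (hg : ContDiff ℝ ∞ g) (x : Plane) :
    lap (fun x => f x * g x) x =
      lap f x * g x + 2 * (∑ j, pd j f x * pd j g x) + f x * lap g x := by
  have hd : ∀ {f : Plane → ℂ}, ContDiff ℝ ∞ f → ∀ x, DifferentiableAt ℝ f x := fun h x =>
    h.differentiable (by simp) x
  have e : ∀ j, pd j (pd j fun x => f x * g x) x =
      pd j (pd j f) x * g x + 2 * (pd j f x * pd j g x) + f x * pd j (pd j g) x := by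
    intro j
    have : (pd j fun x => f x * g x) = fun x => pd j f x * g x + f x * pd j g x :=
      funext fun x => pd_mul (hd hf x) (hd hg x) j
    rw [this]
    have h1 : ContDiff ℝ ∞ fun x => pd j f x * g x := (contDiff_pd hf j).mul hg
    have h2 : ContDiff ℝ ∞ fun x => f x * pd j g x := hf.mul (contDiff_pd hg j)
    have h3 : pd j (fun x => pd j f x * g x + f x * pd j g x) x =
        pd j (fun x => pd j f x * g x) x + pd j (fun x => f x * pd j g x) x := by
      rw [pd, fderiv_fun_add (hd h1 x) (hd h2 x)]
      rfl
    rw [h3, pd_mul (hd (contDiff_pd hf j) x) (hd hg x), pd_mul (hd hf x) (hd (contDiff_pd hg j) x)]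
    ring
  simp only [lap, e, Finset.sum_add_distrib, Finset.sum_mul, Finset.mul_sum]

lemma hasFDerivAt_norm_sq_sub (y x : Plane) :
    HasFDerivAt (fun x : Plane => ((‖y - x‖ ^ 2 : ℝ) : ℂ))
      (ofRealCLM.comp (-(2 • innerSL ℝ (y - x)))) x := by
  have h1 : HasFDerivAt (fun x : Plane => y - x) (-ContinuousLinearMap.id ℝ Plane) x :=
    (hasFDerivAt_id x).const_sub y
  have h2 := h1.norm_sq
  refine (ofRealCLM.hasFDerivAt.comp x h2).congr_fderiv ?_
  ext v
  simp
  ring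

lemma heatKer_eq (z : ℂ) (x : Plane) :
    heatKer z x = (4 * π * z)⁻¹ * cexp (-(4 * z)⁻¹ * ((‖x‖ ^ 2 : ℝ) : ℂ)) := by
  rw [heatKer]; push_cast; rfl

lemma contDiff_heatKer_sub (z : ℂ) (y : Plane) : ContDiff ℝ ∞ fun x => heatKer z (y - x) := by
  simp_rw [heatKer_eq]
  refine contDiff_const.mul (ContDiff.cexp (contDiff_const.mul ?_))
  exact ofRealCLM.contDiff.comp ((contDiff_const.sub contDiff_id).norm_sq ℝ)

lemma contDiff_heatKer_time {ε : ℝ} (hε : 0 < ε) (t : ℝ) (y : Plane) :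
    ContDiff ℝ ∞ fun p : ℝ × Plane => heatKer (ε + (t - p.1 : ℝ) * I) (y - p.2) := by
  simp_rw [heatKer_eq]
  have hz : ∀ p : ℝ × Plane, (ε : ℂ) + (t - p.1 : ℝ) * I ≠ 0 := fun p h => by
    have := congrArg Complex.re h
    simp at this
    exact hε.ne' this
  have hzc : ContDiff ℝ ∞ fun p : ℝ × Plane => (ε : ℂ) + (t - p.1 : ℝ) * I :=
    contDiff_const.add ((ofRealCLM.contDiff.comp (contDiff_const.sub contDiff_fst)).mul
      contDiff_const)
  refine ContDiff.mul ?_ (ContDiff.cexp (ContDiff.mul ?_ ?_))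
  · refine (contDiff_const.mul hzc).inv fun p => mul_ne_zero ?_ (hz p)
    simp [Real.pi_ne_zero]
  · exact ((contDiff_const.mul hzc).inv fun p => mul_ne_zero (by norm_num) (hz p)).neg
  · exact ofRealCLM.contDiff.comp ((contDiff_const.sub contDiff_snd).norm_sq ℝ)

lemma pd_heatKer {z : ℂ} (y x : Plane) (j : Fin 2) :
    pd j (fun x => heatKer z (y - x)) x = (2 * z)⁻¹ * ((y - x) j : ℂ) * heatKer z (y - x) := by
  simp_rw [pd, heatKer_eq]
  have h := (((hasFDerivAt_norm_sq_sub y x).const_mul (-(4 * z)⁻¹)).cexp.const_mul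
    (4 * π * z)⁻¹).fderiv
  rw [h]
  simp [EuclideanSpace.inner_single_right]
  ring

lemma lap_heatKer {z : ℂ} (y x : Plane) :
    lap (fun x => heatKer z (y - x)) x =
      (((2 * z)⁻¹) ^ 2 * (‖y - x‖ ^ 2 : ℝ) - z⁻¹) * heatKer z (y - x) := by
  have hd : ∀ {f : Plane → ℂ}, ContDiff ℝ ∞ f → ∀ x, DifferentiableAt ℝ f x := fun h x =>
    h.differentiable (by simp) x
  have e : ∀ j, pd j (pd j fun x => heatKer z (y - x)) x =
      (((2 * z)⁻¹) ^ 2 * (((y - x) j : ℂ)) ^ 2 - (2 * z)⁻¹) * heatKer z (y - x) := by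
    intro j
    rw [funext fun x => pd_heatKer (z := z) y x j]
    have hl : HasFDerivAt (fun x : Plane => (2 * z)⁻¹ * ((y - x) j : ℂ))
        ((2 * z)⁻¹ • ofRealCLM.comp (-(EuclideanSpace.proj j : Plane →L[ℝ] ℝ))) x := by
      refine HasFDerivAt.const_mul ?_ _
      refine ofRealCLM.hasFDerivAt.comp x ?_
      exact ((EuclideanSpace.proj j : Plane →L[ℝ] ℝ).hasFDerivAt).const_sub (y j)
    rw [pd_mul hl.differentiableAt (hd (contDiff_heatKer_sub z y) x), pd_heatKer]
    simp only [pd]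
    rw [hl.fderiv]
    simp
    ring
  simp only [lap, e]
  rw [Fin.sum_univ_two, EuclideanSpace.norm_sq_eq, Fin.sum_univ_two]
  simp only [Real.norm_eq_abs, sq_abs]
  push_cast
  rw [mul_inv]
  ring

lemma deriv_heatKer_time {ε : ℝ} (hε : 0 < ε) (t s : ℝ) (y x : Plane) :
    deriv (fun s : ℝ => heatKer (ε + (t - s : ℝ) * I) (y - x)) s =
      -I * lap (fun x => heatKer (ε + (t - s : ℝ) * I) (y - x)) x := by
  rw [lap_heatKer]
  set z : ℂ := ε + (t - s : ℝ) * I with hzdef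
  have hz : z ≠ 0 := fun h => by
    have := congrArg Complex.re h
    simp [hzdef] at this
    exact hε.ne' this
  have hzd : HasDerivAt (fun s : ℝ => (ε : ℂ) + (t - s : ℝ) * I) (-I) s := by
    have h1 : HasDerivAt (fun s : ℝ => ((t - s : ℝ) : ℂ)) (-1) s := by
      have := ((hasDerivAt_id s).const_sub t).ofReal_comp
      simpa using this
    simpa using (h1.mul_const I).const_add (ε : ℂ)
  have hpi : (π : ℂ) ≠ 0 := by simp [Real.pi_ne_zero]
  have hK : HasDerivAt (fun z : ℂ => heatKer z (y - x))
      ((((2 * z)⁻¹) ^ 2 * (‖y - x‖ ^ 2 : ℝ) - z⁻¹) * heatKer z (y - x)) z := by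
    simp_rw [heatKer_eq]
    have h1 : HasDerivAt (fun z : ℂ => (4 * π * z)⁻¹) (-(4 * π) / (4 * π * z) ^ 2) z := by
      have := ((hasDerivAt_id z).const_mul (4 * π : ℂ)).inv
        (mul_ne_zero (mul_ne_zero (by norm_num) hpi) hz)
      rw [mul_one] at this
      exact this
    have h2 : HasDerivAt (fun z : ℂ => (4 * z)⁻¹) (-4 / (4 * z) ^ 2) z := by
      have := ((hasDerivAt_id z).const_mul (4 : ℂ)).inv (mul_ne_zero (by norm_num) hz)
      rw [mul_one] at this
      exact this
    have h3 := h1.mul (h2.neg.mul_const ((‖y - x‖ ^ 2 : ℝ) : ℂ)).cexp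
    refine h3.congr_deriv ?_
    simp only [Pi.neg_apply]
    field_simp
    ring
  have := (hK.scomp s hzd).deriv
  simp only [Function.comp_def, smul_eq_mul] at this
  rw [this]

/-- The commutator of a spatial cutoff with the Laplacian, applied to the kernel. -/
def cutoffErr (χ : Plane → ℂ) (z : ℂ) (y x : Plane) : ℂ :=
  I * (lap χ x + 2 * ∑ j, pd j χ x * ((2 * z)⁻¹ * ((y - x) j : ℂ))) * heatKer z (y - x)

lemma heat_cutoff_eq {ε : ℝ} (hε : 0 < ε) {χ : Plane → ℂ} (hχ : ContDiff ℝ ∞ χ) (t s : ℝ)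
    (y x : Plane) :
    I * lap (fun x => χ x * heatKer (ε + (t - s : ℝ) * I) (y - x)) x +
      deriv (fun s : ℝ => χ x * heatKer (ε + (t - s : ℝ) * I) (y - x)) s =
      cutoffErr χ (ε + (t - s : ℝ) * I) y x := by
  have hd : DifferentiableAt ℝ (fun s : ℝ => heatKer (ε + (t - s : ℝ) * I) (y - x)) s :=
    (hasDerivAt_time (u := fun s x => heatKer (ε + (t - s : ℝ) * I) (y - x))
      (contDiff_heatKer_time hε t y) s x).differentiableAt
  rw [lap_mul hχ (contDiff_heatKer_sub _ _), deriv_const_mul _ hd, deriv_heatKer_time hε,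
    cutoffErr]
  simp_rw [pd_heatKer, ← mul_assoc]
  rw [← Finset.sum_mul]
  ring

lemma IsSchrodingerSol.weak_heat {T : ℝ} {u G : ℝ → Plane → ℂ} (h : IsSchrodingerSol T u G)
    {ε : ℝ} (hε : 0 < ε) {χ : Plane → ℂ} (hχ : ContDiff ℝ ∞ χ) {R : ℝ}
    (hR : ∀ x, R < ‖x‖ → χ x = 0) {t : ℝ} (ht : t ∈ Set.Icc 0 T) (y : Plane) :
    (∫ x, u t x * (χ x * heatKer (ε + (t - t : ℝ) * I) (y - x))) -
        ∫ x, u 0 x * (χ x * heatKer (ε + (t - 0 : ℝ) * I) (y - x)) =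
      -I * (∫ a : ℝ × Plane, G a.1 a.2 * (χ a.2 * heatKer (ε + (t - a.1 : ℝ) * I) (y - a.2))
        ∂((volume.restrict (Set.Ioc 0 t)).prod volume)) +
      ∫ a : ℝ × Plane, u a.1 a.2 * cutoffErr χ (ε + (t - a.1 : ℝ) * I) y a.2
        ∂((volume.restrict (Set.Ioc 0 t)).prod volume) := by
  have hK := contDiff_heatKer_time hε t y
  have hΦ : ContDiff ℝ ∞ (Function.uncurry fun (s : ℝ) x =>
      χ x * heatKer (ε + (t - s : ℝ) * I) (y - x)) :=
    (hχ.comp contDiff_snd).mul hK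
  have hw := h.weak hΦ (R := R) (fun s x hx => by simp [hR x hx]) ht
  rw [hw]
  simp_rw [heat_cutoff_eq hε hχ]
  have hχR : ∀ x, R < ‖x‖ → lap χ x = 0 ∧ ∀ j, pd j χ x = 0 := by
    intro x hx
    have h3 : tsupport χ ⊆ Metric.closedBall 0 R :=
      closure_minimal (fun x hx => by
        by_contra hh
        exact hx (hR x (by simpa using hh))) Metric.isClosed_closedBall
    have hx' : x ∉ tsupport χ := fun hh => by
      have := h3 hh
      simp at this
      linarith
    have e : ∀ (j : Fin 2) (f : Plane → ℂ), tsupport (pd j f) ⊆ tsupport f := fun j f =>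
      tsupport_fderiv_apply_subset ℝ _
    refine ⟨Finset.sum_eq_zero fun j _ => ?_, fun j => ?_⟩
    · exact image_eq_zero_of_notMem_tsupport fun hh => hx' (((e j _).trans (e j _)) hh)
    · exact image_eq_zero_of_notMem_tsupport fun hh => hx' (e j _ hh)
  have c1 : Continuous fun a : ℝ × Plane =>
      G a.1 a.2 * (χ a.2 * heatKer (ε + (t - a.1 : ℝ) * I) (y - a.2)) :=
    h.contDiff_source.continuous.mul hΦ.continuous
  have hz : ∀ a : ℝ × Plane, 2 * ((ε : ℂ) + (t - a.1 : ℝ) * I) ≠ 0 := fun p h => by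
    have := congrArg Complex.re h
    simp at this
    exact hε.ne' this
  have c2 : Continuous fun a : ℝ × Plane =>
      u a.1 a.2 * cutoffErr χ (ε + (t - a.1 : ℝ) * I) y a.2 := by
    refine h.contDiff.continuous.mul (Continuous.mul ?_ hK.continuous)
    refine continuous_const.mul (((continuous_lap hχ).comp continuous_snd).add ?_)
    refine continuous_const.mul (continuous_finsetSum _ fun j _ => ?_)
    refine ((contDiff_pd hχ j).continuous.comp continuous_snd).mul (Continuous.mul ?_ ?_)
    · refine Continuous.inv₀ ?_ hz
      fun_prop
    · fun_prop
  have i1 := integrable_prod_of_continuous c1 (R := R) (fun s x hx => by simp [hR x hx]) 0 t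
  have i2 := integrable_prod_of_continuous c2 (R := R)
    (fun s x hx => by simp [cutoffErr, (hχR x hx).1, (hχR x hx).2]) 0 t
  rw [← integral_const_mul, ← integral_add (i1.const_mul _) i2, integral_prod]
  exact (i1.const_mul _).add i2

lemma norm_cutoffErr_le {χ : Plane → ℂ} {δ : ℝ} {x : Plane} (h1 : ‖lap χ x‖ ≤ δ)
    (h2 : ∀ j, ‖pd j χ x‖ ≤ δ) {ε : ℝ} (hε : 0 < ε) {z : ℂ} (hz : z.re = ε) (y : Plane) :
    ‖cutoffErr χ z y x‖ ≤ δ * ((1 + 2 * ‖y - x‖ / ε) * ‖heatKer z (y - x)‖) := by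
  have hδ : 0 ≤ δ := (norm_nonneg _).trans h1
  have hzn : ε ≤ ‖z‖ := hz ▸ Complex.re_le_norm z
  rw [cutoffErr, norm_mul, norm_mul, norm_I, one_mul, ← mul_assoc]
  gcongr
  refine (norm_add_le _ _).trans ?_
  rw [norm_mul]
  have hj : ∀ j : Fin 2, ‖pd j χ x * ((2 * z)⁻¹ * ((y - x) j : ℂ))‖ ≤
      δ * ((2 * ε)⁻¹ * ‖y - x‖) := by
    intro j
    rw [norm_mul, norm_mul, norm_inv, norm_mul, Complex.norm_ofNat, Complex.norm_real]
    gcongr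
    · exact h2 j
    · exact EuclideanSpace.norm_eq (y - x) ▸ (by
        rw [← EuclideanSpace.norm_eq]; exact PiLp.norm_apply_le (y - x) j)
  have hs := (norm_sum_le Finset.univ fun j : Fin 2 =>
    pd j χ x * ((2 * z)⁻¹ * ((y - x) j : ℂ))).trans (Finset.sum_le_sum fun j _ => hj j)
  simp only [Finset.sum_const, Finset.card_univ, Fintype.card_fin, nsmul_eq_mul] at hs
  calc ‖lap χ x‖ + ‖(2 : ℂ)‖ * ‖∑ j, pd j χ x * ((2 * z)⁻¹ * ((y - x) j : ℂ))‖
      ≤ δ + 2 * ((2 : ℕ) * (δ * ((2 * ε)⁻¹ * ‖y - x‖))) := by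
        rw [Complex.norm_ofNat]
        gcongr
    _ = _ := by
        push_cast
        field_simp

lemma exists_weighted_heatKer_le {ε : ℝ} (hε : 0 < ε) {L : ℝ} (hL : 0 < L) :
    ∃ B w : ℝ, 0 ≤ B ∧ 0 < w ∧ ∀ z : ℂ, z.re = ε → ‖z‖ ≤ L → ∀ x : Plane,
      (1 + 2 * ‖x‖ / ε) * ‖heatKer z x‖ ≤ B * ‖heatKer w x‖ := by
  set β : ℝ := ε / (8 * L ^ 2) with hβ
  have hβ0 : 0 < β := by positivity
  set w : ℝ := 2 * L ^ 2 / ε with hw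
  have hw0 : 0 < w := by positivity
  refine ⟨(1 + 1 / ε + 1 / (ε * β)) * (4 * π * ε)⁻¹ * (4 * π * w), w, by positivity, hw0,
    fun z hz hzL x => ?_⟩
  have hzn : ε ≤ ‖z‖ := hz ▸ Complex.re_le_norm z
  have hz0 : 0 < ‖z‖ := hε.trans_le hzn
  have hwn : ‖(w : ℂ)‖ = w := by simp [abs_of_pos hw0]
  rw [norm_heatKer, norm_heatKer, hz, hwn, Complex.ofReal_re]
  set r := ‖x‖
  have hr : 0 ≤ r := norm_nonneg x
  have e1 : w / (4 * w ^ 2) = β := by rw [hβ, hw]; field_simp; norm_num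
  rw [e1]
  have e2 : rexp (-(ε / (4 * ‖z‖ ^ 2)) * r ^ 2) ≤ rexp (-β * r ^ 2) * rexp (-β * r ^ 2) := by
    rw [← Real.exp_add]
    refine Real.exp_le_exp.2 ?_
    have : β + β ≤ ε / (4 * ‖z‖ ^ 2) := by
      rw [show β + β = ε / (4 * L ^ 2) by rw [hβ]; field_simp; norm_num]
      gcongr
    nlinarith [sq_nonneg r]
  have e3 : (1 + 2 * r / ε) * rexp (-β * r ^ 2) ≤ 1 + 1 / ε + 1 / (ε * β) := by
    have hexp : β * r ^ 2 + 1 ≤ rexp (β * r ^ 2) := Real.add_one_le_exp _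
    have h1 : 1 ≤ rexp (β * r ^ 2) := by nlinarith [sq_nonneg r]
    have h2 : 2 * r ≤ 1 + r ^ 2 := by nlinarith [sq_nonneg (r - 1)]
    have h3 : r ^ 2 ≤ 1 / β * rexp (β * r ^ 2) := by
      rw [one_div, ← div_eq_inv_mul, le_div_iff₀ hβ0]; linarith
    rw [neg_mul, Real.exp_neg, ← div_eq_mul_inv, div_le_iff₀ (Real.exp_pos _)]
    calc 1 + 2 * r / ε ≤ 1 + (1 + r ^ 2) / ε := by gcongr
      _ = 1 + 1 / ε + r ^ 2 / ε := by ring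
      _ ≤ rexp (β * r ^ 2) + rexp (β * r ^ 2) / ε + (1 / β * rexp (β * r ^ 2)) / ε := by gcongr
      _ = _ := by field_simp
  calc (1 + 2 * r / ε) * ((4 * π * ‖z‖)⁻¹ * rexp (-(ε / (4 * ‖z‖ ^ 2)) * r ^ 2))
      ≤ (1 + 2 * r / ε) * ((4 * π * ε)⁻¹ * (rexp (-β * r ^ 2) * rexp (-β * r ^ 2))) := by
        gcongr
    _ = ((1 + 2 * r / ε) * rexp (-β * r ^ 2)) * (4 * π * ε)⁻¹ * rexp (-β * r ^ 2) := by ring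
    _ ≤ (1 + 1 / ε + 1 / (ε * β)) * (4 * π * ε)⁻¹ * rexp (-β * r ^ 2) := by gcongr
    _ = _ := by field_simp

lemma isBddIntegrable_heatKer {z : ℂ} (hz : 0 < z.re) : IsBddIntegrable (heatKer z) :=
  ⟨(continuous_heatKer z).measurable, ⟨_, fun x => norm_heatKer_le hz.le x⟩, integrable_heatKer hz⟩

/-- A sequence of smooth cutoffs exhausting the plane. -/
lemma exists_cutoff : ∃ χ : ℕ → Plane → ℂ, (∀ n, ContDiff ℝ ∞ (χ n)) ∧
    (∀ n, ∃ R, ∀ x, R < ‖x‖ → χ n x = 0) ∧ (∀ n x, ‖χ n x‖ ≤ 1) ∧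
    (∀ x, Filter.Tendsto (fun n => χ n x) Filter.atTop (nhds 1)) ∧
    ∃ δ : ℕ → ℝ, Filter.Tendsto δ Filter.atTop (nhds 0) ∧
      ∀ n x, ‖lap (χ n) x‖ ≤ δ n ∧ ∀ j, ‖pd j (χ n) x‖ ≤ δ n := by
  let b : ContDiffBump (0 : Plane) := ⟨1, 2, one_pos, one_lt_two⟩
  set φ : Plane → ℂ := fun x => (b x : ℂ) with hφ
  have hφc : ContDiff ℝ ∞ φ := ofRealCLM.contDiff.comp b.contDiff
  have hφs : HasCompactSupport φ := b.hasCompactSupport.comp_left (g := Complex.ofReal) rfl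
  have hpb : ∀ j, ∃ M, ∀ x, ‖pd j φ x‖ ≤ M := fun j =>
    (contDiff_pd hφc j).continuous.bounded_above_of_compact_support (hasCompactSupport_pd hφs j)
  have hpb2 : ∀ j, ∃ M, ∀ x, ‖pd j (pd j φ) x‖ ≤ M := fun j =>
    (contDiff_pd (contDiff_pd hφc j) j).continuous.bounded_above_of_compact_support
      (hasCompactSupport_pd (hasCompactSupport_pd hφs j) j)
  choose M1 hM1 using hpb
  choose M2 hM2 using hpb2
  have hM1' : ∀ j, 0 ≤ M1 j := fun j => (norm_nonneg _).trans (hM1 j 0)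
  have hM2' : ∀ j, 0 ≤ M2 j := fun j => (norm_nonneg _).trans (hM2 j 0)
  set c : ℕ → ℝ := fun n => 1 / ((n : ℝ) + 1) with hc
  have hc0 : ∀ n, 0 < c n := fun n => by positivity
  have hc1 : ∀ n, c n ≤ 1 := fun n => by
    rw [hc]; simp only []; rw [div_le_one (by positivity)]; simp
  have hct : Filter.Tendsto c Filter.atTop (nhds 0) := tendsto_one_div_add_atTop_nhds_zero_nat
  have hscale : ∀ {f : Plane → ℂ}, ContDiff ℝ ∞ f → ∀ (j : Fin 2) (c : ℝ),
      (pd j fun x => f (c • x)) = fun x => (c : ℂ) * pd j f (c • x) := by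
    intro f hf j c
    funext x
    have h1 : HasFDerivAt (fun x : Plane => c • x) (c • ContinuousLinearMap.id ℝ Plane) x :=
      (hasFDerivAt_id x).const_smul c
    have h2 := ((hf.differentiable (by simp) (c • x)).hasFDerivAt.comp x h1).fderiv
    simp only [pd]
    simp only [Function.comp_def] at h2
    rw [h2]
    simp
  have hcm : ∀ (f : Plane → ℂ) (j : Fin 2) (c : ℂ), Differentiable ℝ f →
      (pd j fun x => c * f x) = fun x => c * pd j f x := by
    intro f j c hf
    funext x
    simp only [pd]
    rw [fderiv_const_mul (hf x)]
    simp
  refine ⟨fun n x => φ (c n • x), fun n => hφc.comp (contDiff_const_smul _), fun n => ?_,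
    fun n x => ?_, fun x => ?_, fun n => c n * (∑ j, M1 j + ∑ j, M2 j), ?_, fun n x => ⟨?_, fun j => ?_⟩⟩
  · refine ⟨2 / c n, fun x hx => ?_⟩
    rw [div_lt_iff₀ (hc0 n)] at hx
    have : b (c n • x) = 0 := b.zero_of_le_dist (by
      rw [dist_zero_right, norm_smul, Real.norm_eq_abs, abs_of_pos (hc0 n), mul_comm]
      exact hx.le)
    simp [hφ, this]
  · simp only [hφ, Complex.norm_real, Real.norm_eq_abs, abs_of_nonneg b.nonneg]
    exact b.le_one
  · have h1 : Filter.Tendsto (fun n => c n • x) Filter.atTop (nhds 0) := by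
      simpa using hct.smul_const x
    have h2 : φ 0 = 1 := by
      simp only [hφ]
      rw [b.one_of_mem_closedBall (by simp [b])]
      simp
    rw [← h2]
    exact (hφc.continuous.tendsto 0).comp h1
  · simpa using hct.mul_const (∑ j, M1 j + ∑ j, M2 j)
  · have e : ∀ j, ‖pd j (pd j fun x => φ (c n • x)) x‖ ≤ c n * M2 j := by
      intro j
      rw [hscale hφc, hcm (fun x => pd j φ (c n • x)) _ _
          (((contDiff_pd hφc j).comp (contDiff_const_smul _)).differentiable
        (by simp)), hscale (contDiff_pd hφc j)]
      simp only [norm_mul, Complex.norm_real, Real.norm_eq_abs, abs_of_pos (hc0 n)]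
      refine mul_le_mul_of_nonneg_left ?_ (hc0 n).le
      exact (mul_le_of_le_one_left (norm_nonneg _) (hc1 n)).trans (hM2 j _)
    refine (norm_sum_le _ _).trans ((Finset.sum_le_sum fun j _ => e j).trans ?_)
    rw [← Finset.mul_sum]
    refine mul_le_mul_of_nonneg_left ?_ (hc0 n).le
    linarith [Finset.sum_nonneg fun j (_ : j ∈ Finset.univ) => hM1' j]
  · rw [hscale hφc]
    simp only [norm_mul, Complex.norm_real, Real.norm_eq_abs, abs_of_pos (hc0 n)]
    refine mul_le_mul_of_nonneg_left ?_ (hc0 n).le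
    refine (hM1 j _).trans ?_
    linarith [Finset.sum_nonneg fun j (_ : j ∈ Finset.univ) => hM2' j,
      Finset.single_le_sum (fun j _ => hM1' j) (Finset.mem_univ j)]

lemma IsSchwartz.isBddIntegrable {f : Plane → ℂ} (hf : IsSchwartz f) : IsBddIntegrable f := by
  obtain ⟨g, rfl⟩ := hf
  refine ⟨g.continuous.measurable, ?_, g.integrable⟩
  obtain ⟨C, -, hC⟩ := g.decay 0 0
  exact ⟨C, fun x => by simpa using hC x⟩

lemma lintegral_cutoffErr_le {χ : Plane → ℂ} {δ : ℝ} (hδ : ∀ x, ‖lap χ x‖ ≤ δ ∧ ∀ j, ‖pd j χ x‖ ≤ δ)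
    {ε : ℝ} (hε : 0 < ε) {B w : ℝ} {z : ℂ} (hz : z.re = ε)
    (hB : ∀ x : Plane, (1 + 2 * ‖x‖ / ε) * ‖heatKer z x‖ ≤ B * ‖heatKer w x‖)
    (y : Plane) {f : Plane → ℂ} (hf : Measurable f) :
    ∫⁻ x, ‖f x * cutoffErr χ z y x‖ₑ ≤
      ENNReal.ofReal δ * (ENNReal.ofReal B *
        (eLpNorm' f 2 volume * eLpNorm' (heatKer w) 2 volume)) := by
  have hδ0 : 0 ≤ δ := (norm_nonneg _).trans (hδ 0).1
  have hwm : Measurable fun x : Plane => heatKer w (y - x) :=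
    (contDiff_heatKer_sub w y).continuous.measurable
  calc ∫⁻ x, ‖f x * cutoffErr χ z y x‖ₑ
      ≤ ∫⁻ x, ENNReal.ofReal δ * (ENNReal.ofReal B * (‖f x‖ₑ * ‖heatKer w (y - x)‖ₑ)) := by
        refine lintegral_mono fun x => ?_
        have h1 : ‖cutoffErr χ z y x‖ₑ ≤
            ENNReal.ofReal δ * (ENNReal.ofReal B * ‖heatKer w (y - x)‖ₑ) := by
          rw [← ofReal_norm, ← ofReal_norm, ← ENNReal.ofReal_mul' (norm_nonneg _),
            ← ENNReal.ofReal_mul hδ0]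
          exact ENNReal.ofReal_le_ofReal ((norm_cutoffErr_le (hδ x).1 (hδ x).2 hε hz y).trans
            (mul_le_mul_of_nonneg_left (hB _) hδ0))
        rw [enorm_mul]
        refine (mul_le_mul_right h1 _).trans (le_of_eq ?_)
        ring
    _ = ENNReal.ofReal δ * (ENNReal.ofReal B * ∫⁻ x, ‖f x‖ₑ * ‖heatKer w (y - x)‖ₑ) := by
        rw [lintegral_const_mul _ (by fun_prop), lintegral_const_mul _ (by fun_prop)]
    _ ≤ _ := by
        gcongr
        refine (ENNReal.lintegral_mul_le_Lp_mul_Lq volume Real.HolderConjugate.two_two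
          hf.enorm.aemeasurable hwm.enorm.aemeasurable).trans (le_of_eq ?_)
        rw [eLpNorm', eLpNorm', lintegral_sub_left_eq_self (fun x => ‖heatKer w x‖ₑ ^ (2 : ℝ)) y]

/-- Regularized Duhamel formula. -/
lemma IsSchrodingerSol.duhamel {T : ℝ} {u G : ℝ → Plane → ℂ} (h : IsSchrodingerSol T u G)
    {ε : ℝ} (hε : 0 < ε) {t : ℝ} (ht : t ∈ Set.Icc 0 T) {M : ℝ≥0∞} (hM : M ≠ ⊤)
    (hu : ∀ s ∈ Set.Icc 0 t, eLpNorm' (u s) 2 volume ≤ M) (y : Plane)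
    (hGi : ∫⁻ s in Set.Ioc 0 t,
      ∫⁻ x, ‖heatKer (ε + (t - s : ℝ) * I) (y - x) * G s x‖ₑ ≠ ⊤) :
    heatOp ε (u t) y = heatOp (ε + t * I) (u 0) y -
      I * ∫ s in Set.Ioc 0 t, heatOp (ε + (t - s : ℝ) * I) (G s) y := by
  obtain ⟨χ, hχ, hχR, hχ1, hχt, δ, hδ, hχδ⟩ := exists_cutoff
  set μ := (volume.restrict (Set.Ioc 0 t)).prod (volume : Measure Plane) with hμ
  have hK := contDiff_heatKer_time hε t y
  have slice : ∀ s ∈ Set.Icc 0 T, Filter.Tendsto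
      (fun n => ∫ x, u s x * (χ n x * heatKer (ε + (t - s : ℝ) * I) (y - x))) Filter.atTop
      (nhds (heatOp (ε + (t - s : ℝ) * I) (u s) y)) := by
    intro s hs
    have hus := (h.isSchwartz s hs).isBddIntegrable
    have hk : Measurable fun x => heatKer (ε + (t - s : ℝ) * I) (y - x) :=
      (contDiff_heatKer_sub _ y).continuous.measurable
    rw [heatOp]
    have hb : Integrable fun x => heatKer (ε + (t - s : ℝ) * I) (y - x) * u s x :=
      hus.integrable.bdd_mul hk.aestronglyMeasurable
        (Filter.Eventually.of_forall fun x => norm_heatKer_le_of_re hε (re_add_mul_I _ _) _)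
    refine tendsto_integral_of_dominated_convergence _ (fun n => ?_) hb.norm (fun n => ?_) ?_
    · exact (hus.measurable.mul ((hχ n).continuous.measurable.mul hk)).aestronglyMeasurable
    · refine Filter.Eventually.of_forall fun x => ?_
      rw [norm_mul, norm_mul, norm_mul, mul_comm, mul_assoc]
      exact mul_le_of_le_one_left (by positivity) (hχ1 n x)
    · refine Filter.Eventually.of_forall fun x => ?_
      have := ((hχt x).mul_const (heatKer (ε + (t - s : ℝ) * I) (y - x))).const_mul (u s x)
      rwa [one_mul, mul_comm (u s x)] at this
  have hGm : Measurable fun a : ℝ × Plane => heatKer (ε + (t - a.1 : ℝ) * I) (y - a.2) * G a.1 a.2 :=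
    (hK.continuous.mul h.contDiff_source.continuous).measurable
  have hGint : Integrable (fun a : ℝ × Plane =>
      heatKer (ε + (t - a.1 : ℝ) * I) (y - a.2) * G a.1 a.2) μ := by
    refine ⟨hGm.aestronglyMeasurable, ?_⟩
    rw [hasFiniteIntegral_iff_enorm, hμ, lintegral_prod _ hGm.enorm.aemeasurable]
    exact hGi.lt_top
  have source : Filter.Tendsto (fun n => ∫ a : ℝ × Plane, G a.1 a.2 *
      (χ n a.2 * heatKer (ε + (t - a.1 : ℝ) * I) (y - a.2)) ∂μ) Filter.atTop
      (nhds (∫ s in Set.Ioc 0 t, heatOp (ε + (t - s : ℝ) * I) (G s) y)) := by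
    simp only [heatOp]
    rw [← integral_prod (fun a : ℝ × Plane =>
      heatKer (ε + (t - a.1 : ℝ) * I) (y - a.2) * G a.1 a.2) hGint]
    refine tendsto_integral_of_dominated_convergence _ (fun n => ?_) hGint.norm (fun n => ?_) ?_
    · exact (h.contDiff_source.continuous.mul (((hχ n).continuous.comp continuous_snd).mul
        hK.continuous)).measurable.aestronglyMeasurable
    · refine Filter.Eventually.of_forall fun a => ?_
      rw [norm_mul, norm_mul, norm_mul, mul_comm, mul_assoc]
      exact mul_le_of_le_one_left (by positivity) (hχ1 n _)
    · refine Filter.Eventually.of_forall fun a => ?_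
      have := ((hχt a.2).mul_const (heatKer (ε + (t - a.1 : ℝ) * I) (y - a.2))).const_mul (G a.1 a.2)
      rwa [one_mul, mul_comm (G a.1 a.2)] at this
  have ht0 : 0 ≤ t := ht.1
  obtain ⟨B, w, hB0, hw0, hB⟩ := exists_weighted_heatKer_le hε (L := ε + t) (by linarith)
  have hwre : 0 < (w : ℂ).re := by simpa using hw0
  have err : Filter.Tendsto (fun n => ∫ a : ℝ × Plane, u a.1 a.2 *
      cutoffErr (χ n) (ε + (t - a.1 : ℝ) * I) y a.2 ∂μ) Filter.atTop (nhds 0) := by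
    rw [tendsto_iff_enorm_sub_tendsto_zero]
    simp only [sub_zero]
    set D : ℝ≥0∞ := ENNReal.ofReal B * (M * eLpNorm' (heatKer w) 2 volume) *
      volume (Set.Ioc 0 t) with hD
    have hDt : D ≠ ⊤ := ENNReal.mul_ne_top (ENNReal.mul_ne_top ENNReal.ofReal_ne_top
      (ENNReal.mul_ne_top hM ((isBddIntegrable_heatKer hwre).eLpNorm'_ne_top one_le_two)))
      measure_Ioc_lt_top.ne
    have hlim : Filter.Tendsto (fun n => ENNReal.ofReal (δ n) * D) Filter.atTop (nhds 0) := by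
      have := ENNReal.Tendsto.mul_const (ENNReal.tendsto_ofReal hδ) (Or.inr hDt)
      simpa using this
    refine tendsto_of_tendsto_of_tendsto_of_le_of_le tendsto_const_nhds hlim
      (fun _ => zero_le) fun n => ?_
    refine (enorm_integral_le_lintegral_enorm _).trans ?_
    refine (lintegral_prod_le _).trans ?_
    calc ∫⁻ s in Set.Ioc 0 t, ∫⁻ x, ‖u s x * cutoffErr (χ n) (ε + (t - s : ℝ) * I) y x‖ₑ
        ≤ ∫⁻ s in Set.Ioc 0 t, ENNReal.ofReal (δ n) * (ENNReal.ofReal B *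
            (M * eLpNorm' (heatKer w) 2 volume)) := by
          refine setLIntegral_mono' measurableSet_Ioc fun s hs => ?_
          refine (lintegral_cutoffErr_le (hχδ n) hε (re_add_mul_I _ _) (hB _ (re_add_mul_I _ _) ?_) y
            (contDiff_slice h.contDiff s).continuous.measurable).trans ?_
          · refine norm_add_mul_I_le hε ?_
            rw [abs_le]; constructor <;> linarith [hs.1, hs.2]
          · gcongr
            exact hu s ⟨hs.1.le, hs.2⟩
      _ = ENNReal.ofReal (δ n) * D := by
          rw [lintegral_const, Measure.restrict_apply_univ, hD]
          ring
  have key := fun n => (hχR n).elim fun R hR => h.weak_heat hε (hχ n) hR ht y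
  have l1 := (slice t ht).sub (slice 0 ⟨le_rfl, ht.1.trans ht.2⟩)
  have l2 := (source.const_mul (-I)).add err
  have := tendsto_nhds_unique (l1.congr key) l2
  simp only [sub_self, sub_zero, ofReal_zero, zero_mul, add_zero] at this
  rw [sub_eq_iff_eq_add] at this
  rw [this]
  ring

lemma conj_heatOp (z : ℂ) (f : Plane → ℂ) (x : Plane) :
    starRingEnd ℂ (heatOp z f x) =
      heatOp (starRingEnd ℂ z) (fun y => starRingEnd ℂ (f y)) x := by
  rw [heatOp, heatOp, ← integral_conj]
  simp only [map_mul, conj_heatKer]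

lemma eLpNorm'_conj (f : Plane → ℂ) (p : ℝ) :
    eLpNorm' (fun x => starRingEnd ℂ (f x)) p volume = eLpNorm' f p volume := by
  simp only [eLpNorm', RCLike.enorm_conj]

lemma eLpNorm'_heatOp_conj (ε τ : ℝ) (f : Plane → ℂ) (p : ℝ) :
    eLpNorm' (heatOp (ε + (-τ : ℝ) * I) f) p volume =
      eLpNorm' (heatOp (ε + (τ : ℝ) * I) fun y => starRingEnd ℂ (f y)) p volume := by
  rw [← eLpNorm'_conj]
  congr 1
  funext x
  rw [conj_heatOp]
  simp

/-- Hölder in time against a homogeneous solution. -/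
lemma lintegral_eLpNorm'_heatOp_mul_le {θ : ℝ} (h0 : 0 ≤ θ) (h1 : θ < 1) {C : ℝ≥0∞}
    (hC : HLSBound θ C) {ε : ℝ} (hε : 0 < ε) {t : ℝ} (ht0 : 0 ≤ t)
    {φ : Plane → ℂ} (hφ : IsBddIntegrable φ) {g : ℝ → ℝ≥0∞} (hg : Measurable g) :
    ∫⁻ s in Set.Ioc 0 t,
        eLpNorm' (heatOp (ε + (t - s : ℝ) * I) φ) (2 / (1 - θ)) volume * g s ≤
      ((1 + C ^ (1 / 2 : ℝ)) * (∫⁻ s in Set.Ioc 0 t, g s ^ (2 / (2 - θ))) ^ ((2 - θ) / 2)) *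
        eLpNorm' φ 2 volume := by
  have hθ2 : 0 < 2 - θ := by linarith
  rcases h0.eq_or_lt with rfl | hθ
  · simp only [sub_zero, div_one, div_self (two_ne_zero' ℝ), ENNReal.rpow_one]
    calc ∫⁻ s in Set.Ioc 0 t, eLpNorm' (heatOp (ε + (t - s : ℝ) * I) φ) 2 volume * g s
        ≤ ∫⁻ s in Set.Ioc 0 t, eLpNorm' φ 2 volume * g s := by
          refine lintegral_mono fun s => ?_
          gcongr
          exact eLpNorm'_heatOp_two_le (by rw [re_add_mul_I]; exact hε) hφ.measurable hφ.integrable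
      _ = (1 * ∫⁻ s in Set.Ioc 0 t, g s) * eLpNorm' φ 2 volume := by
          rw [lintegral_const_mul _ hg, one_mul, mul_comm]
      _ ≤ _ := by gcongr; exact le_self_add
  · have hq : (2 / θ).HolderConjugate (2 / (2 - θ)) := by
      refine Real.holderConjugate_iff.2 ⟨?_, ?_⟩
      · rw [lt_div_iff₀ hθ]; linarith
      · field_simp; ring
    have hv : Measurable (Function.uncurry fun (s : ℝ) y => heatOp (ε + (t - s : ℝ) * I) φ y) :=
      measurable_heatOp_param (α := ℝ × Plane) (z := fun p => ε + (t - p.1 : ℝ) * I)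
        (f := fun _ => φ) (y := fun p => p.2) (by fun_prop) (hφ.measurable.comp measurable_snd)
        (by fun_prop)
    refine (ENNReal.lintegral_mul_le_Lp_mul_Lq _ hq
      (measurable_eLpNorm'_slice hv _).aemeasurable hg.aemeasurable).trans ?_
    have key := lintegral_eLpNorm'_heatOp_le hθ h1 hC hε t measurableSet_Ioc ht0
      (le_refl (Set.Ioc 0 t)) hφ.conj
    have e : ∀ s : ℝ, eLpNorm' (heatOp (ε + (t - s : ℝ) * I) φ) (2 / (1 - θ)) volume =
        eLpNorm' (heatOp (ε + (s - t : ℝ) * I) fun y => starRingEnd ℂ (φ y))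
          (2 / (1 - θ)) volume := fun s => by
      rw [← eLpNorm'_heatOp_conj, neg_sub]
    simp only [e]
    rw [one_div_div, one_div_div]
    calc _ ≤ ((C ^ (1 / 2 : ℝ) * eLpNorm' φ 2 volume) ^ (2 / θ)) ^ (θ / 2) *
          (∫⁻ s in Set.Ioc 0 t, g s ^ (2 / (2 - θ))) ^ ((2 - θ) / 2) := by
          rw [eLpNorm'_conj] at key
          gcongr
      _ = (C ^ (1 / 2 : ℝ) * (∫⁻ s in Set.Ioc 0 t, g s ^ (2 / (2 - θ))) ^ ((2 - θ) / 2)) *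
          eLpNorm' φ 2 volume := by
          rw [← ENNReal.rpow_mul, show 2 / θ * (θ / 2) = 1 by field_simp, ENNReal.rpow_one]
          ring
      _ ≤ _ := by gcongr; exact le_add_self

/-- Integrability in time of the source. -/
lemma lintegral_eLpNorm'_ne_top {θ : ℝ} (h0 : 0 ≤ θ) (h1 : θ < 1) {t : ℝ} {g : ℝ → ℝ≥0∞}
    (h : ∫⁻ s in Set.Ioc 0 t, g s ^ (2 / (2 - θ)) ≠ ⊤) : ∫⁻ s in Set.Ioc 0 t, g s ≠ ⊤ := by
  refine lintegral_ne_top_of_rpow (p := 2 / (2 - θ)) ?_ h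
  rw [le_div_iff₀ (by linarith)]; linarith

lemma lintegral_heatKer_mul_source_ne_top {θ : ℝ} (h0 : 0 ≤ θ) (h1 : θ < 1) {ε : ℝ} (hε : 0 < ε)
    {t : ℝ} {G : ℝ → Plane → ℂ} (hGm : Measurable (Function.uncurry G))
    (hfin : ∫⁻ s in Set.Ioc 0 t,
      eLpNorm' (G s) (2 / (1 + θ)) volume ^ (2 / (2 - θ)) ≠ ⊤) (y : Plane) :
    ∫⁻ s in Set.Ioc 0 t, ∫⁻ x, ‖heatKer (ε + (t - s : ℝ) * I) (y - x) * G s x‖ₑ ≠ ⊤ := by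
  obtain ⟨c, hc, hcb⟩ := exists_enorm_heatOp_le hε (ε + t) (holderConjugate_two_div h0 h1)
  refine ne_top_of_le_ne_top (b := ∫⁻ s in Set.Ioc 0 t, c * eLpNorm' (G s) (2 / (1 + θ)) volume)
    ?_ ?_
  · rw [lintegral_const_mul _ (measurable_eLpNorm'_slice hGm _)]
    exact ENNReal.mul_ne_top hc (lintegral_eLpNorm'_ne_top h0 h1 hfin)
  · refine setLIntegral_mono' measurableSet_Ioc fun s hs => ?_
    refine hcb _ (re_add_mul_I _ _) (norm_add_mul_I_le hε ?_) _
      (hGm.comp measurable_prodMk_left) _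
    rw [abs_le]; constructor <;> linarith [hs.1, hs.2]

lemma measurable_duhamelTerm {ε t : ℝ} {G : ℝ → Plane → ℂ}
    (hGm : Measurable (Function.uncurry G)) :
    Measurable fun p : ℝ × Plane => heatOp (ε + (t - p.1 : ℝ) * I) (G p.1) p.2 :=
  measurable_heatOp_param (α := ℝ × Plane) (z := fun p => (ε : ℂ) + (t - p.1 : ℝ) * I)
    (f := fun p => G p.1) (y := fun p => p.2) (by fun_prop)
    (hGm.comp (f := fun p : (ℝ × Plane) × Plane => (p.1.1, p.2)) (by fun_prop)) (by fun_prop)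

/-- `L²` bound for the regularized Duhamel term. -/
lemma eLpNorm'_duhamelTerm_two_le {θ : ℝ} (h0 : 0 ≤ θ) (h1 : θ < 1) {C : ℝ≥0∞}
    (hC : HLSBound θ C) {ε : ℝ} (hε : 0 < ε) {t : ℝ} (ht0 : 0 ≤ t)
    {G : ℝ → Plane → ℂ} (hGm : Measurable (Function.uncurry G))
    (hG : ∀ s ∈ Set.Ioc 0 t, IsBddIntegrable (G s))
    (hfin : ∫⁻ s in Set.Ioc 0 t,
      eLpNorm' (G s) (2 / (1 + θ)) volume ^ (2 / (2 - θ)) ≠ ⊤) :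
    eLpNorm' (fun y => ∫ s in Set.Ioc 0 t, heatOp (ε + (t - s : ℝ) * I) (G s) y) 2 volume ≤
      (1 + C ^ (1 / 2 : ℝ)) * (∫⁻ s in Set.Ioc 0 t,
        eLpNorm' (G s) (2 / (1 + θ)) volume ^ (2 / (2 - θ))) ^ ((2 - θ) / 2) := by
  set m : Measure ℝ := volume.restrict (Set.Ioc 0 t) with hm
  have hconj := holderConjugate_two_div h0 h1
  have hDm : Measurable fun p : ℝ × Plane => heatOp (ε + (t - p.1 : ℝ) * I) (G p.1) p.2 :=
    measurable_duhamelTerm hGm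
  have hgm : Measurable fun s => eLpNorm' (G s) (2 / (1 + θ)) volume :=
    measurable_eLpNorm'_slice hGm _
  have hg1 := lintegral_eLpNorm'_ne_top h0 h1 hfin
  obtain ⟨c, hc, hcb⟩ := exists_enorm_heatOp_le hε (ε + t) hconj
  set w : Plane → ℂ := fun y => ∫ s, heatOp (ε + (t - s : ℝ) * I) (G s) y ∂m with hw
  have hwm : Measurable w :=
    (StronglyMeasurable.integral_prod_left' (f := fun p : ℝ × Plane =>
      heatOp (ε + (t - p.1 : ℝ) * I) (G p.1) p.2) hDm.stronglyMeasurable).measurable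
  have main := lintegral_rpow_le_of_pairing Real.HolderConjugate.two_two hwm
    (b := (1 + C ^ (1 / 2 : ℝ)) * (∫⁻ s in Set.Ioc 0 t,
        eLpNorm' (G s) (2 / (1 + θ)) volume ^ (2 / (2 - θ))) ^ ((2 - θ) / 2)) fun φ hφ => by
      have hKm : Measurable fun p : ℝ × Plane =>
          heatOp (ε + (t - p.1 : ℝ) * I) (G p.1) p.2 * φ p.2 :=
        hDm.mul (hφ.measurable.comp measurable_snd)
      have hKi : Integrable (fun p : ℝ × Plane =>
          heatOp (ε + (t - p.1 : ℝ) * I) (G p.1) p.2 * φ p.2) (m.prod volume) := by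
        refine ⟨hKm.aestronglyMeasurable, ?_⟩
        rw [hasFiniteIntegral_iff_enorm, lintegral_prod _ hKm.enorm.aemeasurable]
        refine lt_of_le_of_lt (b := ∫⁻ s in Set.Ioc 0 t,
          c * eLpNorm' (G s) (2 / (1 + θ)) volume * ∫⁻ x, ‖φ x‖ₑ) ?_ ?_
        · refine setLIntegral_mono' measurableSet_Ioc fun s hs => ?_
          rw [← lintegral_const_mul _ hφ.measurable.enorm]
          refine lintegral_mono fun y => ?_
          rw [enorm_mul]
          refine mul_le_mul_left ((enorm_heatOp_le_lintegral _ _ _).trans ?_) _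
          refine hcb _ (re_add_mul_I _ _) (norm_add_mul_I_le hε ?_) _ (hG s hs).measurable _
          rw [abs_le]; constructor <;> linarith [hs.1, hs.2]
        · rw [lintegral_mul_const _ (by fun_prop), lintegral_const_mul _ hgm]
          exact ENNReal.mul_lt_top (ENNReal.mul_lt_top hc.lt_top hg1.lt_top)
            (hasFiniteIntegral_iff_enorm.1 hφ.integrable.2)
      have hswap : ∫ y, w y * φ y =
          ∫ s in Set.Ioc 0 t, ∫ y, heatOp (ε + (t - s : ℝ) * I) (G s) y * φ y := by
        rw [integral_integral_swap (f := fun (s : ℝ) y =>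
          heatOp (ε + (t - s : ℝ) * I) (G s) y * φ y) hKi]
        refine integral_congr_ae (Filter.Eventually.of_forall fun y => ?_)
        simp only [hw]
        rw [← integral_mul_const]
      rw [hswap]
      refine (enorm_integral_le_lintegral_enorm _).trans (le_trans ?_
        (lintegral_eLpNorm'_heatOp_mul_le h0 h1 hC hε ht0 hφ hgm))
      refine setLIntegral_mono' measurableSet_Ioc fun s hs => ?_
      have hre : 0 ≤ ((ε : ℂ) + (t - s : ℝ) * I).re := by rw [re_add_mul_I]; exact hε.le
      rw [← heatForm_eq hre (hG s hs).integrable hφ.integrable, heatForm_comm,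
        heatForm_eq hre hφ.integrable (hG s hs).integrable]
      exact enorm_integral_mul_le_eLpNorm' hconj (measurable_heatOp _ hφ.measurable)
        (hG s hs).measurable
  rw [eLpNorm']
  exact (ENNReal.rpow_le_rpow main (by positivity)).trans
    (by rw [← ENNReal.rpow_mul, mul_one_div_cancel (two_ne_zero' ℝ), ENNReal.rpow_one])

/-- A sequence of positive regularization parameters tending to zero. -/
def regParam (n : ℕ) : ℝ := (((n : ℝ) + 1) ^ 2)⁻¹

lemma regParam_pos (n : ℕ) : 0 < regParam n := by unfold regParam; positivity

lemma heatKer_regParam (n : ℕ) (x : Plane) :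
    heatKer (regParam n) x = ((((n : ℝ) + 1) ^ 2 * ‖heatKer 1 (((n : ℝ) + 1) • x)‖ : ℝ) : ℂ) := by
  have h1 := norm_heatKer_ofReal one_pos (((n : ℝ) + 1) • x)
  rw [ofReal_one] at h1
  have hn : ((n : ℂ) + 1) ≠ 0 := by exact_mod_cast Nat.succ_ne_zero n
  rw [ofReal_mul, h1, heatKer, heatKer, norm_smul, Real.norm_of_nonneg (by positivity), regParam]
  push_cast
  have e : -(4 * (((n : ℂ) + 1) ^ 2)⁻¹)⁻¹ * (‖x‖ : ℂ) ^ 2 =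
      -(4 * 1)⁻¹ * (((n : ℂ) + 1) * ‖x‖) ^ 2 := by
    field_simp
  rw [e]
  field_simp

lemma tendsto_norm_sq_mul_heatKer_one :
    Filter.Tendsto (fun x : Plane => ‖x‖ ^ 2 * ‖heatKer 1 x‖) (Bornology.cobounded Plane)
      (nhds 0) := by
  have h1 : Filter.Tendsto (fun s : ℝ => (4 * π)⁻¹ * (4 * (s ^ (1 : ℕ) * rexp (-s))))
      Filter.atTop (nhds 0) := by
    have := ((Real.tendsto_pow_mul_exp_neg_atTop_nhds_zero 1).const_mul 4).const_mul (4 * π)⁻¹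
    simpa using this
  have h2 : Filter.Tendsto (fun x : Plane => ‖x‖ ^ 2 / 4) (Bornology.cobounded Plane)
      Filter.atTop :=
    ((Filter.tendsto_pow_atTop two_ne_zero).comp tendsto_norm_cobounded_atTop).atTop_div_const
      (by norm_num)
  refine (h1.comp h2).congr fun x => ?_
  rw [norm_heatKer]
  simp only [Function.comp, pow_one, norm_one, one_re, mul_one]
  have : -(1 / (4 * 1 ^ 2)) * ‖x‖ ^ 2 = -(‖x‖ ^ 2 / 4) := by ring
  rw [this]
  ring

/-- The heat semigroup is an approximate identity. -/
lemma tendsto_heatOp_regParam {f : Plane → ℂ} (hf : Integrable f) (hc : Continuous f) (x : Plane) :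
    Filter.Tendsto (fun n => heatOp (regParam n) f x) Filter.atTop (nhds (f x)) := by
  have hInt : ∫ x : Plane, ‖heatKer 1 x‖ = 1 := by
    simpa using integral_norm_heatKer_ofReal one_pos
  have hfr : Module.finrank ℝ Plane = 2 := by simp
  have key := tendsto_integral_comp_smul_smul_of_integrable' (μ := (volume : Measure Plane))
    (φ := fun x => ‖heatKer 1 x‖) (fun _ => norm_nonneg _) hInt
    (by rw [hfr]; exact tendsto_norm_sq_mul_heatKer_one) hf (hc.continuousAt (x := x))
  have h2 : Filter.Tendsto (fun n : ℕ => (n : ℝ) + 1) Filter.atTop Filter.atTop :=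
    Filter.tendsto_atTop_add_const_right _ _ tendsto_natCast_atTop_atTop
  refine (key.comp h2).congr fun n => ?_
  simp only [Function.comp, hfr, heatOp, heatKer_regParam, real_smul]

lemma IsSchrodingerSol.measurable {T : ℝ} {u G : ℝ → Plane → ℂ} (h : IsSchrodingerSol T u G)
    (t : ℝ) : Measurable (u t) := (contDiff_slice h.contDiff t).continuous.measurable

/-- A conditional `L²` estimate. -/
lemma IsSchrodingerSol.eLpNorm'_two_le {T : ℝ} {u G : ℝ → Plane → ℂ} (h : IsSchrodingerSol T u G)
    {θ : ℝ} (h0 : 0 ≤ θ) (h1 : θ < 1) {C : ℝ≥0∞} (hC : HLSBound θ C)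
    {t : ℝ} (ht : t ∈ Set.Icc 0 T) {M : ℝ≥0∞} (hM : M ≠ ⊤)
    (hu : ∀ s ∈ Set.Icc 0 t, eLpNorm' (u s) 2 volume ≤ M)
    (hfin : ∫⁻ s in Set.Ioc 0 t,
      eLpNorm' (G s) (2 / (1 + θ)) volume ^ (2 / (2 - θ)) ≠ ⊤) :
    eLpNorm' (u t) 2 volume ≤ eLpNorm' (u 0) 2 volume +
      (1 + C ^ (1 / 2 : ℝ)) * (∫⁻ s in Set.Ioc 0 t,
        eLpNorm' (G s) (2 / (1 + θ)) volume ^ (2 / (2 - θ))) ^ ((2 - θ) / 2) := by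
  have hGm : Measurable (Function.uncurry G) := h.contDiff_source.continuous.measurable
  have hut := (h.isSchwartz t ht).isBddIntegrable
  have hu0 := (h.isSchwartz 0 ⟨le_rfl, ht.1.trans ht.2⟩).isBddIntegrable
  refine (Lp.eLpNorm'_lim_le_liminf_eLpNorm' (f := fun n => heatOp (regParam n) (u t)) two_pos
    (fun n => (measurable_heatOp _ hut.measurable).aestronglyMeasurable)
    (Filter.Eventually.of_forall fun x => tendsto_heatOp_regParam hut.integrable
      (contDiff_slice h.contDiff t).continuous x)).trans ?_
  refine Filter.liminf_le_of_le (by isBoundedDefault) fun b hb => ?_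
  obtain ⟨n, hn⟩ := hb.exists
  refine hn.trans ?_
  have hε := regParam_pos n
  set ε := regParam n
  have hd : heatOp ε (u t) = heatOp (ε + t * I) (u 0) + fun y =>
      (-I) * ∫ s in Set.Ioc 0 t, heatOp (ε + (t - s : ℝ) * I) (G s) y := by
    funext y
    rw [h.duhamel hε ht hM hu y (lintegral_heatKer_mul_source_ne_top h0 h1 hε hGm hfin y),
      Pi.add_apply]
    ring
  have hwm : Measurable fun y => ∫ s in Set.Ioc 0 t, heatOp (ε + (t - s : ℝ) * I) (G s) y :=
    (StronglyMeasurable.integral_prod_left' (f := fun p : ℝ × Plane =>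
      heatOp (ε + (t - p.1 : ℝ) * I) (G p.1) p.2)
      (measurable_duhamelTerm hGm).stronglyMeasurable).measurable
  rw [hd]
  refine (eLpNorm'_add_le (measurable_heatOp _ hu0.measurable).aestronglyMeasurable
    (hwm.const_mul _).aestronglyMeasurable one_le_two).trans (add_le_add ?_ ?_)
  · exact eLpNorm'_heatOp_two_le (by rw [re_add_mul_I]; exact hε) hu0.measurable hu0.integrable
  · refine le_trans (le_of_eq ?_) (eLpNorm'_duhamelTerm_two_le h0 h1 hC hε ht.1 hGm
      (fun s hs => (h.isSchwartz_source s ⟨hs.1.le, hs.2.trans ht.2⟩).isBddIntegrable) hfin)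
    simp only [eLpNorm', enorm_mul, enorm_neg]
    simp [← ofReal_norm]

lemma IsSchrodingerSol.shift {T : ℝ} {u G : ℝ → Plane → ℂ} (h : IsSchrodingerSol T u G)
    {a : ℝ} (ha : 0 ≤ a) :
    IsSchrodingerSol (T - a) (fun s => u (a + s)) (fun s => G (a + s)) where
  contDiff := h.contDiff.comp (f := fun p : ℝ × Plane => (a + p.1, p.2)) (by fun_prop)
  contDiff_source := h.contDiff_source.comp (f := fun p : ℝ × Plane => (a + p.1, p.2)) (by fun_prop)
  isSchwartz t ht := h.isSchwartz _ ⟨by linarith [ht.1], by linarith [ht.2]⟩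
  isSchwartz_source t ht := h.isSchwartz_source _ ⟨by linarith [ht.1], by linarith [ht.2]⟩
  eq t ht x := by
    have := h.eq (a + t) ⟨by linarith [ht.1], by linarith [ht.2]⟩ x
    rw [← this, deriv_comp_const_add (fun s => u s x)]

lemma IsSchwartz.conj {f : Plane → ℂ} (hf : IsSchwartz f) :
    IsSchwartz fun x => starRingEnd ℂ (f x) := by
  obtain ⟨g, rfl⟩ := hf
  refine ⟨⟨fun x => starRingEnd ℂ (g x), conjCLE.contDiff.comp g.smooth', fun k n => ?_⟩, rfl⟩
  obtain ⟨C, hC⟩ := g.decay' k n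
  refine ⟨C, fun x => ?_⟩
  have := conjLIE.norm_iteratedFDeriv_comp_left (𝕜 := ℝ) (g : Plane → ℂ) x n
  refine le_trans (le_of_eq ?_) (hC x)
  congr 1

lemma pd_conj (j : Fin 2) (f : Plane → ℂ) (x : Plane) :
    pd j (fun x => starRingEnd ℂ (f x)) x = starRingEnd ℂ (pd j f x) := by
  have := conjCLE.comp_fderiv (f := f) (x := x)
  have e : (fun x => starRingEnd ℂ (f x)) = conjCLE ∘ f := rfl
  rw [pd, e, this]
  rfl

lemma lap_conj (f : Plane → ℂ) (x : Plane) :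
    lap (fun x => starRingEnd ℂ (f x)) x = starRingEnd ℂ (lap f x) := by
  simp only [lap, map_sum]
  refine Finset.sum_congr rfl fun j _ => ?_
  rw [show pd j (fun x => starRingEnd ℂ (f x)) = fun x => starRingEnd ℂ (pd j f x) from
    funext fun x => pd_conj j f x, pd_conj]

lemma IsSchrodingerSol.reverse {T : ℝ} {u G : ℝ → Plane → ℂ} (h : IsSchrodingerSol T u G)
    {a : ℝ} (ha : a ≤ T) :
    IsSchrodingerSol a (fun s x => starRingEnd ℂ (u (a - s) x))
      (fun s x => starRingEnd ℂ (G (a - s) x)) where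
  contDiff := conjCLE.contDiff.comp
    (h.contDiff.comp (f := fun p : ℝ × Plane => (a - p.1, p.2)) (by fun_prop))
  contDiff_source := conjCLE.contDiff.comp
    (h.contDiff_source.comp (f := fun p : ℝ × Plane => (a - p.1, p.2)) (by fun_prop))
  isSchwartz t ht := (h.isSchwartz _ ⟨by linarith [ht.2], by linarith [ht.1]⟩).conj
  isSchwartz_source t ht := (h.isSchwartz_source _ ⟨by linarith [ht.2], by linarith [ht.1]⟩).conj
  eq t ht x := by
    rw [← h.eq (a - t) ⟨by linarith [ht.2], by linarith [ht.1]⟩ x, lap_conj, map_add, map_mul, conj_I]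
    have e1 : deriv (fun s => starRingEnd ℂ (u (a - s) x)) t =
        starRingEnd ℂ (deriv (fun s => u (a - s) x) t) := deriv.star
    rw [e1, deriv_comp_const_sub (fun s => u s x), map_neg]
    ring

/-- The conditional `L²` estimate between two arbitrary times. -/
lemma IsSchrodingerSol.eLpNorm'_two_le_of_uIcc {T : ℝ} {u G : ℝ → Plane → ℂ}
    (h : IsSchrodingerSol T u G) {θ : ℝ} (h0 : 0 ≤ θ) (h1 : θ < 1) {C : ℝ≥0∞} (hC : HLSBound θ C)
    {a b : ℝ} (ha : a ∈ Set.Icc 0 T) (hb : b ∈ Set.Icc 0 T) {M : ℝ≥0∞} (hM : M ≠ ⊤)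
    (hu : ∀ s ∈ Set.uIcc a b, eLpNorm' (u s) 2 volume ≤ M)
    (hfin : ∫⁻ s in Set.Ioc 0 T,
      eLpNorm' (G s) (2 / (1 + θ)) volume ^ (2 / (2 - θ)) ≠ ⊤) :
    eLpNorm' (u b) 2 volume ≤ eLpNorm' (u a) 2 volume +
      (1 + C ^ (1 / 2 : ℝ)) * (∫⁻ s in Set.Ioc 0 T,
        eLpNorm' (G s) (2 / (1 + θ)) volume ^ (2 / (2 - θ))) ^ ((2 - θ) / 2) := by
  have hθ2 : 0 < 2 - θ := by linarith
  set g : ℝ → ℝ≥0∞ := fun s => eLpNorm' (G s) (2 / (1 + θ)) volume ^ (2 / (2 - θ)) with hg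
  have hgm : Measurable g :=
    (measurable_eLpNorm'_slice h.contDiff_source.continuous.measurable _).pow_const _
  rcases le_total a b with hab | hab
  · rw [Set.uIcc_of_le hab] at hu
    have hI : ∫⁻ s in Set.Ioc 0 (b - a), g (a + s) ≤ ∫⁻ s in Set.Ioc 0 T, g s := by
      rw [← lintegral_indicator measurableSet_Ioc, ← lintegral_indicator measurableSet_Ioc]
      refine (lintegral_mono fun s => ?_).trans_eq
        (lintegral_add_left_eq_self ((Set.Ioc 0 T).indicator g) a)
      by_cases hs : s ∈ Set.Ioc 0 (b - a)
      · have hs' : a + s ∈ Set.Ioc 0 T := ⟨by linarith [hs.1, ha.1], by linarith [hs.2, hb.2]⟩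
        simp [hs, hs', -Set.mem_Ioc]
      · simp [hs, -Set.mem_Ioc]
    have := (h.shift ha.1).eLpNorm'_two_le h0 h1 hC (t := b - a)
      ⟨by linarith, by linarith [hb.2]⟩ hM
      (fun s hs => hu _ ⟨by linarith [hs.1], by linarith [hs.2]⟩) (ne_top_of_le_ne_top hfin hI)
    simp only [add_sub_cancel, add_zero] at this
    refine this.trans ?_
    gcongr
  · rw [Set.uIcc_of_ge hab] at hu
    have hI : ∫⁻ s in Set.Ioc 0 (a - b), g (a - s) ≤ ∫⁻ s in Set.Ioc 0 T, g s := by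
      rw [Measure.restrict_congr_set (Ioc_ae_eq_Icc (a := (0:ℝ)) (b := T)),
        ← lintegral_indicator measurableSet_Ioc, ← lintegral_indicator measurableSet_Icc]
      refine (lintegral_mono fun s => ?_).trans_eq
        (lintegral_sub_left_eq_self ((Set.Icc 0 T).indicator g) a)
      by_cases hs : s ∈ Set.Ioc 0 (a - b)
      · have hs' : a - s ∈ Set.Icc 0 T := ⟨by linarith [hs.2, hb.1], by linarith [hs.1, ha.2]⟩
        simp [hs, hs', -Set.mem_Ioc, -Set.mem_Icc]
      · simp [hs, -Set.mem_Ioc]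
    have := (h.reverse ha.2).eLpNorm'_two_le h0 h1 hC (t := a - b)
      ⟨by linarith, by linarith [hb.1]⟩ hM
      (fun s hs => (eLpNorm'_conj _ _).trans_le (hu _ ⟨by linarith [hs.2], by linarith [hs.1]⟩))
      (by simp only [eLpNorm'_conj]; exact ne_top_of_le_ne_top hfin hI)
    simp only [eLpNorm'_conj, sub_sub_cancel, sub_zero] at this
    refine this.trans ?_
    gcongr

/-- If `N` is locally bounded on a compact set, it is bounded there. -/
lemma exists_bound_of_locally {N : ℝ → ℝ≥0∞} {S K : Set ℝ} (hK : IsCompact K) (hKS : K ⊆ S)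
    (h : ∀ t ∈ K, ∃ M : ℝ≥0∞, M ≠ ⊤ ∧ ∀ᶠ s in nhdsWithin t S, N s ≤ M) :
    ∃ M : ℝ≥0∞, M ≠ ⊤ ∧ ∀ s ∈ K, N s ≤ M := by
  refine hK.induction_on (p := fun A => ∃ M : ℝ≥0∞, M ≠ ⊤ ∧ ∀ s ∈ A, N s ≤ M)
    ⟨0, ENNReal.zero_ne_top, by simp⟩ ?_ ?_ ?_
  · rintro A A' hA ⟨M, hM, h⟩
    exact ⟨M, hM, fun s hs => h s (hA hs)⟩
  · rintro A A' ⟨M, hM, h⟩ ⟨M', hM', h'⟩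
    refine ⟨max M M', (max_lt hM.lt_top hM'.lt_top).ne, ?_⟩
    rintro s (hs | hs)
    · exact (h s hs).trans (le_max_left _ _)
    · exact (h' s hs).trans (le_max_right _ _)
  · intro t ht
    obtain ⟨M, hM, h⟩ := h t ht
    exact ⟨_, nhdsWithin_mono t hKS h, M, hM, fun s hs => hs⟩

/-- A conditional propagation estimate for a lower semicontinuous finite function on an interval is
unconditional. -/
lemma le_add_of_conditional_le {T : ℝ} {N : ℝ → ℝ≥0∞} {K : ℝ≥0∞} (hK : K ≠ ⊤)
    (hN : ∀ t ∈ Set.Icc 0 T, N t ≠ ⊤)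
    (hcl : ∀ n : ℕ, IsClosed {t | t ∈ Set.Icc 0 T ∧ N t ≤ n})
    (hprop : ∀ a ∈ Set.Icc 0 T, ∀ b ∈ Set.Icc 0 T, ∀ M : ℝ≥0∞, M ≠ ⊤ →
      (∀ s ∈ Set.uIcc a b, N s ≤ M) → N b ≤ N a + K) {t : ℝ} (ht : t ∈ Set.Icc 0 T) :
    N t ≤ N 0 + K := by
  have h0T : (0 : ℝ) ∈ Set.Icc 0 T := ⟨le_rfl, ht.1.trans ht.2⟩
  set L : Set ℝ := {t | ∃ M : ℝ≥0∞, M ≠ ⊤ ∧ ∀ᶠ s in nhdsWithin t (Set.Icc 0 T), N s ≤ M} with hL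
  have hLo : IsOpen L := by
    rw [isOpen_iff_mem_nhds]
    rintro t ⟨M, hM, h⟩
    filter_upwards [eventually_nhds_nhdsWithin.2 h] with s hs using ⟨M, hM, hs⟩
  have step : ∀ t ∈ Set.Icc 0 T, ∀ b ∈ Set.Icc 0 T, (∀ s ∈ Set.uIcc t b, s ≠ b → s ∈ L) →
      N t ≤ N b + K := by
    intro t ht b hb h
    refine hprop b hb t ht (max (N t + K) (N b))
      (max_lt (ENNReal.add_lt_top.2 ⟨(hN t ht).lt_top, hK.lt_top⟩) (hN b hb).lt_top).ne
      fun s hs => ?_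
    rw [Set.uIcc_comm] at hs
    by_cases hsb : s = b
    · exact hsb ▸ le_max_right _ _
    · refine le_trans ?_ (le_max_left _ _)
      have hsT : s ∈ Set.Icc 0 T := Set.uIcc_subset_Icc ht hb hs
      have hx : ∀ x ∈ Set.uIcc t s, x ≠ b := by
        intro x hx hxb
        rw [hxb, Set.mem_uIcc] at hx
        rw [Set.mem_uIcc] at hs
        apply hsb
        rcases hs with hs | hs <;> rcases hx with hx | hx <;> linarith [hs.1, hs.2, hx.1, hx.2]
      obtain ⟨M, hM, hMb⟩ := exists_bound_of_locally (N := N) isCompact_uIcc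
        (Set.uIcc_subset_Icc ht hsT) fun x hxs =>
          h x (Set.uIcc_subset_uIcc_left hs hxs) (hx x hxs)
      exact hprop t ht s hsT M hM hMb
  suffices hall : Set.Icc 0 T ⊆ L from step t ht 0 h0T fun s hs _ =>
    hall (Set.uIcc_subset_Icc ht h0T hs)
  by_contra hne
  obtain ⟨b₀, hb₀T, hb₀L⟩ := Set.not_subset.1 hne
  set B : Set ℝ := Set.Icc 0 T ∩ Lᶜ with hB
  have hBc : IsClosed B := isClosed_Icc.inter hLo.isClosed_compl
  have : Nonempty B := ⟨⟨b₀, hb₀T, hb₀L⟩⟩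
  have : CompleteSpace B := hBc.completeSpace_coe
  obtain ⟨n, ⟨t₀, ht₀B⟩, ht₀⟩ := nonempty_interior_of_iUnion_of_closed
    (f := fun n : ℕ => {b : B | N b ≤ n})
    (fun n => by
      have := (hcl n).preimage (continuous_subtype_val (p := (· ∈ B)))
      convert this using 1
      ext b
      simp [b.2.1.1, b.2.1.2])
    (by
      refine Set.eq_univ_of_forall fun b => Set.mem_iUnion.2 ?_
      obtain ⟨n, hn⟩ := ENNReal.exists_nat_gt (hN b b.2.1)
      exact ⟨n, hn.le⟩)
  have hev : ∀ᶠ s in nhdsWithin t₀ B, N s ≤ n := by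
    have := mem_interior_iff_mem_nhds.1 ht₀
    exact (preimage_coe_mem_nhds_subtype (a := ⟨t₀, ht₀B⟩) (t := {s | N s ≤ n})).1 this
  obtain ⟨δ, hδ, hball⟩ := Metric.mem_nhdsWithin_iff.1 hev
  refine ht₀B.2 ⟨n + K, ENNReal.add_ne_top.2 ⟨ENNReal.natCast_ne_top n, hK⟩, ?_⟩
  filter_upwards [inter_mem_nhdsWithin (Set.Icc 0 T) (Metric.ball_mem_nhds t₀ hδ)]
  rintro t ⟨htT, htδ⟩
  by_cases htB : t ∈ B
  · exact (hball ⟨htδ, htB⟩).trans le_self_add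
  have hcomp : IsCompact (B ∩ Set.uIcc t t₀) := isCompact_uIcc.inter_left hBc
  obtain ⟨b, hb, hmin⟩ : ∃ b ∈ B ∩ Set.uIcc t t₀, ∀ s ∈ B ∩ Set.uIcc t t₀, dist t b ≤ dist t s :=
    hcomp.exists_isMinOn (f := fun s => dist t s) ⟨t₀, ht₀B, Set.right_mem_uIcc⟩ (by fun_prop)
  refine (step t htT b hb.1.1 fun s hs hsb => ?_).trans ?_
  · by_contra hsL
    have hsB : s ∈ B := ⟨Set.uIcc_subset_Icc htT hb.1.1 hs, hsL⟩
    have h2 := hmin s ⟨hsB, Set.uIcc_subset_uIcc_left hb.2 hs⟩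
    apply hsb
    rw [Real.dist_eq, Real.dist_eq] at h2
    rw [Set.mem_uIcc] at hs
    rcases hs with hs | hs
    · rw [abs_of_nonpos (by linarith), abs_of_nonpos (by linarith)] at h2; linarith
    · rw [abs_of_nonneg (by linarith), abs_of_nonneg (by linarith)] at h2; linarith
  · gcongr
    refine hball ⟨?_, hb.1⟩
    rw [Metric.mem_ball, Real.dist_eq] at htδ ⊢
    refine lt_of_le_of_lt ?_ htδ
    have := Set.abs_sub_right_of_mem_uIcc hb.2
    rwa [abs_sub_comm, abs_sub_comm t]

lemma isClosed_eLpNorm'_le {u : ℝ → Plane → ℂ} (hu : Continuous (Function.uncurry u)) (T : ℝ)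
    (M : ℝ≥0∞) : IsClosed {t | t ∈ Set.Icc 0 T ∧ eLpNorm' (u t) 2 volume ≤ M} := by
  refine isClosed_Icc.inter (IsSeqClosed.isClosed fun s t hs ht => ?_)
  refine (Lp.eLpNorm'_lim_le_liminf_eLpNorm' (f := fun n => u (s n)) two_pos
    (fun n => (hu.comp (Continuous.prodMk_right (s n))).aestronglyMeasurable)
    (Filter.Eventually.of_forall fun x => ?_)).trans ?_
  · exact ((hu.comp (Continuous.prodMk_left x)).tendsto t).comp ht
  · refine Filter.liminf_le_of_le (by isBoundedDefault) fun b hb => ?_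
    obtain ⟨n, hn⟩ := hb.exists
    exact hn.trans (hs n)

/-- The inhomogeneous energy estimate. -/
lemma IsSchrodingerSol.eLpNorm'_two_le' {T : ℝ} {u G : ℝ → Plane → ℂ} (h : IsSchrodingerSol T u G)
    {θ : ℝ} (h0 : 0 ≤ θ) (h1 : θ < 1) {C : ℝ≥0∞} (hCt : C ≠ ⊤) (hC : HLSBound θ C)
    (hfin : ∫⁻ s in Set.Ioc 0 T,
      eLpNorm' (G s) (2 / (1 + θ)) volume ^ (2 / (2 - θ)) ≠ ⊤) {t : ℝ} (ht : t ∈ Set.Icc 0 T) :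
    eLpNorm' (u t) 2 volume ≤ eLpNorm' (u 0) 2 volume +
      (1 + C ^ (1 / 2 : ℝ)) * (∫⁻ s in Set.Ioc 0 T,
        eLpNorm' (G s) (2 / (1 + θ)) volume ^ (2 / (2 - θ))) ^ ((2 - θ) / 2) := by
  refine le_add_of_conditional_le (N := fun t => eLpNorm' (u t) 2 volume) (T := T) ?_ ?_ ?_ ?_ ht
  · refine ENNReal.mul_ne_top (ENNReal.add_ne_top.2 ⟨ENNReal.one_ne_top,
      ENNReal.rpow_ne_top_of_nonneg (by norm_num) hCt⟩)
      (ENNReal.rpow_ne_top_of_nonneg (by linarith) hfin)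
  · exact fun t ht => (h.isSchwartz t ht).isBddIntegrable.eLpNorm'_ne_top one_le_two
  · exact fun n => isClosed_eLpNorm'_le h.contDiff.continuous T n
  · exact fun a ha b hb M hM hu => h.eLpNorm'_two_le_of_uIcc h0 h1 hC ha hb hM hu hfin

lemma eLpNorm'_I_mul (f : Plane → ℂ) (p : ℝ) :
    eLpNorm' (fun y => -I * f y) p volume = eLpNorm' f p volume := by
  simp only [eLpNorm', enorm_mul, enorm_neg]
  simp [← ofReal_norm]

lemma measurable_duhamelTerm_prod {ε : ℝ} {G : ℝ → Plane → ℂ}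
    (hGm : Measurable (Function.uncurry G)) :
    Measurable (Function.uncurry fun t y =>
      ∫ s in Set.Ioc 0 t, heatOp (ε + (t - s : ℝ) * I) (G s) y) := by
  have hm : Measurable fun p : ℝ × (ℝ × Plane) => {p : ℝ × (ℝ × Plane) | 0 < p.1 ∧ p.1 ≤ p.2.1}.indicator
      (fun p => heatOp (ε + (p.2.1 - p.1 : ℝ) * I) (G p.1) p.2.2) p := by
    refine Measurable.indicator ?_ ((measurableSet_lt (measurable_const (a := (0 : ℝ)))
      measurable_fst).inter (measurableSet_le measurable_fst (measurable_fst.comp measurable_snd)))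
    refine measurable_heatOp_param (α := ℝ × ℝ × Plane)
      (z := fun p => (ε : ℂ) + (p.2.1 - p.1 : ℝ) * I) (f := fun p => G p.1)
      (y := fun p => p.2.2) (by fun_prop) ?_ (by fun_prop)
    exact hGm.comp (f := fun p : (ℝ × ℝ × Plane) × Plane => (p.1.1, p.2)) (by fun_prop)
  have := (StronglyMeasurable.integral_prod_left' (μ := volume) hm.stronglyMeasurable).measurable
  convert this using 1
  funext p
  rw [Function.uncurry, ← integral_indicator measurableSet_Ioc]
  rfl

/-- The regularized retarded Strichartz estimate. -/
lemma lintegral_eLpNorm'_duhamelTerm_le {θ η : ℝ} (h0 : 0 < θ) (h1 : θ < 1) (hη0 : 0 ≤ η)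
    (hη1 : η ≤ 1) {C : ℝ≥0∞} (hC : HLSBound θ C) {ε : ℝ} (hε : 0 < ε) {T : ℝ} (hT0 : 0 ≤ T)
    {G : ℝ → Plane → ℂ} (hGm : Measurable (Function.uncurry G))
    (hG : ∀ s ∈ Set.Icc 0 T, IsBddIntegrable (G s))
    (hfin : ∫⁻ s in Set.Ioc 0 T,
      eLpNorm' (G s) (2 / (1 + η * θ)) volume ^ (2 / (2 - η * θ)) ≠ ⊤) :
    ∫⁻ t in Set.Ioc 0 T, eLpNorm'
        (fun y => ∫ s in Set.Ioc 0 t, heatOp (ε + (t - s : ℝ) * I) (G s) y)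
        (2 / (1 - θ)) volume ^ (2 / θ) ≤
      ((C ^ (1 / 2 : ℝ)) ^ (1 - η) * C ^ η * (∫⁻ s in Set.Ioc 0 T,
        eLpNorm' (G s) (2 / (1 + η * θ)) volume ^ (2 / (2 - η * θ))) ^ ((2 - η * θ) / 2)) ^
          (2 / θ) := by
  have hq : (2 / θ).HolderConjugate (2 / (2 - θ)) := by
    refine Real.holderConjugate_iff.2 ⟨?_, ?_⟩
    · rw [lt_div_iff₀ h0]; linarith
    · have : 2 - θ ≠ 0 := by linarith
      field_simp; ring
  set G' : ℝ → Plane → ℂ := fun s x => {p : ℝ × Plane | p.1 ∈ Set.Icc 0 T}.indicator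
    (Function.uncurry G) (s, x) with hG'
  have hG'm : Measurable (Function.uncurry G') :=
    hGm.indicator (measurable_fst measurableSet_Icc)
  have hG'eq : ∀ s ∈ Set.Icc 0 T, G' s = G s := by
    intro s hs
    funext x
    rw [hG']
    exact Set.indicator_of_mem (s := {p : ℝ × Plane | p.1 ∈ Set.Icc 0 T}) (a := (s, x)) hs _
  have hG'b : ∀ s, IsBddIntegrable (G' s) := by
    intro s
    by_cases hs : s ∈ Set.Icc 0 T
    · rw [hG'eq s hs]; exact hG s hs
    · have : G' s = fun _ => 0 := by
        funext x
        exact Set.indicator_of_notMem (s := {p : ℝ × Plane | p.1 ∈ Set.Icc 0 T}) (a := (s, x)) hs _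
      rw [this]
      exact ⟨measurable_const, ⟨0, by simp⟩, integrable_zero _ _ _⟩
  have hY : ∫⁻ s in Set.Ioc 0 T,
      eLpNorm' (G' s) (2 / (1 + η * θ)) volume ^ (2 / (2 - η * θ)) = ∫⁻ s in Set.Ioc 0 T,
      eLpNorm' (G s) (2 / (1 + η * θ)) volume ^ (2 / (2 - η * θ)) :=
    setLIntegral_congr_fun measurableSet_Ioc fun s hs => by
      simp only [hG'eq s ⟨hs.1.le, hs.2⟩]
  have hv : ∀ t ∈ Set.Ioc 0 T, (fun y => ∫ s in Set.Ioc 0 t, heatOp (ε + (t - s : ℝ) * I) (G' s) y) =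
      fun y => ∫ s in Set.Ioc 0 t, heatOp (ε + (t - s : ℝ) * I) (G s) y := by
    intro t ht
    funext y
    exact setIntegral_congr_fun measurableSet_Ioc fun s hs => by
      simp only [hG'eq s ⟨hs.1.le, hs.2.trans ht.2⟩]
  rw [← hY] at hfin ⊢
  refine le_trans (le_of_eq ?_) (lintegral_rpow_lintegral_le_of_pairing hq
    (holderConjugate_two_div h0.le h1) (m := volume.restrict (Set.Ioc 0 T))
    (measurable_duhamelTerm_prod (ε := ε) hG'm) fun F hF => ?_)
  · refine setLIntegral_congr_fun measurableSet_Ioc fun t ht => ?_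
    rw [← hv t ht, eLpNorm', ← ENNReal.rpow_mul, one_div_mul_eq_div]
  · refine (enorm_integral_retarded_le h0.le h1 hη0 hη1 hC hε hT0 hG'm hG'b hfin hF).trans
      (le_of_eq ?_)
    rw [one_div_div]
    have h1η : 0 ≤ 1 - η := by linarith
    rw [ENNReal.mul_rpow_of_nonneg _ _ h1η, ENNReal.mul_rpow_of_nonneg _ _ hη0]
    set x := (∫⁻ t in Set.Ioc 0 T, eLpNorm' (F t) (2 / (1 + θ)) volume ^ (2 / (2 - θ))) ^
      ((2 - θ) / 2)
    have hx : x ^ (1 - η) * x ^ η = x := by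
      rw [← ENNReal.rpow_add_of_nonneg _ _ h1η hη0, sub_add_cancel, ENNReal.rpow_one]
    calc _ = (C ^ (1 / 2 : ℝ)) ^ (1 - η) * C ^ η * (∫⁻ s in Set.Ioc 0 T,
        eLpNorm' (G' s) (2 / (1 + η * θ)) volume ^ (2 / (2 - η * θ))) ^ ((2 - η * θ) / 2) *
          (x ^ (1 - η) * x ^ η) := by ring
      _ = _ := by rw [hx]

lemma measurable_heatOp_slice (z : ℂ) {u : ℝ → Plane → ℂ} (hu : Measurable (Function.uncurry u)) :
    Measurable (Function.uncurry fun t y => heatOp z (u t) y) :=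
  measurable_heatOp_param (α := ℝ × Plane) (z := fun _ => z) (f := fun p => u p.1)
    (y := fun p => p.2) (by fun_prop)
    (hu.comp (f := fun p : (ℝ × Plane) × Plane => (p.1.1, p.2)) (by fun_prop)) (by fun_prop)

/-- Removal of the regularization. -/
lemma lintegral_eLpNorm'_le_of_regularized {u : ℝ → Plane → ℂ}
    (hu : Continuous (Function.uncurry u)) {T : ℝ}
    (hui : ∀ t ∈ Set.Icc 0 T, IsBddIntegrable (u t)) {p q : ℝ} (hp : 0 < p) (hq : 0 < q) {A : ℝ≥0∞}
    (hA : ∀ n, ∫⁻ t in Set.Ioc 0 T, eLpNorm' (heatOp (regParam n) (u t)) p volume ^ q ≤ A) :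
    ∫⁻ t in Set.Ioc 0 T, eLpNorm' (u t) p volume ^ q ≤ A := by
  calc ∫⁻ t in Set.Ioc 0 T, eLpNorm' (u t) p volume ^ q
      ≤ ∫⁻ t in Set.Ioc 0 T, Filter.liminf
          (fun n => eLpNorm' (heatOp (regParam n) (u t)) p volume ^ q) Filter.atTop := by
        refine setLIntegral_mono' measurableSet_Ioc fun t ht => ?_
        have hut := hui t ⟨ht.1.le, ht.2⟩
        have h1 := Lp.eLpNorm'_lim_le_liminf_eLpNorm' (μ := volume) (f := fun n => heatOp (regParam n) (u t)) hp
          (fun n => (measurable_heatOp _ hut.measurable).aestronglyMeasurable)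
          (Filter.Eventually.of_forall fun x => tendsto_heatOp_regParam hut.integrable
            (hu.comp (Continuous.prodMk_right t)) x)
        refine (ENNReal.rpow_le_rpow h1 hq.le).trans (le_of_eq ?_)
        exact (ENNReal.orderIsoRpow q hq).liminf_apply
    _ ≤ Filter.liminf (fun n => ∫⁻ t in Set.Ioc 0 T,
          eLpNorm' (heatOp (regParam n) (u t)) p volume ^ q) Filter.atTop :=
        lintegral_liminf_le fun n =>
          (measurable_eLpNorm'_slice (measurable_heatOp_slice _ hu.measurable) _).pow_const _
    _ ≤ A := by
        refine Filter.liminf_le_of_le (by isBoundedDefault) fun b hb => ?_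
        obtain ⟨n, hn⟩ := hb.exists
        exact hn.trans (hA n)

/-- Strichartz estimate when the source exponent does not exceed the solution exponent. -/
lemma IsSchrodingerSol.strichartz_of_le {θ η : ℝ} (h0 : 0 < θ) (h1 : θ < 1) (hη0 : 0 ≤ η)
    (hη1 : η ≤ 1) {C C' : ℝ≥0∞} (hC : HLSBound θ C) (hC't : C' ≠ ⊤) (hC' : HLSBound (η * θ) C')
    {T : ℝ} (hT0 : 0 ≤ T) {u G : ℝ → Plane → ℂ} (h : IsSchrodingerSol T u G)
    (hfin : ∫⁻ s in Set.Ioc 0 T,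
      eLpNorm' (G s) (2 / (1 + η * θ)) volume ^ (2 / (2 - η * θ)) ≠ ⊤) :
    (∫⁻ t in Set.Ioc 0 T, eLpNorm' (u t) (2 / (1 - θ)) volume ^ (2 / θ)) ^ (θ / 2) ≤
      C ^ (1 / 2 : ℝ) * eLpNorm' (u 0) 2 volume +
        (C ^ (1 / 2 : ℝ)) ^ (1 - η) * C ^ η * (∫⁻ s in Set.Ioc 0 T,
          eLpNorm' (G s) (2 / (1 + η * θ)) volume ^ (2 / (2 - η * θ))) ^ ((2 - η * θ) / 2) := by
  have hηθ0 : 0 ≤ η * θ := by positivity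
  have hηθ1 : η * θ < 1 := by nlinarith
  have hθ1 : 0 < 1 - θ := by linarith
  have hq1 : 1 ≤ 2 / θ := by rw [le_div_iff₀ h0]; linarith
  have hp1 : 1 ≤ 2 / (1 - θ) := by rw [le_div_iff₀ hθ1]; linarith
  have hGm : Measurable (Function.uncurry G) := h.contDiff_source.continuous.measurable
  have hu0 := (h.isSchwartz 0 ⟨le_rfl, hT0⟩).isBddIntegrable
  have e : (θ / 2) = (2 / θ)⁻¹ := by rw [inv_div]
  rw [e, ENNReal.rpow_inv_le_iff (by positivity)]
  refine lintegral_eLpNorm'_le_of_regularized h.contDiff.continuous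
    (fun t ht => (h.isSchwartz t ht).isBddIntegrable) (by positivity) (by positivity) fun n => ?_
  have hε := regParam_pos n
  set ε := regParam n
  set a : ℝ → ℝ≥0∞ := fun t => eLpNorm' (heatOp (ε + t * I) (u 0)) (2 / (1 - θ)) volume with ha
  set b : ℝ → ℝ≥0∞ := fun t => eLpNorm' (fun y => ∫ s in Set.Ioc 0 t,
    heatOp (ε + (t - s : ℝ) * I) (G s) y) (2 / (1 - θ)) volume with hb
  have hvm : Measurable (Function.uncurry fun (t : ℝ) y => heatOp (ε + t * I) (u 0) y) :=
    measurable_heatOp_param (α := ℝ × Plane) (z := fun p => ε + p.1 * I)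
      (f := fun _ => u 0) (y := fun p => p.2) (by fun_prop) (hu0.measurable.comp measurable_snd)
      (by fun_prop)
  have hwm := measurable_duhamelTerm_prod (ε := ε) hGm
  have ham : Measurable a := measurable_eLpNorm'_slice hvm _
  have hbm : Measurable b := measurable_eLpNorm'_slice hwm _
  have hM := fun t ht => h.eLpNorm'_two_le' hηθ0 hηθ1 hC't hC' hfin (t := t) ht
  set M := eLpNorm' (u 0) 2 volume + (1 + C' ^ (1 / 2 : ℝ)) * (∫⁻ s in Set.Ioc 0 T,
        eLpNorm' (G s) (2 / (1 + η * θ)) volume ^ (2 / (2 - η * θ))) ^ ((2 - η * θ) / 2)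
  have hMt : M ≠ ⊤ := by
    refine ENNReal.add_ne_top.2 ⟨hu0.eLpNorm'_ne_top one_le_two,
      ENNReal.mul_ne_top (ENNReal.add_ne_top.2 ⟨ENNReal.one_ne_top,
      ENNReal.rpow_ne_top_of_nonneg (by norm_num) hC't⟩)
      (ENNReal.rpow_ne_top_of_nonneg (by linarith) hfin)⟩
  have hab : ∀ t ∈ Set.Ioc 0 T, eLpNorm' (heatOp ε (u t)) (2 / (1 - θ)) volume ≤ a t + b t := by
    intro t ht
    have hd : heatOp ε (u t) = heatOp (ε + t * I) (u 0) + fun y =>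
        (-I) * ∫ s in Set.Ioc 0 t, heatOp (ε + (t - s : ℝ) * I) (G s) y := by
      funext y
      rw [h.duhamel hε ⟨ht.1.le, ht.2⟩ hMt (fun s hs => hM s ⟨hs.1, hs.2.trans ht.2⟩) y
        (lintegral_heatKer_mul_source_ne_top hηθ0 hηθ1 hε hGm
          (ne_top_of_le_ne_top hfin (lintegral_mono_set (Set.Ioc_subset_Ioc_right ht.2))) y),
        Pi.add_apply]
      ring
    have hwt : Measurable fun y => ∫ s in Set.Ioc 0 t, heatOp (ε + (t - s : ℝ) * I) (G s) y :=
      hwm.comp measurable_prodMk_left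
    rw [hd]
    refine (eLpNorm'_add_le (measurable_heatOp _ hu0.measurable).aestronglyMeasurable
      (hwt.const_mul _).aestronglyMeasurable hp1).trans (add_le_add le_rfl ?_)
    exact (eLpNorm'_I_mul _ _).le
  have h1' := lintegral_eLpNorm'_heatOp_le h0 h1 hC hε 0 measurableSet_Ioc hT0
    (le_refl (Set.Ioc 0 T)) hu0
  simp only [sub_zero] at h1'
  have h2' := lintegral_eLpNorm'_duhamelTerm_le h0 h1 hη0 hη1 hC hε hT0 hGm
    (fun s hs => (h.isSchwartz_source s hs).isBddIntegrable) hfin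
  rw [← ENNReal.rpow_inv_le_iff (by positivity)] at h1' h2' ⊢
  rw [← one_div] at h1' h2' ⊢
  calc _ ≤ (∫⁻ t in Set.Ioc 0 T, (a + b) t ^ (2 / θ)) ^ (1 / (2 / θ)) := by
        refine ENNReal.rpow_le_rpow (setLIntegral_mono' measurableSet_Ioc fun t ht =>
          ENNReal.rpow_le_rpow (hab t ht) (by positivity)) (by positivity)
    _ ≤ _ := ENNReal.lintegral_Lp_add_le ham.aemeasurable hbm.aemeasurable hq1
    _ ≤ _ := add_le_add h1' h2'

/-- The `L²` bound at each time, with a constant depending only on the exponent of the source. -/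
theorem exists_eLpNorm'_two_bound {τ : ℝ} (h0 : 0 ≤ τ) (h1 : τ < 1) :
    ∃ K : ℝ≥0∞, K ≠ ⊤ ∧ ∀ T : ℝ, 0 ≤ T → ∀ u G : ℝ → Plane → ℂ, IsSchrodingerSol T u G →
      ∫⁻ s in Set.Ioc 0 T, eLpNorm' (G s) (2 / (1 + τ)) volume ^ (2 / (2 - τ)) ≠ ⊤ →
      ∀ t ∈ Set.Icc 0 T, eLpNorm' (u t) 2 volume ≤ K * (eLpNorm' (u 0) 2 volume +
        (∫⁻ s in Set.Ioc 0 T, eLpNorm' (G s) (2 / (1 + τ)) volume ^ (2 / (2 - τ))) ^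
          ((2 - τ) / 2)) := by
  obtain ⟨C, hCt, hC⟩ := exists_hls h0 h1
  refine ⟨1 + C ^ (1 / 2 : ℝ), ENNReal.add_ne_top.2 ⟨ENNReal.one_ne_top,
    ENNReal.rpow_ne_top_of_nonneg (by norm_num) hCt⟩, fun T _ u G h hfin t ht => ?_⟩
  refine (h.eLpNorm'_two_le' h0 h1 hCt hC hfin ht).trans ?_
  rw [mul_add]
  refine add_le_add (le_mul_of_one_le_left' ?_) le_rfl
  exact le_self_add

/-- The Strichartz bound when the source exponent is at most the solution exponent. -/
theorem exists_strichartz_bound_of_le {θ η : ℝ} (h0 : 0 < θ) (h1 : θ < 1) (hη0 : 0 ≤ η)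
    (hη1 : η ≤ 1) :
    ∃ K : ℝ≥0∞, K ≠ ⊤ ∧ ∀ T : ℝ, 0 ≤ T → ∀ u G : ℝ → Plane → ℂ, IsSchrodingerSol T u G →
      ∫⁻ s in Set.Ioc 0 T, eLpNorm' (G s) (2 / (1 + η * θ)) volume ^ (2 / (2 - η * θ)) ≠ ⊤ →
      (∫⁻ t in Set.Ioc 0 T, eLpNorm' (u t) (2 / (1 - θ)) volume ^ (2 / θ)) ^ (θ / 2) ≤
        K * (eLpNorm' (u 0) 2 volume + (∫⁻ s in Set.Ioc 0 T,
          eLpNorm' (G s) (2 / (1 + η * θ)) volume ^ (2 / (2 - η * θ))) ^ ((2 - η * θ) / 2)) := by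
  obtain ⟨C, hCt, hC⟩ := exists_hls h0.le h1
  obtain ⟨C', hC't, hC'⟩ := exists_hls (θ := η * θ) (by positivity) (by nlinarith)
  have hK1 : C ^ (1 / 2 : ℝ) ≠ ⊤ := ENNReal.rpow_ne_top_of_nonneg (by norm_num) hCt
  refine ⟨C ^ (1 / 2 : ℝ) + (C ^ (1 / 2 : ℝ)) ^ (1 - η) * C ^ η, ENNReal.add_ne_top.2 ⟨hK1,
    ENNReal.mul_ne_top (ENNReal.rpow_ne_top_of_nonneg (by linarith) hK1)
      (ENNReal.rpow_ne_top_of_nonneg hη0 hCt)⟩, fun T hT u G h hfin => ?_⟩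
  refine (h.strichartz_of_le h0 h1 hη0 hη1 hC hC't hC' hT hfin).trans ?_
  rw [mul_add]
  exact add_le_add (mul_le_mul_left le_self_add _) (mul_le_mul_left le_add_self _)

/-- The Strichartz bound for all finite admissible time exponents. -/
theorem exists_strichartz_bound {θ τ : ℝ} (h0 : 0 < θ) (h1 : θ < 1) (hτ0 : 0 ≤ τ) (hτ1 : τ < 1) :
    ∃ K : ℝ≥0∞, K ≠ ⊤ ∧ ∀ T : ℝ, 0 ≤ T → ∀ u G : ℝ → Plane → ℂ, IsSchrodingerSol T u G →
      ∫⁻ s in Set.Ioc 0 T, eLpNorm' (G s) (2 / (1 + τ)) volume ^ (2 / (2 - τ)) ≠ ⊤ →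
      (∫⁻ t in Set.Ioc 0 T, eLpNorm' (u t) (2 / (1 - θ)) volume ^ (2 / θ)) ^ (θ / 2) ≤
        K * (eLpNorm' (u 0) 2 volume + (∫⁻ s in Set.Ioc 0 T,
          eLpNorm' (G s) (2 / (1 + τ)) volume ^ (2 / (2 - τ))) ^ ((2 - τ) / 2)) := by
  rcases le_total τ θ with hle | hle
  · have e : τ / θ * θ = τ := div_mul_cancel₀ _ h0.ne'
    have key := exists_strichartz_bound_of_le (η := τ / θ) h0 h1 (by positivity)
      ((div_le_one h0).2 hle)
    rwa [e] at key
  have hτ : 0 < τ := h0.trans_le hle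
  obtain ⟨K₁, hK₁t, hK₁⟩ := exists_strichartz_bound_of_le (η := 1) hτ hτ1 zero_le_one le_rfl
  simp only [one_mul] at hK₁
  obtain ⟨K₂, hK₂t, hK₂⟩ := exists_eLpNorm'_two_bound hτ0 hτ1
  refine ⟨K₂ + K₁, ENNReal.add_ne_top.2 ⟨hK₂t, hK₁t⟩, fun T hT u G h hfin => ?_⟩
  have hZ := hK₁ T hT u G h hfin
  have hS := hK₂ T hT u G h hfin
  set A := eLpNorm' (u 0) 2 volume + (∫⁻ s in Set.Ioc 0 T,
    eLpNorm' (G s) (2 / (1 + τ)) volume ^ (2 / (2 - τ))) ^ ((2 - τ) / 2)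
  set η := θ / τ with hη
  have hη0 : 0 < η := by positivity
  have hη1 : η ≤ 1 := (div_le_one hτ).2 hle
  have e : η * τ = θ := div_mul_cancel₀ _ hτ.ne'
  have eq : η * (2 / θ) = 2 / τ := by rw [hη]; field_simp
  set B := (K₂ + K₁) * A
  have hBZ : (∫⁻ t in Set.Ioc 0 T, eLpNorm' (u t) (2 / (1 - τ)) volume ^ (2 / τ)) ≤
      B ^ (2 / τ) := by
    rw [← ENNReal.rpow_inv_le_iff (by positivity), inv_div]
    exact hZ.trans (mul_le_mul_left le_add_self _)
  have hBS : ∀ t ∈ Set.Icc 0 T, eLpNorm' (u t) 2 volume ≤ B := fun t ht =>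
    (hS t ht).trans (mul_le_mul_left le_self_add _)
  rw [← inv_div 2 θ, ENNReal.rpow_inv_le_iff (by positivity)]
  calc (∫⁻ t in Set.Ioc 0 T, eLpNorm' (u t) (2 / (1 - θ)) volume ^ (2 / θ))
      ≤ ∫⁻ t in Set.Ioc 0 T, (B ^ (1 - η)) ^ (2 / θ) *
          eLpNorm' (u t) (2 / (1 - τ)) volume ^ (2 / τ) := by
        refine setLIntegral_mono' measurableSet_Ioc fun t ht => ?_
        have hi := eLpNorm'_interp (μ := volume) (h.measurable t) hτ0 hτ1 hη0.le hη1
        rw [e] at hi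
        rw [← eq, ENNReal.rpow_mul, ← ENNReal.mul_rpow_of_nonneg _ _ (by positivity)]
        refine ENNReal.rpow_le_rpow (hi.trans (mul_le_mul_left ?_ _)) (by positivity)
        exact ENNReal.rpow_le_rpow (hBS t ⟨ht.1.le, ht.2⟩) (by linarith)
    _ = (B ^ (1 - η)) ^ (2 / θ) *
          ∫⁻ t in Set.Ioc 0 T, eLpNorm' (u t) (2 / (1 - τ)) volume ^ (2 / τ) :=
        lintegral_const_mul _ ((measurable_eLpNorm'_slice
          h.contDiff.continuous.measurable _).pow_const _)
    _ ≤ (B ^ (1 - η)) ^ (2 / θ) * B ^ (2 / τ) := mul_le_mul_right hBZ _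
    _ = B ^ (2 / θ) := by
        rw [← eq, ← ENNReal.rpow_mul, ← ENNReal.rpow_add_of_nonneg _ _
          (mul_nonneg (by linarith) (by positivity)) (by positivity)]
        congr 1
        ring

theorem eLpNorm_ofReal {f : Plane → ℂ} {r : ℝ} (hr : 0 < r) :
    eLpNorm f (ENNReal.ofReal r) volume = eLpNorm' f r volume := by
  rw [eLpNorm_eq_eLpNorm' (by simpa using hr) ENNReal.ofReal_ne_top, ENNReal.toReal_ofReal hr.le]

theorem enorm_toReal_eLpNorm_ofReal {f : Plane → ℂ} (hf : IsSchwartz f) {r : ℝ} (hr : 1 ≤ r) :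
    ‖(eLpNorm f (ENNReal.ofReal r) volume).toReal‖ₑ = eLpNorm' f r volume := by
  rw [eLpNorm_ofReal (by linarith), Real.enorm_of_nonneg ENNReal.toReal_nonneg,
    ENNReal.ofReal_toReal (hf.isBddIntegrable.eLpNorm'_ne_top hr)]

theorem mixNorm_ofReal {T q r : ℝ} {v : ℝ → Plane → ℂ} (hv : ∀ t ∈ Set.Icc 0 T, IsSchwartz (v t))
    (hq : 0 < q) (hr : 1 ≤ r) :
    mixNorm T (ENNReal.ofReal q) (ENNReal.ofReal r) v =
      (∫⁻ t in Set.Ioc 0 T, eLpNorm' (v t) r volume ^ q) ^ (1 / q) := by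
  rw [mixNorm, eLpNorm_eq_eLpNorm' (by simpa using hq) ENNReal.ofReal_ne_top,
    ENNReal.toReal_ofReal hq.le, eLpNorm'_eq_lintegral_enorm]
  congr 1
  refine setLIntegral_congr_fun measurableSet_Ioc fun t ht => ?_
  simp only [enorm_toReal_eLpNorm_ofReal (hv t ⟨ht.1.le, ht.2⟩) hr]

/-- An admissible pair is `(2 / θ, 2 / (1 - θ))` for some `θ ∈ [0, 1)`. -/
theorem Admissible.exists_param {q r : ℝ≥0∞} (h : Admissible q r) :
    ∃ θ : ℝ, 0 ≤ θ ∧ θ < 1 ∧ q⁻¹ = ENNReal.ofReal (θ / 2) ∧ r⁻¹ = ENNReal.ofReal ((1 - θ) / 2) := by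
  obtain ⟨h, hq⟩ := h
  simp only [one_div] at h
  have hq' : q⁻¹ < 2⁻¹ := ENNReal.inv_lt_inv.2 hq
  have hqt : q⁻¹ ≠ ⊤ := hq'.ne_top
  have h2 : (2⁻¹ : ℝ≥0∞) = ENNReal.ofReal 2⁻¹ := by
    rw [ENNReal.ofReal_inv_of_pos two_pos, ENNReal.ofReal_ofNat]
  have hlt : q⁻¹.toReal < 2⁻¹ := by
    rw [h2] at hq'
    exact (ENNReal.lt_ofReal_iff_toReal_lt hqt).1 hq'
  refine ⟨2 * q⁻¹.toReal, by positivity, by linarith, ?_, ?_⟩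
  · rw [mul_div_cancel_left₀ _ two_ne_zero, ENNReal.ofReal_toReal hqt]
  · have e : (1 - 2 * q⁻¹.toReal) / 2 = 2⁻¹ - q⁻¹.toReal := by ring
    rw [e, ENNReal.ofReal_sub _ ENNReal.toReal_nonneg, ENNReal.ofReal_toReal hqt, ← h2, ← h,
      ENNReal.add_sub_cancel_left hqt]

theorem ENNReal.eq_ofReal_of_inv_eq {p : ℝ≥0∞} {a : ℝ} (ha : 0 < a)
    (h : p⁻¹ = ENNReal.ofReal a) : p = ENNReal.ofReal a⁻¹ := by
  rw [ENNReal.ofReal_inv_of_pos ha, ← h, inv_inv]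

theorem ENNReal.eq_ofReal_of_conjugate {p p' : ℝ≥0∞} {a : ℝ} (ha0 : 0 ≤ a) (ha : a < 1)
    (h : p⁻¹ = ENNReal.ofReal a) (hp : 1 / p + 1 / p' = 1) : p' = ENNReal.ofReal (1 - a)⁻¹ := by
  refine ENNReal.eq_ofReal_of_inv_eq (by linarith) ?_
  rw [ENNReal.ofReal_sub _ ha0, ← h, ENNReal.ofReal_one, ← hp, one_div, one_div,
    ENNReal.add_sub_cancel_left (h ▸ ENNReal.ofReal_ne_top)]

/-- Strichartz estimates in two space dimensions, for solutions of the Schrödinger equation. -/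
theorem exists_mixNorm_bound {q r qt rt : ℝ≥0∞} (h1 : Admissible q r) (h2 : Admissible qt rt) :
    ∃ K : ℝ≥0∞, K ≠ ⊤ ∧ ∀ qt' rt' : ℝ≥0∞, 1 / qt + 1 / qt' = 1 → 1 / rt + 1 / rt' = 1 →
      ∀ T : ℝ, 0 ≤ T → ∀ u G : ℝ → Plane → ℂ, IsSchrodingerSol T u G →
      mixNorm T qt' rt' G ≠ ⊤ →
      mixNorm T q r u ≤ K * (eLpNorm (u 0) 2 volume + mixNorm T qt' rt' G) := by
  obtain ⟨θ, hθ0, hθ1, hq, hr⟩ := h1.exists_param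
  obtain ⟨τ, hτ0, hτ1, hqt, hrt⟩ := h2.exists_param
  have e2 : ∀ f : Plane → ℂ, eLpNorm f 2 volume = eLpNorm' f 2 volume := fun f => by
    rw [← eLpNorm_ofReal two_pos, ENNReal.ofReal_ofNat]
  have hG : ∀ qt' rt' : ℝ≥0∞, 1 / qt + 1 / qt' = 1 → 1 / rt + 1 / rt' = 1 → ∀ (T : ℝ)
      (u G : ℝ → Plane → ℂ), IsSchrodingerSol T u G → mixNorm T qt' rt' G =
        (∫⁻ s in Set.Ioc 0 T, eLpNorm' (G s) (2 / (1 + τ)) volume ^ (2 / (2 - τ))) ^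
          ((2 - τ) / 2) := by
    intro qt' rt' hqt' hrt' T u G h
    have a1 : (1 - τ / 2)⁻¹ = 2 / (2 - τ) := by
      rw [show 1 - τ / 2 = (2 - τ) / 2 by ring, inv_div]
    have a2 : (1 - (1 - τ) / 2)⁻¹ = 2 / (1 + τ) := by
      rw [show 1 - (1 - τ) / 2 = (1 + τ) / 2 by ring, inv_div]
    rw [ENNReal.eq_ofReal_of_conjugate (by linarith) (by linarith) hqt hqt', a1,
      ENNReal.eq_ofReal_of_conjugate (by linarith) (by linarith) hrt hrt', a2,
      mixNorm_ofReal h.isSchwartz_source (div_pos two_pos (by linarith))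
        ((one_le_div (by linarith)).2 (by linarith)), one_div_div]
  rcases hθ0.eq_or_lt with rfl | hθ
  · obtain ⟨K, hKt, hK⟩ := exists_eLpNorm'_two_bound hτ0 hτ1
    refine ⟨K, hKt, fun qt' rt' hqt' hrt' T hT u G h hfin => ?_⟩
    rw [hG qt' rt' hqt' hrt' T u G h] at hfin ⊢
    have hfin' := fun hh => hfin ((ENNReal.rpow_eq_top_iff_of_pos (by linarith)).2 hh)
    have hq' : q = ⊤ := by simpa using hq
    have hr' : r = ENNReal.ofReal 2 := by
      rw [ENNReal.eq_ofReal_of_inv_eq (by norm_num) hr]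
      norm_num
    rw [e2, hq', hr', mixNorm, eLpNorm_exponent_top]
    refine eLpNormEssSup_le_of_ae_enorm_bound
      ((ae_restrict_mem measurableSet_Ioc).mono fun t ht => ?_)
    have ht' : t ∈ Set.Icc 0 T := ⟨ht.1.le, ht.2⟩
    rw [enorm_toReal_eLpNorm_ofReal (h.isSchwartz t ht') one_le_two]
    exact hK T hT u G h hfin' t ht'
  · obtain ⟨K, hKt, hK⟩ := exists_strichartz_bound hθ hθ1 hτ0 hτ1
    refine ⟨K, hKt, fun qt' rt' hqt' hrt' T hT u G h hfin => ?_⟩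
    rw [hG qt' rt' hqt' hrt' T u G h] at hfin ⊢
    have hfin' := fun hh => hfin ((ENNReal.rpow_eq_top_iff_of_pos (by linarith)).2 hh)
    rw [e2, ENNReal.eq_ofReal_of_inv_eq (by positivity) hq,
      ENNReal.eq_ofReal_of_inv_eq (by linarith) hr, inv_div, inv_div,
      mixNorm_ofReal h.isSchwartz (by positivity)
        ((one_le_div (by linarith)).2 (by linarith)), one_div_div]
    exact hK T hT u G h hfin'

/-- Strichartz estimates in two space dimensions. -/
theorem strichartz_estimate (q r qt rt : ℝ≥0∞) (h1 : Admissible q r) (h2 : Admissible qt rt) :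
    ∃ C > (0:ℝ), ∀ qt' rt' : ℝ≥0∞, 1/qt + 1/qt' = 1 → 1/rt + 1/rt' = 1 →
      ∀ T > (0:ℝ), ∀ u G : ℝ → EuclideanSpace ℝ (Fin 2) → ℂ,
        ContDiff ℝ ∞ (Function.uncurry u) → ContDiff ℝ ∞ (Function.uncurry G) →
        (∀ t ∈ Set.Icc (0:ℝ) T, IsSchwartz (u t)) →
        (∀ t ∈ Set.Icc (0:ℝ) T, IsSchwartz (G t)) →
        (∀ t ∈ Set.Icc (0:ℝ) T, ∀ x,
          Complex.I * deriv (fun s => u s x) t + lap (u t) x = G t x) →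
        mixNorm T q r u ≤ ENNReal.ofReal C * (eLpNorm (u 0) 2 volume + mixNorm T qt' rt' G) := by
  obtain ⟨K, hKt, hK⟩ := exists_mixNorm_bound h1 h2
  refine ⟨K.toReal + 1, by positivity, fun qt' rt' hqt' hrt' T hT u G hu hG hus hGs heq => ?_⟩
  rcases eq_or_ne (mixNorm T qt' rt' G) ⊤ with htop | htop
  · rw [htop, add_top, ENNReal.mul_top]
    · exact le_top
    · simp only [ne_eq, ENNReal.ofReal_eq_zero, not_le]
      positivity
  · refine (hK qt' rt' hqt' hrt' T hT.le u G ⟨hu, hG, hus, hGs, heq⟩ htop).trans ?_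
    refine mul_le_mul_left ?_ _
    rw [ENNReal.le_ofReal_iff_toReal_le hKt (by positivity)]
    linarith

end
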